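/- Every planar graph with no cycle of length 5 and no cycle of length 6 is (3,1)-choosable. -/

import Mathlib

open Set

namespace ChoosSep

/-- `G` has a cycle of length `n`. -/
def HasCycleLen {V : Type} (G : SimpleGraph V) (n : ℕ) : Prop :=
  ∃ (v : V) (c : G.Walk v v), c.IsCycle ∧ c.length = n

/-- `G` has a proper coloring choosing each color from the list `L v`. -/
def ColorableWith {V : Type} (G : SimpleGraph V) (L : V → Finset ℕ) : Prop :=
  ∃ φ : V → ℕ, (∀ v, φ v ∈ L v) ∧ ∀ ⦃u v⦄, G.Adj u v → φ u ≠ φ v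

/-- `G` is `(k,d)`-choosable: it has an `L`-coloring for every list assignment
giving each vertex at least `k` colors and any two adjacent vertices at most `d`
common colors. -/
def Choosable {V : Type} (G : SimpleGraph V) (k d : ℕ) : Prop :=
  ∀ L : V → Finset ℕ, (∀ v, k ≤ (L v).card) →
    (∀ ⦃u v⦄, G.Adj u v → ((L u) ∩ (L v)).card ≤ d) →
    ColorableWith G L

/-- The closed straight segment between two points of the plane. -/
def seg (x y : ℝ × ℝ) : Set (ℝ × ℝ) := segment ℝ x y

/-- A straight-line plane embedding of `G`: vertices go to distinct points, edges are
drawn as straight segments, two distinct edges meet only in common endpoints, and no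
vertex lies on the drawing of an edge it does not belong to.  By Fáry's theorem a
finite simple graph admits such an embedding iff it is planar. -/
structure PlaneEmb {V : Type} (G : SimpleGraph V) where
  pos : V → ℝ × ℝ
  inj : Function.Injective pos
  edges_meet : ∀ ⦃a b c d : V⦄, G.Adj a b → G.Adj c d → s(a, b) ≠ s(c, d) →
    seg (pos a) (pos b) ∩ seg (pos c) (pos d) ⊆ ({pos a, pos b} ∩ {pos c, pos d} : Set (ℝ × ℝ))
  vertex_off : ∀ ⦃a b v : V⦄, G.Adj a b → v ≠ a → v ≠ b → pos v ∉ seg (pos a) (pos b)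

/-- `G` is planar: it admits a plane embedding. -/
def IsPlanar {V : Type} (G : SimpleGraph V) : Prop := Nonempty (PlaneEmb G)

section
open scoped Classical

/-! ### Weights of orbits -/

/-- The reciprocal of the length of the orbit of `x` under `f`. -/
noncomputable def orbWt {α : Type*} (f : α → α) (x : α) : ℚ :=
  1 / (Function.minimalPeriod f x : ℚ)

theorem orbWt_nonneg {α : Type*} (f : α → α) (x : α) : 0 ≤ orbWt f x := by
  unfold orbWt; positivity

theorem orbWt_of_fixed {α : Type*} {f : α → α} {x : α} (h : f x = x) : orbWt f x = 1 := by
  have : Function.minimalPeriod f x = 1 := Function.minimalPeriod_eq_one_iff_isFixedPt.2 h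
  simp [orbWt, this]

theorem sum_comp_of_invariant {α : Type*} [Fintype α] {f : α → α} (hf : Function.Injective f)
    {S : Finset α} (hS : ∀ x ∈ S, f x ∈ S) (g : α → ℚ) :
    ∑ x ∈ S, g (f x) = ∑ x ∈ S, g x := by
  have himg : S.image f = S :=
    Finset.eq_of_subset_of_card_le (Finset.image_subset_iff.2 hS)
      (Finset.card_image_of_injective _ hf).ge
  conv_rhs => rw [← himg]
  rw [Finset.sum_image (fun a _ b _ h => hf h)]

theorem compl_invariant {α : Type*} [Fintype α] {f : α → α} (hf : Function.Injective f)
    {S : Finset α} (hS : ∀ x ∈ S, f x ∈ S) : ∀ x ∈ Sᶜ, f x ∈ Sᶜ := by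
  have himg : S.image f = S :=
    Finset.eq_of_subset_of_card_le (Finset.image_subset_iff.2 hS)
      (Finset.card_image_of_injective _ hf).ge
  intro x hx
  rw [Finset.mem_compl] at hx ⊢
  intro h
  rw [← himg, Finset.mem_image] at h
  obtain ⟨y, hy, hyx⟩ := h
  exact hx (hf hyx ▸ hy)

/-- The orbit of `x` under `f`, as a finset. -/
noncomputable def orb {α : Type*} (f : α → α) (x : α) : Finset α :=
  (Finset.range (Function.minimalPeriod f x)).image (fun k => f^[k] x)

theorem mem_periodicPts_of_injective {α : Type*} [Fintype α] {f : α → α}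
    (hf : Function.Injective f) (x : α) : x ∈ Function.periodicPts f :=
  Function.Injective.mem_periodicPts hf x

theorem self_mem_orb {α : Type*} [Fintype α] {f : α → α}
    (hf : Function.Injective f) (x : α) : x ∈ orb f x := by
  have := Function.minimalPeriod_pos_of_mem_periodicPts (mem_periodicPts_of_injective hf x)
  exact Finset.mem_image.2 ⟨0, by simpa using this, rfl⟩

theorem orb_invariant {α : Type*} [Fintype α] {f : α → α}
    (hf : Function.Injective f) (x : α) : ∀ y ∈ orb f x, f y ∈ orb f x := by
  intro y hy
  obtain ⟨k, hk, rfl⟩ := Finset.mem_image.1 hy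
  have hpos := Function.minimalPeriod_pos_of_mem_periodicPts (mem_periodicPts_of_injective hf x)
  refine Finset.mem_image.2 ⟨(k + 1) % Function.minimalPeriod f x, ?_, ?_⟩
  · simpa using Nat.mod_lt _ hpos
  · show f^[_] x = f (f^[k] x)
    rw [Function.iterate_mod_minimalPeriod_eq, Function.iterate_succ_apply']

theorem orb_subset {α : Type*} {f : α → α} {S : Finset α} (hS : ∀ x ∈ S, f x ∈ S) {x : α} (hx : x ∈ S) :
    orb f x ⊆ S := by
  intro y hy
  obtain ⟨k, -, rfl⟩ := Finset.mem_image.1 hy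
  exact Set.MapsTo.iterate (f := f) (s := (S : Set α)) (fun z hz => hS z hz) k hx

theorem sum_orbWt_orb {α : Type*} [Fintype α] {f : α → α}
    (hf : Function.Injective f) (x : α) : ∑ y ∈ orb f x, orbWt f y = 1 := by
  have hpos := Function.minimalPeriod_pos_of_mem_periodicPts (mem_periodicPts_of_injective hf x)
  unfold orb
  rw [Finset.sum_image]
  · have : ∀ k ∈ Finset.range (Function.minimalPeriod f x),
        orbWt f (f^[k] x) = 1 / (Function.minimalPeriod f x : ℚ) := by
      intro k _
      unfold orbWt
      rw [Function.minimalPeriod_apply_iterate (mem_periodicPts_of_injective hf x)]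
    rw [Finset.sum_congr rfl this]
    simp
    field_simp
  · intro i hi j hj h
    exact Function.iterate_injOn_Iio_minimalPeriod (by simpa using hi) (by simpa using hj) h

theorem one_le_sum_orbWt {α : Type*} [Fintype α] {f : α → α}
    (hf : Function.Injective f) {S : Finset α} (hS : ∀ x ∈ S, f x ∈ S) (hne : S.Nonempty) :
    1 ≤ ∑ y ∈ S, orbWt f y := by
  obtain ⟨x, hx⟩ := hne
  rw [← sum_orbWt_orb hf x]
  exact Finset.sum_le_sum_of_subset_of_nonneg (orb_subset hS hx)
    (fun y _ _ => orbWt_nonneg f y)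

/-- If `f` is obtained from `f'` by cutting out the two elements `d` and `e`, the number of
orbits goes up by at least one. -/
theorem sum_orbWt_cut {α : Type*} [Fintype α] {f f' : α → α} (hf : Function.Injective f)
    (hf' : Function.Injective f') {d e : α} (hde : d ≠ e) (hd : f d = d) (he : f e = e)
    (hd' : f' d ≠ d)
    (h : ∀ x, x ≠ d → x ≠ e → f' x ≠ d → f' x ≠ e → f x = f' x) :
    ∑ x, orbWt f' x + 1 ≤ ∑ x, orbWt f x := by
  set O : Finset α := orb f' d ∪ orb f' e with hO
  have hO' : ∀ x ∈ O, f' x ∈ O := by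
    intro x hx
    rcases Finset.mem_union.1 hx with hx | hx
    · exact Finset.mem_union_left _ (orb_invariant hf' d x hx)
    · exact Finset.mem_union_right _ (orb_invariant hf' e x hx)
  have hdO : d ∈ O := Finset.mem_union_left _ (self_mem_orb hf' d)
  have heO : e ∈ O := Finset.mem_union_right _ (self_mem_orb hf' e)
  have hOc' : ∀ x ∈ Oᶜ, f' x ∈ Oᶜ := compl_invariant hf' hO'
  have hagree : ∀ x ∈ Oᶜ, f x = f' x := by
    intro x hx
    have hx' := hOc' x hx
    rw [Finset.mem_compl] at hx hx'
    exact h x (fun q => hx (q ▸ hdO)) (fun q => hx (q ▸ heO)) (fun q => hx' (q ▸ hdO))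
      (fun q => hx' (q ▸ heO))
  have hOc : ∀ x ∈ Oᶜ, f x ∈ Oᶜ := fun x hx => by rw [hagree x hx]; exact hOc' x hx
  have hOf : ∀ x ∈ O, f x ∈ O := by simpa using compl_invariant hf hOc
  have hiter : ∀ x ∈ Oᶜ, ∀ k, f^[k] x = f'^[k] x ∧ f'^[k] x ∈ Oᶜ := by
    intro x hx k
    induction k with
    | zero => exact ⟨rfl, hx⟩
    | succ k ih =>
      rw [Function.iterate_succ_apply', Function.iterate_succ_apply', ih.1]
      exact ⟨hagree _ ih.2, hOc' _ ih.2⟩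
  have hwt : ∀ x ∈ Oᶜ, orbWt f x = orbWt f' x := by
    intro x hx
    unfold orbWt
    congr 2
    apply Nat.dvd_antisymm
    · apply Function.IsPeriodicPt.minimalPeriod_dvd
      show f^[_] x = x
      rw [(hiter x hx _).1]
      exact Function.isPeriodicPt_minimalPeriod f' x
    · apply Function.IsPeriodicPt.minimalPeriod_dvd
      show f'^[_] x = x
      rw [← (hiter x hx _).1]
      exact Function.isPeriodicPt_minimalPeriod f x
  have key : ∑ x ∈ O, orbWt f' x + 1 ≤ ∑ x ∈ O, orbWt f x := by
    set R := O \ {d, e} with hR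
    have hsplit : ∑ x ∈ O, orbWt f x = ∑ x ∈ R, orbWt f x + 2 := by
      rw [hR, ← Finset.sum_sdiff (s₁ := {d, e}) (s₂ := O)
        (by intro z; simp; rintro (rfl | rfl) <;> assumption), Finset.sum_pair hde,
        orbWt_of_fixed hd, orbWt_of_fixed he]
      norm_num
    rw [hsplit]
    by_cases hed : e ∈ orb f' d
    · have : O = orb f' d := by
        rw [hO]
        exact Finset.union_eq_left.2 (orb_subset (orb_invariant hf' d) hed)
      rw [this, sum_orbWt_orb hf']
      have : 0 ≤ ∑ x ∈ R, orbWt f x := Finset.sum_nonneg (fun x _ => orbWt_nonneg f x)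
      linarith
    · have h1 : ∑ x ∈ O, orbWt f' x ≤ 2 := by
        have := Finset.sum_union_inter (s₁ := orb f' d) (s₂ := orb f' e) (f := orbWt f')
        rw [sum_orbWt_orb hf', sum_orbWt_orb hf'] at this
        have h0 : 0 ≤ ∑ x ∈ orb f' d ∩ orb f' e, orbWt f' x :=
          Finset.sum_nonneg (fun x _ => orbWt_nonneg f' x)
        rw [hO]; linarith
      have h2 : 1 ≤ ∑ x ∈ R, orbWt f x := by
        apply one_le_sum_orbWt hf
        · intro x hx
          rw [hR, Finset.mem_sdiff] at hx ⊢
          refine ⟨hOf x hx.1, ?_⟩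
          intro hx2
          apply hx.2
          simp only [Finset.mem_insert, Finset.mem_singleton] at hx2 ⊢
          rcases hx2 with q | q
          · exact Or.inl (hf (q.trans hd.symm))
          · exact Or.inr (hf (q.trans he.symm))
        · exact ⟨f' d, by
            rw [hR, Finset.mem_sdiff]
            have hdd : f' d ≠ e := fun q =>
              hed (q ▸ orb_invariant hf' d d (self_mem_orb hf' d))
            exact ⟨hO' d hdO, by simp [hd', hdd]⟩⟩
      linarith
  rw [← Finset.sum_compl_add_sum O, ← Finset.sum_compl_add_sum O (orbWt f),
    Finset.sum_congr rfl hwt]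
  linarith

end

section
open scoped Classical

/-! ### Cyclic successors and rotation systems -/

/-- `b` is the cyclic successor of `a` in `s`, ordered by `key`. -/
def CycNext {α K : Type*} [LinearOrder K] (key : α → K) (s : Finset α) (a b : α) : Prop :=
  b ∈ s ∧ ((key a < key b ∧ ∀ c ∈ s, key a < key c → key b ≤ key c) ∨
    ((∀ c ∈ s, key c ≤ key a) ∧ ∀ c ∈ s, key b ≤ key c))

theorem exists_cycNext {α K : Type*} [LinearOrder K] (key : α → K) {s : Finset α} {a : α}
    (ha : a ∈ s) : ∃ b, CycNext key s a b := by
  by_cases h : ∃ c ∈ s, key a < key c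
  · obtain ⟨c, hc, hac⟩ := h
    obtain ⟨b, hb, hmin⟩ := Finset.exists_min_image (s.filter (fun c => key a < key c)) key
      ⟨c, Finset.mem_filter.2 ⟨hc, hac⟩⟩
    rw [Finset.mem_filter] at hb
    exact ⟨b, hb.1, Or.inl ⟨hb.2, fun d hd had => hmin d (Finset.mem_filter.2 ⟨hd, had⟩)⟩⟩
  · push Not at h
    obtain ⟨b, hb, hmin⟩ := Finset.exists_min_image s key ⟨a, ha⟩
    exact ⟨b, hb, Or.inr ⟨h, hmin⟩⟩

theorem CycNext.unique {α K : Type*} [LinearOrder K] {key : α → K} {s : Finset α} {a b b' : α}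
    (hinj : Set.InjOn key s) (h : CycNext key s a b) (h' : CycNext key s a b') : b = b' := by
  obtain ⟨hb, h⟩ := h
  obtain ⟨hb', h'⟩ := h'
  apply hinj hb hb'
  rcases h with ⟨h1, h2⟩ | ⟨h1, h2⟩ <;> rcases h' with ⟨h1', h2'⟩ | ⟨h1', h2'⟩
  · exact le_antisymm (h2 _ hb' h1') (h2' _ hb h1)
  · exact absurd h1 (not_lt.2 (h1' _ hb))
  · exact absurd h1' (not_lt.2 (h1 _ hb'))
  · exact le_antisymm (h2 _ hb') (h2' _ hb)

theorem CycNext.mono {α K : Type*} [LinearOrder K] {key : α → K} {s t : Finset α} {a b : α}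
    (h : CycNext key t a b) (hst : s ⊆ t) (hb : b ∈ s) : CycNext key s a b :=
  ⟨hb, h.2.imp (fun h => ⟨h.1, fun c hc => h.2 c (hst hc)⟩)
    (fun h => ⟨fun c hc => h.1 c (hst hc), fun c hc => h.2 c (hst hc)⟩)⟩

theorem cycNext_trans {α K : Type*} [LinearOrder K] {key : α → K} {s : Finset α}
    (hinj : Set.InjOn key s) {nxt : α → α} (hn : ∀ a ∈ s, CycNext key s a (nxt a))
    {S : Set α} {v : α} (hv : v ∈ s) (hvS : v ∈ S) (hS : ∀ a ∈ s, a ∈ S → nxt a ∈ S) :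
    ∀ w ∈ s, w ∈ S := by
  by_contra! hcon
  obtain ⟨w0, hw0, hw0S⟩ := hcon
  obtain ⟨M, hM, hMmax⟩ := Finset.exists_max_image (s.filter (· ∈ S)) key
    ⟨v, Finset.mem_filter.2 ⟨hv, hvS⟩⟩
  rw [Finset.mem_filter] at hM
  obtain ⟨w, hw, hwmin⟩ := Finset.exists_min_image (s.filter (· ∉ S)) key
    ⟨w0, Finset.mem_filter.2 ⟨hw0, hw0S⟩⟩
  rw [Finset.mem_filter] at hw
  have hmS := hS M hM.1 hM.2
  obtain ⟨hms, hm⟩ := hn M hM.1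
  rcases hm with ⟨h1, -⟩ | ⟨-, hmin⟩
  · exact absurd h1 (not_lt.2 (hMmax _ (Finset.mem_filter.2 ⟨hms, hmS⟩)))
  have hlt : key (nxt M) < key w := lt_of_le_of_ne (hmin w hw.1) (fun h => by
    have := hinj hms hw.1 h
    exact hw.2 (this ▸ hmS))
  obtain ⟨p, hp, hpmax⟩ := Finset.exists_max_image (s.filter (fun c => key c < key w)) key
    ⟨_, Finset.mem_filter.2 ⟨hms, hlt⟩⟩
  rw [Finset.mem_filter] at hp
  have hpS : p ∈ S := by
    by_contra hpS
    exact absurd hp.2 (not_lt.2 (hwmin p (Finset.mem_filter.2 ⟨hp.1, hpS⟩)))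
  have hbS := hS p hp.1 hpS
  obtain ⟨hbs, hb⟩ := hn p hp.1
  rcases hb with ⟨h1, h2⟩ | ⟨h1, -⟩
  · have hle := h2 w hw.1 hp.2
    rcases hle.lt_or_eq with h | h
    · exact absurd h1 (not_lt.2 (hpmax _ (Finset.mem_filter.2 ⟨hbs, h⟩)))
    · exact hw.2 (hinj hbs hw.1 h ▸ hbS)
  · exact absurd hp.2 (not_lt.2 (h1 w hw.1))

/-- A rotation system: a cyclic permutation of the neighbours of every vertex. -/
structure Rot {V : Type*} (H : SimpleGraph V) where
  nxt : V → V → V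
  adj : ∀ {u v}, H.Adj u v → H.Adj u (nxt u v)
  trans : ∀ (u v : V) (S : Set V), H.Adj u v → v ∈ S →
    (∀ a ∈ S, H.Adj u a → nxt u a ∈ S) → ∀ w, H.Adj u w → w ∈ S

namespace Rot
variable {V : Type*} {H : SimpleGraph V} (R : Rot H)

theorem surj {u w : V} (h : H.Adj u w) : ∃ v, H.Adj u v ∧ R.nxt u v = w := by
  have := R.trans u (R.nxt u w) {w | ∃ v, H.Adj u v ∧ R.nxt u v = w} (R.adj h) ⟨w, h, rfl⟩
    (fun a _ ha => ⟨a, ha, rfl⟩) w h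
  exact this

theorem inj [Fintype V] {u v w : V} (hv : H.Adj u v) (hw : H.Adj u w)
    (h : R.nxt u v = R.nxt u w) : v = w := by
  let s : Finset V := Finset.univ.filter (H.Adj u)
  have hms : ∀ x, x ∈ s ↔ H.Adj u x := fun x => by simp [s]
  have himg : s.image (R.nxt u) = s := by
    ext x
    rw [Finset.mem_image]
    constructor
    · rintro ⟨y, hy, rfl⟩
      exact (hms _).2 (R.adj ((hms _).1 hy))
    · intro hx
      obtain ⟨y, hy, hyx⟩ := R.surj ((hms _).1 hx)
      exact ⟨y, (hms _).2 hy, hyx⟩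
  have := Finset.card_image_iff.1 (by rw [himg] : (s.image (R.nxt u)).card = s.card)
  exact this ((hms _).2 hv) ((hms _).2 hw) h

/-- The face map on darts. -/
noncomputable def face (δ : V × V) : V × V :=
  if H.Adj δ.1 δ.2 then (δ.2, R.nxt δ.2 δ.1) else δ

theorem face_of_adj {a b : V} (h : H.Adj a b) : R.face (a, b) = (b, R.nxt b a) := if_pos h

theorem face_of_not_adj {δ : V × V} (h : ¬ H.Adj δ.1 δ.2) : R.face δ = δ := if_neg h

theorem face_adj {δ : V × V} (h : H.Adj δ.1 δ.2) : H.Adj (R.face δ).1 (R.face δ).2 := by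
  obtain ⟨a, b⟩ := δ
  rw [R.face_of_adj h]
  exact R.adj h.symm

theorem face_injective [Fintype V] : Function.Injective R.face := by
  rintro ⟨a, b⟩ ⟨c, d⟩ h
  by_cases h1 : H.Adj a b <;> by_cases h2 : H.Adj c d
  · rw [R.face_of_adj h1, R.face_of_adj h2, Prod.mk.injEq] at h
    obtain ⟨rfl, h⟩ := h
    rw [R.inj h1.symm h2.symm h]
  · have := R.face_adj (δ := (a, b)) h1
    rw [h, R.face_of_not_adj (δ := (c, d)) h2] at this
    exact absurd this h2
  · have := R.face_adj (δ := (c, d)) h2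
    rw [← h, R.face_of_not_adj (δ := (a, b)) h1] at this
    exact absurd this h1
  · rwa [R.face_of_not_adj (δ := (a, b)) h1, R.face_of_not_adj (δ := (c, d)) h2] at h

end Rot

/-- The number of darts, i.e. ordered pairs of adjacent vertices. -/
noncomputable def darts {V : Type*} [Fintype V] (H : SimpleGraph V) : Finset (V × V) :=
  Finset.univ.filter (fun δ => H.Adj δ.1 δ.2)

theorem mem_darts {V : Type*} [Fintype V] {H : SimpleGraph V} {δ : V × V} :
    δ ∈ darts H ↔ H.Adj δ.1 δ.2 := by simp [darts]

/-- Euler's inequality `E ≤ V + F` for a rotation system. -/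
def Rot.Euler {V : Type*} [Fintype V] {H : SimpleGraph V} (R : Rot H) : Prop :=
  ((darts H).card : ℚ) ≤ 2 * Fintype.card V + 2 * ∑ δ ∈ darts H, orbWt R.face δ

/-- Deleting an edge from a rotation system preserves Euler's inequality. -/
theorem Rot.Euler.delete {V : Type*} [Fintype V] {H H' : SimpleGraph V} {R : Rot H} {R' : Rot H'}
    (h : R'.Euler) {p q : V} (hpq' : H'.Adj p q)
    (hH : ∀ a b, H.Adj a b ↔ H'.Adj a b ∧ s(a, b) ≠ s(p, q))
    (hR : ∀ a b, H.Adj a b → H.Adj a (R'.nxt a b) → R.nxt a b = R'.nxt a b) : R.Euler := by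
  have hne := hpq'.ne
  have hd : ¬ H.Adj p q := fun h => ((hH _ _).1 h).2 rfl
  have he : ¬ H.Adj q p := fun h => hd h.symm
  have hcut := sum_orbWt_cut R.face_injective R'.face_injective (d := (p, q)) (e := (q, p))
    (by simp [hne]) (R.face_of_not_adj hd) (R.face_of_not_adj he)
    (by rw [R'.face_of_adj hpq']; simp [hne.symm]) (by
      rintro ⟨a, b⟩ h1 h2 h3 h4
      by_cases hab : H'.Adj a b
      · have hab2 : H.Adj a b := (hH _ _).2 ⟨hab, by
          rw [Ne, Sym2.eq_iff]; simpa [not_or, Prod.ext_iff] using And.intro h1 h2⟩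
        rw [R.face_of_adj hab2, R'.face_of_adj hab]
        rw [R'.face_of_adj hab] at h3 h4
        rw [hR b a hab2.symm]
        exact (hH _ _).2 ⟨R'.adj hab.symm, by
          rw [Ne, Sym2.eq_iff]; simpa [not_or, Prod.ext_iff] using And.intro h3 h4⟩
      · rw [R'.face_of_not_adj (δ := (a, b)) hab, R.face_of_not_adj (δ := (a, b))
          (fun h => hab ((hH _ _).1 h).1)])
  have hD : darts H' = insert (p, q) (insert (q, p) (darts H)) := by
    ext ⟨a, b⟩
    simp only [mem_darts, Finset.mem_insert, hH, Prod.mk.injEq, Ne, Sym2.eq_iff]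
    constructor
    · intro h; tauto
    · rintro (⟨rfl, rfl⟩ | ⟨rfl, rfl⟩ | h)
      · exact hpq'
      · exact hpq'.symm
      · exact h.1
  have hcard : (darts H').card = (darts H).card + 2 := by
    rw [hD, Finset.card_insert_of_notMem, Finset.card_insert_of_notMem]
    · simpa [mem_darts] using he
    · simp [mem_darts, hd, hne]
  have hsum : ∀ {K : SimpleGraph V} (S : Rot K), ∑ δ, orbWt S.face δ =
      ∑ δ ∈ darts K, orbWt S.face δ + ((Fintype.card (V × V) : ℚ) - (darts K).card) := by
    intro K S
    rw [← Finset.sum_add_sum_compl (darts K)]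
    congr 1
    rw [Finset.sum_congr rfl (g := fun _ => (1 : ℚ))]
    · rw [Finset.sum_const, Finset.card_compl, nsmul_eq_mul, mul_one,
        Nat.cast_sub (Finset.card_le_univ _)]
    · intro x hx
      rw [Finset.mem_compl, mem_darts] at hx
      exact orbWt_of_fixed (S.face_of_not_adj hx)
  rw [hsum, hsum, hcard] at hcut
  unfold Rot.Euler at h ⊢
  rw [hcard] at h
  push_cast at h hcut
  linarith

end

section
open scoped Classical

/-! ### Plane geometry -/

/-- Twice the signed area of the triangle `u v w`. -/
def cr (u v w : ℝ × ℝ) : ℝ := (v.1 - u.1) * (w.2 - u.2) - (v.2 - u.2) * (w.1 - u.1)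

theorem mem_seg_iff {x y z : ℝ × ℝ} : z ∈ seg x y ↔
    ∃ t : ℝ, 0 ≤ t ∧ t ≤ 1 ∧ z = (x.1 + t * (y.1 - x.1), x.2 + t * (y.2 - x.2)) := by
  unfold seg
  rw [segment_eq_image']
  constructor
  · rintro ⟨t, ⟨h0, h1⟩, rfl⟩
    exact ⟨t, h0, h1, by ext <;> simp⟩
  · rintro ⟨t, h0, h1, rfl⟩
    exact ⟨t, ⟨h0, h1⟩, by ext <;> simp⟩

theorem seg_comm (x y : ℝ × ℝ) : seg x y = seg y x := segment_symm ℝ x y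

/-- The point at parameter `t` on the line through `x` and `y`. -/
def pt (x y : ℝ × ℝ) (t : ℝ) : ℝ × ℝ := (x.1 + t * (y.1 - x.1), x.2 + t * (y.2 - x.2))

theorem pt_mem_seg (x y : ℝ × ℝ) {t : ℝ} (h0 : 0 ≤ t) (h1 : t ≤ 1) : pt x y t ∈ seg x y :=
  mem_seg_iff.2 ⟨t, h0, h1, rfl⟩

theorem cr_pt_mid (u w x y : ℝ × ℝ) (t : ℝ) :
    cr u (pt x y t) w = (1 - t) * cr u x w + t * cr u y w := by
  simp only [cr, pt]; ring

theorem cr_pt_right (u v x y : ℝ × ℝ) (t : ℝ) :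
    cr u v (pt x y t) = (1 - t) * cr u v x + t * cr u v y := by
  simp only [cr, pt]; ring

theorem cr_rotate (u v w : ℝ × ℝ) : cr v w u = cr u v w := by
  simp only [cr]; ring

theorem cr_add (u v w q : ℝ × ℝ) : cr u q w + cr u v q + cr q v w = cr u v w := by
  simp only [cr]; ring

@[simp] theorem cr_self_left (u w : ℝ × ℝ) : cr u u w = 0 := by simp [cr]
@[simp] theorem cr_self_right (u v : ℝ × ℝ) : cr u v v = 0 := by simp [cr]; ring
@[simp] theorem cr_self_outer (u v : ℝ × ℝ) : cr u v u = 0 := by simp [cr]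

theorem eq_pt_of_cr_mid_eq_zero {u v w q : ℝ × ℝ} (hΔ : 0 < cr u v w) (h : cr u q w = 0) :
    q = pt u w (cr u v q / cr u v w) := by
  have h1 : cr u v w * (q.1 - u.1) = cr u q w * (v.1 - u.1) + cr u v q * (w.1 - u.1) := by
    simp only [cr]; ring
  have h2 : cr u v w * (q.2 - u.2) = cr u q w * (v.2 - u.2) + cr u v q * (w.2 - u.2) := by
    simp only [cr]; ring
  rw [h] at h1 h2
  ext <;> simp only [pt] <;> field_simp <;> linarith

theorem eq_pt_of_cr_right_eq_zero {u v w q : ℝ × ℝ} (hΔ : 0 < cr u v w) (h : cr u v q = 0) :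
    q = pt u v (cr u q w / cr u v w) := by
  have h1 : cr u v w * (q.1 - u.1) = cr u q w * (v.1 - u.1) + cr u v q * (w.1 - u.1) := by
    simp only [cr]; ring
  have h2 : cr u v w * (q.2 - u.2) = cr u q w * (v.2 - u.2) + cr u v q * (w.2 - u.2) := by
    simp only [cr]; ring
  rw [h] at h1 h2
  ext <;> simp only [pt] <;> field_simp <;> linarith

theorem eq_of_cr_eq {u v w q r : ℝ × ℝ} (hΔ : 0 < cr u v w) (h : cr u q w = cr u r w)
    (h' : cr u v q = cr u v r) : q = r := by
  have h1 : cr u v w * (q.1 - r.1) = (cr u q w - cr u r w) * (v.1 - u.1) +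
      (cr u v q - cr u v r) * (w.1 - u.1) := by simp only [cr]; ring
  have h2 : cr u v w * (q.2 - r.2) = (cr u q w - cr u r w) * (v.2 - u.2) +
      (cr u v q - cr u v r) * (w.2 - u.2) := by simp only [cr]; ring
  rw [h, h', sub_self, sub_self, zero_mul, zero_mul, add_zero, mul_eq_zero] at h1 h2
  have := hΔ.ne'
  ext <;> grind

/-- Leaving the wedge at `u` spanned by `v` and `w` along a segment, one crosses one of
its two sides. -/
theorem exists_exit {a b a' b' : ℝ} (ha : 0 < a) (hb : 0 < b) (h : a' < 0 ∨ b' < 0) :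
    ∃ t : ℝ, 0 ≤ t ∧ t ≤ 1 ∧
      (((1 - t) * a + t * a' = 0 ∧ 0 ≤ (1 - t) * b + t * b') ∨
        ((1 - t) * b + t * b' = 0 ∧ 0 ≤ (1 - t) * a + t * a')) := by
  have aux : ∀ {a b a' b' : ℝ}, 0 < a → 0 < b → a' < 0 → a * b' - a' * b ≥ 0 →
      ∃ t : ℝ, 0 ≤ t ∧ t ≤ 1 ∧ ((1 - t) * a + t * a' = 0 ∧ 0 ≤ (1 - t) * b + t * b') := by
    intro a b a' b' ha hb ha' hd
    have hpos : 0 < a - a' := by linarith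
    refine ⟨a / (a - a'), by positivity, by rw [div_le_one hpos]; linarith, ?_, ?_⟩
    · field_simp; ring
    · have : (1 - a / (a - a')) * b + a / (a - a') * b' = (a * b' - a' * b) / (a - a') := by
        field_simp; ring
      rw [this]; positivity
  by_cases hd : a * b' - a' * b ≥ 0
  · by_cases ha' : a' < 0
    · obtain ⟨t, h0, h1, h2⟩ := aux ha hb ha' hd
      exact ⟨t, h0, h1, Or.inl h2⟩
    · have hb' := h.resolve_left ha'
      nlinarith
  · by_cases hb' : b' < 0
    · obtain ⟨t, h0, h1, h2⟩ := aux hb ha hb' (by linarith : b * a' - b' * a ≥ 0)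
      exact ⟨t, h0, h1, Or.inr h2⟩
    · have ha' := h.resolve_right hb'
      nlinarith

section plane
variable {V : Type} {G : SimpleGraph V} (e : PlaneEmb G)

/-- No edge enters the part of an empty wedge that is closer to the apex than all vertices
of the wedge. -/
theorem PlaneEmb.no_edge_in_wedge {u v w : V} (huv : G.Adj u v) (huw : G.Adj u w)
    (hΔ : 0 < cr (e.pos u) (e.pos v) (e.pos w))
    (hempty : ∀ n, G.Adj u n → 0 < cr (e.pos u) (e.pos n) (e.pos w) →
      0 < cr (e.pos u) (e.pos v) (e.pos n) → False)
    {s : ℝ} (hs : s ≤ cr (e.pos u) (e.pos v) (e.pos w))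
    (hmin : ∀ c, c ≠ u → 0 ≤ cr (e.pos u) (e.pos c) (e.pos w) →
      0 ≤ cr (e.pos u) (e.pos v) (e.pos c) →
      s ≤ cr (e.pos u) (e.pos c) (e.pos w) + cr (e.pos u) (e.pos v) (e.pos c))
    {c d : V} (hcd : G.Adj c d) {q : ℝ × ℝ} (hq : q ∈ seg (e.pos c) (e.pos d))
    (hA : 0 < cr (e.pos u) q (e.pos w)) (hB : 0 < cr (e.pos u) (e.pos v) q)
    (hS : cr (e.pos u) q (e.pos w) + cr (e.pos u) (e.pos v) q < s) : False := by
  wlog hle : cr (e.pos u) (e.pos c) (e.pos w) + cr (e.pos u) (e.pos v) (e.pos c) ≤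
    cr (e.pos u) q (e.pos w) + cr (e.pos u) (e.pos v) q generalizing c d
  · refine this hcd.symm (by rwa [seg_comm]) ?_
    obtain ⟨t, h0, h1, hqt⟩ := mem_seg_iff.1 hq
    change q = pt _ _ t at hqt
    rw [hqt, cr_pt_mid, cr_pt_right] at hle ⊢
    by_contra hcon
    rcases le_total (cr (e.pos u) (e.pos c) (e.pos w) + cr (e.pos u) (e.pos v) (e.pos c))
      (cr (e.pos u) (e.pos d) (e.pos w) + cr (e.pos u) (e.pos v) (e.pos d)) with h | h
    · nlinarith
    · nlinarith
  have hcu : c ≠ u := by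
    rintro rfl
    obtain ⟨t, h0, h1, hqt⟩ := mem_seg_iff.1 hq
    change q = pt _ _ t at hqt
    rw [hqt, cr_pt_mid, cr_self_left] at hA
    rw [hqt, cr_pt_right, cr_self_outer] at hB
    exact hempty d hcd (by by_contra h; nlinarith) (by by_contra h; nlinarith)
  have hdu : d ≠ u := by
    rintro rfl
    obtain ⟨t, h0, h1, hqt⟩ := mem_seg_iff.1 hq
    change q = pt _ _ t at hqt
    rw [hqt, cr_pt_mid, cr_self_left] at hA
    rw [hqt, cr_pt_right, cr_self_outer] at hB
    exact hempty c hcd.symm (by by_contra h; nlinarith) (by by_contra h; nlinarith)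
  have hneg : cr (e.pos u) (e.pos c) (e.pos w) < 0 ∨ cr (e.pos u) (e.pos v) (e.pos c) < 0 := by
    by_contra! h
    have := hmin c hcu h.1 h.2
    linarith
  obtain ⟨t, h0, h1, ht⟩ := exists_exit hA hB hneg
  rw [← cr_pt_mid, ← cr_pt_right] at ht
  set r := pt q (e.pos c) t with hr
  have hrS : cr (e.pos u) r (e.pos w) + cr (e.pos u) (e.pos v) r <
      cr (e.pos u) (e.pos v) (e.pos w) := by
    rw [hr, cr_pt_mid, cr_pt_right]
    nlinarith
  have hrseg : r ∈ seg (e.pos c) (e.pos d) :=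
    (convex_segment (𝕜 := ℝ) (e.pos c) (e.pos d)).segment_subset hq (left_mem_segment ℝ _ _)
      (pt_mem_seg q (e.pos c) h0 h1)
  have finish : ∀ {x : V}, G.Adj u x → r ∈ seg (e.pos u) (e.pos x) → r ≠ e.pos x →
      c ≠ x → False := by
    intro x hux hrx hrne hcx
    have := e.edges_meet hcd hux (by
      rw [Ne, Sym2.eq_iff]; rintro (⟨h, -⟩ | ⟨h, -⟩)
      · exact hcu h
      · exact hcx h) ⟨hrseg, hrx⟩
    obtain ⟨h1, h2⟩ := this
    have hru : r = e.pos u := by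
      rcases h2 with h | h
      · exact h
      · exact absurd h hrne
    rw [hru] at h1
    rcases h1 with h | h
    · exact hcu (e.inj h).symm
    · exact hdu (e.inj h).symm
  rcases ht with ⟨hz, hp⟩ | ⟨hz, hp⟩
  · rw [hz, zero_add] at hrS
    refine finish huw ?_ ?_ ?_
    · rw [eq_pt_of_cr_mid_eq_zero hΔ hz]
      exact pt_mem_seg _ _ (by positivity) (by rw [div_le_one hΔ]; exact hrS.le)
    · intro h
      rw [h] at hrS
      exact lt_irrefl _ hrS
    · rintro rfl
      rw [cr_self_right] at hle
      linarith
  · rw [hz, add_zero] at hrS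
    refine finish huv ?_ ?_ ?_
    · rw [eq_pt_of_cr_right_eq_zero hΔ hz]
      exact pt_mem_seg _ _ (by positivity) (by rw [div_le_one hΔ]; exact hrS.le)
    · intro h
      rw [h] at hrS
      exact lt_irrefl _ hrS
    · rintro rfl
      rw [cr_self_right] at hle
      linarith

/-- `G` with the additional edge `u p`. -/
def addEdge (G : SimpleGraph V) (u p : V) : SimpleGraph V := G ⊔ SimpleGraph.edge u p

theorem addEdge_adj {G : SimpleGraph V} {u p : V} (hup : u ≠ p) {a b : V} :
    (addEdge G u p).Adj a b ↔ G.Adj a b ∨ s(a, b) = s(u, p) := by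
  simp only [addEdge, SimpleGraph.sup_adj, SimpleGraph.edge_adj, Sym2.eq_iff]
  grind

/-- A segment that avoids the drawing can be added to it. -/
def PlaneEmb.add {u p : V} (hup : u ≠ p)
    (hv : ∀ c, c ≠ u → c ≠ p → e.pos c ∉ seg (e.pos u) (e.pos p))
    (he : ∀ c d q, G.Adj c d → q ∈ seg (e.pos c) (e.pos d) → q ∈ seg (e.pos u) (e.pos p) →
      q = e.pos u ∨ q = e.pos p) : PlaneEmb (addEdge G u p) where
  pos := e.pos
  inj := e.inj
  edges_meet := by
    have hseg : ∀ a b : V, s(a, b) = s(u, p) → seg (e.pos a) (e.pos b) = seg (e.pos u) (e.pos p)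
        ∧ ({e.pos a, e.pos b} : Set (ℝ × ℝ)) = {e.pos u, e.pos p} := by
      intro a b h
      rw [Sym2.eq_iff] at h
      rcases h with ⟨rfl, rfl⟩ | ⟨rfl, rfl⟩
      · exact ⟨rfl, rfl⟩
      · exact ⟨seg_comm _ _, Set.pair_comm _ _⟩
    have key : ∀ c d, G.Adj c d → seg (e.pos c) (e.pos d) ∩ seg (e.pos u) (e.pos p) ⊆
        ({e.pos c, e.pos d} ∩ {e.pos u, e.pos p} : Set (ℝ × ℝ)) := by
      rintro c d hcd q ⟨h1, h2⟩
      have h3 := he c d q hcd h1 h2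
      refine ⟨?_, h3⟩
      have : ∀ x, q = e.pos x → q ∈ ({e.pos c, e.pos d} : Set (ℝ × ℝ)) := by
        rintro x rfl
        by_contra hcon
        refine e.vertex_off hcd (v := x) ?_ ?_ h1
        · rintro rfl; exact hcon (Or.inl rfl)
        · rintro rfl; exact hcon (Or.inr rfl)
      rcases h3 with h | h
      · exact this u h
      · exact this p h
    intro a b c d hab hcd hne
    rw [addEdge_adj hup] at hab hcd
    rcases hab with hab | hab <;> rcases hcd with hcd | hcd
    · exact e.edges_meet hab hcd hne
    · rw [(hseg c d hcd).1, (hseg c d hcd).2]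
      exact key a b hab
    · rw [(hseg a b hab).1, (hseg a b hab).2, Set.inter_comm, Set.inter_comm {e.pos u, e.pos p}]
      exact key c d hcd
    · exact absurd (hab.trans hcd.symm) hne
  vertex_off := by
    intro a b v hab ha hb
    rw [addEdge_adj hup] at hab
    rcases hab with hab | hab
    · exact e.vertex_off hab ha hb
    · rw [Sym2.eq_iff] at hab
      rcases hab with ⟨rfl, rfl⟩ | ⟨rfl, rfl⟩
      · exact hv v ha hb
      · rw [seg_comm]; exact hv v hb ha

end plane
end

section
open scoped Classical

/-- No edge can be added to the drawing. -/
def PlaneEmb.Maximal {V : Type} {G : SimpleGraph V} (e : PlaneEmb G) : Prop :=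
  ∀ u p, u ≠ p → ¬ G.Adj u p →
    (∀ c, c ≠ u → c ≠ p → e.pos c ∉ seg (e.pos u) (e.pos p)) →
    (∀ c d q, G.Adj c d → q ∈ seg (e.pos c) (e.pos d) → q ∈ seg (e.pos u) (e.pos p) →
      q = e.pos u ∨ q = e.pos p) → False

theorem pt_zero (x y : ℝ × ℝ) : pt x y 0 = x := by ext <;> simp [pt]

theorem pt_one (x y : ℝ × ℝ) : pt x y 1 = y := by ext <;> simp [pt]

section plane
variable {V : Type} {G : SimpleGraph V} (e : PlaneEmb G)

theorem PlaneEmb.Maximal.outside [Fintype V] {e : PlaneEmb G} (hmax : e.Maximal) {u v w : V}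
    (huv : G.Adj u v) (huw : G.Adj u w)
    (hΔ : 0 < cr (e.pos u) (e.pos v) (e.pos w))
    (hempty : ∀ n, G.Adj u n → 0 < cr (e.pos u) (e.pos n) (e.pos w) →
      0 < cr (e.pos u) (e.pos v) (e.pos n) → False)
    {n : V} (hnu : n ≠ u) (hnv : n ≠ v) (hnw : n ≠ w)
    (hA : 0 ≤ cr (e.pos u) (e.pos n) (e.pos w)) (hB : 0 ≤ cr (e.pos u) (e.pos v) (e.pos n)) :
    cr (e.pos u) (e.pos v) (e.pos w) <
      cr (e.pos u) (e.pos n) (e.pos w) + cr (e.pos u) (e.pos v) (e.pos n) := by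
  by_contra! hcon
  obtain ⟨p, hp, hpmin⟩ := Finset.exists_min_image
    (Finset.univ.filter fun n => n ≠ u ∧ n ≠ v ∧ n ≠ w ∧ 0 ≤ cr (e.pos u) (e.pos n) (e.pos w) ∧
      0 ≤ cr (e.pos u) (e.pos v) (e.pos n))
    (fun n => cr (e.pos u) (e.pos n) (e.pos w) + cr (e.pos u) (e.pos v) (e.pos n))
    ⟨n, by simp [*]⟩
  have hpn := hpmin n (by simp [*])
  simp only [Finset.mem_filter, Finset.mem_univ, true_and] at hp hpmin
  obtain ⟨hpu, hpv, hpw, hpA, hpB⟩ := hp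
  have hs := hpn.trans hcon
  have hmin : ∀ c, c ≠ u → 0 ≤ cr (e.pos u) (e.pos c) (e.pos w) →
      0 ≤ cr (e.pos u) (e.pos v) (e.pos c) →
      cr (e.pos u) (e.pos p) (e.pos w) + cr (e.pos u) (e.pos v) (e.pos p) ≤
        cr (e.pos u) (e.pos c) (e.pos w) + cr (e.pos u) (e.pos v) (e.pos c) := by
    intro c hcu hcA hcB
    by_cases hcv : c = v
    · subst hcv; simpa using hs
    by_cases hcw : c = w
    · subst hcw; simpa using hs
    exact hpmin c ⟨hcu, hcv, hcw, hcA, hcB⟩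
  have hpA' : 0 < cr (e.pos u) (e.pos p) (e.pos w) := by
    refine lt_of_le_of_ne hpA fun h => ?_
    refine e.vertex_off huw hpu hpw ?_
    rw [eq_pt_of_cr_mid_eq_zero hΔ h.symm]
    exact pt_mem_seg _ _ (by positivity) (by rw [div_le_one hΔ]; linarith)
  have hpB' : 0 < cr (e.pos u) (e.pos v) (e.pos p) := by
    refine lt_of_le_of_ne hpB fun h => ?_
    refine e.vertex_off huv hpu hpv ?_
    rw [eq_pt_of_cr_right_eq_zero hΔ h.symm]
    exact pt_mem_seg _ _ (by positivity) (by rw [div_le_one hΔ]; linarith)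
  refine hmax u p hpu.symm (fun h => hempty p h hpA' hpB') ?_ ?_
  · intro c hcu hcp hc
    obtain ⟨t, h0, h1, hct⟩ := mem_seg_iff.1 hc
    change e.pos c = pt _ _ t at hct
    have ht1 : t < 1 := lt_of_le_of_ne h1 (by
      rintro rfl; rw [pt_one] at hct; exact hcp (e.inj hct))
    have := hmin c hcu (by rw [hct, cr_pt_mid, cr_self_left]; nlinarith)
      (by rw [hct, cr_pt_right, cr_self_outer]; nlinarith)
    rw [hct, cr_pt_mid, cr_pt_right, cr_self_outer, cr_self_left] at this
    nlinarith
  · intro c d q hcd hq hqs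
    obtain ⟨t, h0, h1, hqt⟩ := mem_seg_iff.1 hqs
    change q = pt _ _ t at hqt
    rcases h0.eq_or_lt with h | h0
    · left; rw [hqt, ← h, pt_zero]
    rcases h1.eq_or_lt with h | h1
    · right; rw [hqt, h, pt_one]
    exfalso
    refine e.no_edge_in_wedge huv huw hΔ hempty hs hmin hcd hq ?_ ?_ ?_
    · rw [hqt, cr_pt_mid, cr_self_left]; nlinarith
    · rw [hqt, cr_pt_right, cr_self_outer]; nlinarith
    · rw [hqt, cr_pt_mid, cr_pt_right, cr_self_outer, cr_self_left]; nlinarith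

theorem PlaneEmb.Maximal.corner [Fintype V] {e : PlaneEmb G} (hmax : e.Maximal) {u v w : V}
    (huv : G.Adj u v) (huw : G.Adj u w)
    (hΔ : 0 < cr (e.pos u) (e.pos v) (e.pos w))
    (hempty : ∀ n, G.Adj u n → 0 < cr (e.pos u) (e.pos n) (e.pos w) →
      0 < cr (e.pos u) (e.pos v) (e.pos n) → False) :
    G.Adj v w ∧
    (∀ n, G.Adj w n → 0 < cr (e.pos w) (e.pos n) (e.pos v) →
      0 < cr (e.pos w) (e.pos u) (e.pos n) → False) ∧
    (∀ n, G.Adj v n → 0 < cr (e.pos v) (e.pos n) (e.pos u) →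
      0 < cr (e.pos v) (e.pos w) (e.pos n) → False) := by
  set Δ := cr (e.pos u) (e.pos v) (e.pos w) with hΔdef
  have hvw : v ≠ w := by rintro rfl; simp [hΔdef] at hΔ
  have hmin : ∀ c, c ≠ u → 0 ≤ cr (e.pos u) (e.pos c) (e.pos w) →
      0 ≤ cr (e.pos u) (e.pos v) (e.pos c) →
      Δ ≤ cr (e.pos u) (e.pos c) (e.pos w) + cr (e.pos u) (e.pos v) (e.pos c) := by
    intro c hcu hcA hcB
    by_cases hcv : c = v
    · subst hcv; simp [hΔdef]
    by_cases hcw : c = w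
    · subst hcw; simp [hΔdef]
    exact (hmax.outside huv huw hΔ hempty hcu hcv hcw hcA hcB).le
  have hno : ∀ {c d : V}, G.Adj c d → ∀ t : ℝ, 0 ≤ t → t ≤ 1 →
      0 < (1 - t) * cr (e.pos u) (e.pos c) (e.pos w) + t * cr (e.pos u) (e.pos d) (e.pos w) →
      0 < (1 - t) * cr (e.pos u) (e.pos v) (e.pos c) + t * cr (e.pos u) (e.pos v) (e.pos d) →
      (1 - t) * cr (e.pos u) (e.pos c) (e.pos w) + t * cr (e.pos u) (e.pos d) (e.pos w) +
      ((1 - t) * cr (e.pos u) (e.pos v) (e.pos c) + t * cr (e.pos u) (e.pos v) (e.pos d)) < Δ →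
      False := by
    intro c d hcd t h0 h1 hA hB hS
    rw [← cr_pt_mid, ← cr_pt_right] at hS
    rw [← cr_pt_mid] at hA
    rw [← cr_pt_right] at hB
    exact e.no_edge_in_wedge huv huw hΔ hempty le_rfl hmin hcd (pt_mem_seg _ _ h0 h1) hA hB hS
  have hsmall : ∀ {a b : ℝ}, 0 < b → ∃ t : ℝ, 0 < t ∧ t ≤ 1 ∧ 0 < (1 - t) * b + t * a := by
    intro a b hb
    have hpos : 0 < b + |a| := by positivity
    have hk : b / (2 * (b + |a|)) * (b + |a|) = b / 2 := by field_simp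
    have h0 : 0 < b / (2 * (b + |a|)) := by positivity
    refine ⟨b / (2 * (b + |a|)), h0, ?_, ?_⟩
    · rw [div_le_one (by positivity)]; linarith [abs_nonneg a]
    · nlinarith [neg_abs_le a]
  refine ⟨?_, ?_, ?_⟩
  · by_contra hnadj
    refine hmax v w hvw hnadj ?_ ?_
    · intro c hcv hcw hc
      obtain ⟨t, h0, h1, hct⟩ := mem_seg_iff.1 hc
      change e.pos c = pt _ _ t at hct
      have hA : cr (e.pos u) (e.pos c) (e.pos w) = (1 - t) * Δ := by
        rw [hct, cr_pt_mid, cr_self_right]; ring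
      have hB : cr (e.pos u) (e.pos v) (e.pos c) = t * Δ := by
        rw [hct, cr_pt_right, cr_self_right]; ring
      have hcu : c ≠ u := by
        rintro rfl
        simp only [cr_self_left, cr_self_outer] at hA hB
        nlinarith
      have := hmax.outside huv huw hΔ hempty hcu hcv hcw (by rw [hA]; nlinarith)
        (by rw [hB]; nlinarith)
      rw [hA, hB] at this
      nlinarith
    · intro c d q hcd hq hqs
      obtain ⟨t, h0, h1, hqt⟩ := mem_seg_iff.1 hqs
      change q = pt _ _ t at hqt
      rcases h0.eq_or_lt with h | h0
      · left; rw [hqt, ← h, pt_zero]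
      rcases h1.eq_or_lt with h | h1
      · right; rw [hqt, h, pt_one]
      exfalso
      have hA : cr (e.pos u) q (e.pos w) = (1 - t) * Δ := by
        rw [hqt, cr_pt_mid, cr_self_right]; ring
      have hB : cr (e.pos u) (e.pos v) q = t * Δ := by
        rw [hqt, cr_pt_right, cr_self_right]; ring
      have hA0 : 0 < (1 - t) * Δ := mul_pos (by linarith) hΔ
      have hB0 : 0 < t * Δ := mul_pos h0 hΔ
      have hoff : ∀ x, 0 < cr (e.pos u) (e.pos x) (e.pos w) →
          0 < cr (e.pos u) (e.pos v) (e.pos x) →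
          cr (e.pos u) (e.pos x) (e.pos w) + cr (e.pos u) (e.pos v) (e.pos x) = Δ → False := by
        intro x hxA hxB hxS
        have hxu : x ≠ u := by rintro rfl; simp at hxA
        have hxv : x ≠ v := by rintro rfl; simp at hxB
        have hxw : x ≠ w := by rintro rfl; simp at hxA
        have := hmax.outside huv huw hΔ hempty hxu hxv hxw hxA.le hxB.le
        linarith
      -- both endpoints lie on the line through `v` and `w`
      have hend : ∀ {c d : V}, G.Adj c d → q ∈ seg (e.pos c) (e.pos d) →
          Δ ≤ cr (e.pos u) (e.pos c) (e.pos w) + cr (e.pos u) (e.pos v) (e.pos c) := by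
        intro c d hcd hq
        by_contra! hlt
        set a := cr (e.pos u) (e.pos c) (e.pos w) with ha
        set b := cr (e.pos u) (e.pos v) (e.pos c) with hb
        obtain ⟨r, hr0, hr1, hr2⟩ := hsmall (a := a) hA0
        obtain ⟨r', hr0', hr1', hr2'⟩ := hsmall (a := b) hB0
        have hm : ∀ {m x y : ℝ}, 0 < y → 0 < m → m ≤ 1 → 0 < (1 - m) * y + m * x →
            ∀ m', 0 < m' → m' ≤ m → 0 < (1 - m') * y + m' * x := by
          intro m x y hy hm0 hm1 h m' hm0' hmm
          rcases le_total x 0 with hx | hx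
          · nlinarith
          · nlinarith
        have hmin0 : 0 < min r r' := lt_min hr0 hr0'
        have k1 := hm hA0 hr0 hr1 hr2 (min r r') hmin0 (min_le_left _ _)
        have k2 := hm hB0 hr0' hr1' hr2' (min r r') hmin0 (min_le_right _ _)
        rw [← hA, ha, ← cr_pt_mid] at k1
        rw [← hB, hb, ← cr_pt_right] at k2
        refine e.no_edge_in_wedge huv huw hΔ hempty le_rfl hmin hcd
          ((convex_segment (𝕜 := ℝ) (e.pos c) (e.pos d)).segment_subset hq
            (left_mem_segment ℝ _ _)
            (pt_mem_seg q (e.pos c) hmin0.le ((min_le_left _ _).trans hr1))) k1 k2 ?_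
        rw [cr_pt_mid, cr_pt_right, hA, hB]
        nlinarith
      have hc := hend hcd hq
      have hd := hend hcd.symm (by rwa [seg_comm])
      wlog hle : cr (e.pos u) (e.pos v) (e.pos c) ≤ cr (e.pos u) (e.pos v) (e.pos d)
        generalizing c d
      · exact this d c hcd.symm (by rwa [seg_comm]) hd hc (le_of_not_ge hle)
      obtain ⟨m, hm0, hm1, hqm⟩ := mem_seg_iff.1 hq
      change q = pt _ _ m at hqm
      rw [hqm, cr_pt_mid] at hA
      rw [hqm, cr_pt_right] at hB
      have hcq : cr (e.pos u) (e.pos c) (e.pos w) + cr (e.pos u) (e.pos v) (e.pos c) = Δ := by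
        rcases hm1.eq_or_lt with h | h
        · subst h
          exfalso
          exact hoff d (by linarith) (by linarith) (by linarith)
        · nlinarith
      have hdq : cr (e.pos u) (e.pos d) (e.pos w) + cr (e.pos u) (e.pos v) (e.pos d) = Δ := by
        rcases hm0.eq_or_lt with h | h
        · subst h
          exfalso
          exact hoff c (by linarith) (by linarith) (by linarith)
        · nlinarith
      have hBc : cr (e.pos u) (e.pos v) (e.pos c) ≤ 0 := by
        by_contra! h
        exact hoff c (by nlinarith) h hcq
      have hAd : cr (e.pos u) (e.pos d) (e.pos w) ≤ 0 := by
        by_contra! h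
        exact hoff d h (by nlinarith) hdq
      have hon : ∀ x : V, (x = v ∨ x = w) → x = c ∨ x = d := by
        intro x hx
        by_contra! hcon
        refine e.vertex_off hcd hcon.1 hcon.2 ?_
        set b := cr (e.pos u) (e.pos v) (e.pos c)
        set b' := cr (e.pos u) (e.pos v) (e.pos d)
        have hbx : 0 ≤ cr (e.pos u) (e.pos v) (e.pos x) ∧
            cr (e.pos u) (e.pos v) (e.pos x) ≤ Δ ∧
            cr (e.pos u) (e.pos x) (e.pos w) = Δ - cr (e.pos u) (e.pos v) (e.pos x) := by
          rcases hx with rfl | rfl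
          · simp [hΔdef]
            exact hΔ.le
          · simp [hΔdef]
            exact hΔ.le
        obtain ⟨hx0, hx1, hx2⟩ := hbx
        have hbb : 0 < b' - b := by linarith
        have : e.pos x = pt (e.pos c) (e.pos d)
            ((cr (e.pos u) (e.pos v) (e.pos x) - b) / (b' - b)) := by
          apply eq_of_cr_eq hΔ
          · rw [cr_pt_mid, hx2, eq_sub_of_add_eq hcq, eq_sub_of_add_eq hdq]
            field_simp
            ring
          · rw [cr_pt_right]
            field_simp
            ring
        rw [this]
        refine pt_mem_seg _ _ (div_nonneg (by linarith) hbb.le) ?_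
        rw [div_le_one hbb]
        linarith
      have h1 := hon v (Or.inl rfl)
      have h2 := hon w (Or.inr rfl)
      apply hnadj
      rcases h1 with rfl | rfl <;> rcases h2 with h2 | h2
      · exact absurd h2.symm hvw
      · rw [h2]; exact hcd
      · rw [h2]; exact hcd.symm
      · exact absurd h2.symm hvw
  · intro n hwn h1 h2
    rw [← cr_rotate (e.pos w)] at h1 h2
    have hadd := cr_add (e.pos u) (e.pos v) (e.pos w) (e.pos n)
    obtain ⟨t, ht0, ht1, ht⟩ := hsmall (a := cr (e.pos u) (e.pos v) (e.pos n)) hΔ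
    refine hno hwn t ht0.le ht1 ?_ ht ?_
    · rw [cr_self_right]; nlinarith
    · rw [cr_self_right]; nlinarith
  · intro n hvn h1 h2
    rw [cr_rotate] at h1 h2
    have hadd := cr_add (e.pos u) (e.pos v) (e.pos w) (e.pos n)
    obtain ⟨t, ht0, ht1, ht⟩ := hsmall (a := cr (e.pos u) (e.pos n) (e.pos w)) hΔ
    refine hno hvn t ht0.le ht1 ht ?_ ?_
    · rw [cr_self_right]; nlinarith
    · rw [cr_self_right]; nlinarith

end plane
end

section
open scoped Classical

/-- The slope of the line through `u` and `v`. -/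
noncomputable def slp (u v : ℝ × ℝ) : ℝ := (v.2 - u.2) / (v.1 - u.1)

/-- Directions at `u`, ordered by angle, starting from the vertical. -/
noncomputable def dirKey (u v : ℝ × ℝ) : Bool ×ₗ ℝ := toLex (decide (v.1 < u.1), slp u v)

theorem cr_eq_slp {u v w : ℝ × ℝ} (hv : v.1 ≠ u.1) (hw : w.1 ≠ u.1) :
    cr u v w = (v.1 - u.1) * (w.1 - u.1) * (slp u w - slp u v) := by
  have := sub_ne_zero.2 hv
  have := sub_ne_zero.2 hw
  simp only [cr, slp]
  field_simp

theorem dirKey_lt {u v w : ℝ × ℝ} (hv : v.1 ≠ u.1) (hw : w.1 ≠ u.1) : dirKey u v < dirKey u w ↔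
    (u.1 < v.1 ∧ w.1 < u.1) ∨
      (((u.1 < v.1 ∧ u.1 < w.1) ∨ (v.1 < u.1 ∧ w.1 < u.1)) ∧ slp u v < slp u w) := by
  rw [dirKey, dirKey, Prod.Lex.toLex_lt_toLex]
  rcases lt_or_gt_of_ne hv with h1 | h1 <;> rcases lt_or_gt_of_ne hw with h2 | h2 <;>
    simp [h1, h2, not_lt.2 h1.le, not_lt.2 h2.le]

theorem cr_pos_iff {u v w : ℝ × ℝ} (hv : v.1 ≠ u.1) (hw : w.1 ≠ u.1) : 0 < cr u v w ↔
    (((u.1 < v.1 ∧ u.1 < w.1) ∨ (v.1 < u.1 ∧ w.1 < u.1)) ∧ slp u v < slp u w) ∨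
      (((u.1 < v.1 ∧ w.1 < u.1) ∨ (v.1 < u.1 ∧ u.1 < w.1)) ∧ slp u w < slp u v) := by
  rw [cr_eq_slp hv hw]
  rcases lt_or_gt_of_ne hv with h1 | h1 <;> rcases lt_or_gt_of_ne hw with h2 | h2 <;>
    simp only [h1, h2, not_lt.2 h1.le, not_lt.2 h2.le, and_true, or_true, or_false,
      false_or, and_false, true_and, false_and]
  · rw [mul_pos_iff_of_pos_left (mul_pos_of_neg_of_neg (by linarith) (by linarith)), sub_pos]
  · rw [← neg_mul_neg, mul_pos_iff_of_pos_left
      (neg_pos.2 (mul_neg_of_neg_of_pos (by linarith) (by linarith))), neg_sub, sub_pos]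
  · rw [← neg_mul_neg, mul_pos_iff_of_pos_left
      (neg_pos.2 (mul_neg_of_pos_of_neg (by linarith) (by linarith))), neg_sub, sub_pos]
  · rw [mul_pos_iff_of_pos_left (mul_pos (by linarith) (by linarith)), sub_pos]

theorem dirKey_between {u v n w : ℝ × ℝ} (hv : v.1 ≠ u.1) (hw : w.1 ≠ u.1) (hn : n.1 ≠ u.1)
    (hcr : 0 < cr u v w) (h : (dirKey u v < dirKey u n ∧ dirKey u n < dirKey u w) ∨
      (dirKey u w < dirKey u v ∧ (dirKey u v < dirKey u n ∨ dirKey u n < dirKey u w))) :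
    0 < cr u n w ∧ 0 < cr u v n := by
  rw [cr_pos_iff hv hw] at hcr
  rw [cr_pos_iff hn hw, cr_pos_iff hv hn]
  rw [dirKey_lt hv hn, dirKey_lt hn hw, dirKey_lt hw hv] at h
  rcases lt_or_gt_of_ne hv with h1 | h1 <;> rcases lt_or_gt_of_ne hw with h2 | h2 <;>
    rcases lt_or_gt_of_ne hn with h3 | h3 <;>
    simp only [h1, h2, h3, not_lt.2 h1.le, not_lt.2 h2.le, not_lt.2 h3.le, and_true, or_true,
      true_or, or_false, false_or, and_false, true_and, false_and] at hcr h ⊢ <;> grind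

theorem cycNext_of_empty {V : Type*} {pos : V → ℝ × ℝ} {u v w : V} {s : Finset V}
    (hs : ∀ n ∈ s, (pos n).1 ≠ (pos u).1) (hv : v ∈ s) (hw : w ∈ s)
    (hcr : 0 < cr (pos u) (pos v) (pos w))
    (hempty : ∀ n ∈ s, 0 < cr (pos u) (pos n) (pos w) → 0 < cr (pos u) (pos v) (pos n) → False) :
    CycNext (fun n => dirKey (pos u) (pos n)) s v w := by
  have hb : ∀ n ∈ s, _ := fun n hn h =>
    (fun hh : _ ∧ _ => hempty n hn hh.1 hh.2)
      (dirKey_between (n := pos n) (hs v hv) (hs w hw) (hs n hn) hcr h)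
  refine ⟨hw, ?_⟩
  dsimp only
  rcases lt_trichotomy (dirKey (pos u) (pos v)) (dirKey (pos u) (pos w)) with h | h | h
  · left
    refine ⟨h, fun c hc hvc => ?_⟩
    by_contra! hcw
    exact hb c hc (Or.inl ⟨hvc, hcw⟩)
  · exfalso
    have h2 : slp (pos u) (pos v) = slp (pos u) (pos w) := congrArg (fun z => (ofLex z).2) h
    rw [cr_eq_slp (hs v hv) (hs w hw), h2] at hcr
    simp at hcr
  · right
    refine ⟨fun c hc => ?_, fun c hc => ?_⟩
    · by_contra! hcw
      exact hb c hc (Or.inr ⟨h, Or.inl hcw⟩)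
    · by_contra! hcw
      exact hb c hc (Or.inr ⟨h, Or.inr hcw⟩)

theorem empty_of_cycNext {V : Type*} {pos : V → ℝ × ℝ} {u v w : V} {s : Finset V}
    (hs : ∀ n ∈ s, (pos n).1 ≠ (pos u).1) (hv : v ∈ s) (hw : w ∈ s)
    (hside : ((pos v).1 < (pos u).1 ↔ (pos w).1 < (pos u).1))
    (hlt : dirKey (pos u) (pos v) < dirKey (pos u) (pos w))
    (hc : CycNext (fun n => dirKey (pos u) (pos n)) s v w) :
    0 < cr (pos u) (pos v) (pos w) ∧
    ∀ n ∈ s, 0 < cr (pos u) (pos n) (pos w) → 0 < cr (pos u) (pos v) (pos n) → False := by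
  obtain ⟨-, h | h⟩ := hc
  swap
  · exact absurd hlt (not_lt.2 (h.1 w hw))
  have hn2 := h.2
  have hvn := hs v hv
  have hwn := hs w hw
  rw [dirKey_lt hvn hwn] at hlt
  refine ⟨?_, fun n hn h1 h2 => ?_⟩
  · rw [cr_pos_iff hvn hwn]
    rcases lt_or_gt_of_ne hvn with h1 | h1 <;> rcases lt_or_gt_of_ne hwn with h2 | h2 <;>
      simp only [h1, h2, not_lt.2 h1.le, not_lt.2 h2.le, iff_self, iff_true,
        and_true, or_true, or_false, false_or, and_false, true_and, false_and]
        at hlt hside ⊢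
    · exact hlt
    · exact hlt
  · have hnn := hs n hn
    rw [cr_pos_iff hnn hwn] at h1
    rw [cr_pos_iff hvn hnn] at h2
    have hn3 := hn2 n hn
    dsimp only at hn3
    rw [← not_lt, dirKey_lt hnn hwn, dirKey_lt hvn hnn] at hn3
    grind

end

section
open scoped Classical

/-- The neighbours of `u`, as a finset. -/
noncomputable def nbrs {V : Type*} [Fintype V] (G : SimpleGraph V) (u : V) : Finset V :=
  Finset.univ.filter (G.Adj u)

@[simp] theorem mem_nbrs {V : Type*} [Fintype V] {G : SimpleGraph V} {u v : V} :
    v ∈ nbrs G u ↔ G.Adj u v := by simp [nbrs]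

section plane
variable {V : Type} [Fintype V] {G : SimpleGraph V} (e : PlaneEmb G)

/-- No two vertices lie on a common vertical line. -/
def PlaneEmb.XInj {V : Type} {G : SimpleGraph V} (e : PlaneEmb G) : Prop :=
  ∀ a b, (e.pos a).1 = (e.pos b).1 → a = b

theorem PlaneEmb.XInj.ne {V : Type} {G : SimpleGraph V} {e : PlaneEmb G} (hx : e.XInj)
    {a b : V} (h : G.Adj a b) : (e.pos b).1 ≠ (e.pos a).1 :=
  fun h' => h.ne (hx _ _ h').symm

theorem PlaneEmb.XInj.dirKey_injOn {e : PlaneEmb G} (hx : e.XInj) (u : V) :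
    Set.InjOn (fun n => dirKey (e.pos u) (e.pos n)) (nbrs G u) := by
  intro a ha b hb hab
  rw [Finset.mem_coe, mem_nbrs] at ha hb
  by_contra hne
  have h1 := congrArg (fun z => (ofLex z).1) hab
  have h2 : slp _ _ = slp _ _ := congrArg (fun z => (ofLex z).2) hab
  simp only [dirKey, ofLex_toLex, decide_eq_decide] at h1
  wlog hle : |(e.pos a).1 - (e.pos u).1| ≤ |(e.pos b).1 - (e.pos u).1| generalizing a b
  · exact this hb ha hab.symm (Ne.symm hne) h2.symm h1.symm (le_of_not_ge hle)
  have hau := sub_ne_zero.2 (hx.ne ha)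
  have hbu := sub_ne_zero.2 (hx.ne hb)
  refine e.vertex_off hb (v := a) ha.ne.symm hne ?_
  have : e.pos a = pt (e.pos u) (e.pos b)
      (((e.pos a).1 - (e.pos u).1) / ((e.pos b).1 - (e.pos u).1)) := by
    ext
    · simp only [pt]; field_simp; ring
    · simp only [slp] at h2
      simp only [pt]; field_simp at h2 ⊢; linarith
  rw [this]
  have hn : ((e.pos a).1 - (e.pos u).1) / ((e.pos b).1 - (e.pos u).1) =
      |(e.pos a).1 - (e.pos u).1| / |(e.pos b).1 - (e.pos u).1| := by
    rcases lt_or_gt_of_ne (hx.ne ha) with h | h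
    · rw [abs_of_neg (by linarith), abs_of_neg (by linarith [h1.1 h]), neg_div_neg_eq]
    · rw [abs_of_pos (by linarith), abs_of_pos]
      have := hx.ne hb
      have : ¬ (e.pos b).1 < (e.pos u).1 := fun hh => by linarith [h1.2 hh]
      grind
  rw [hn]
  exact pt_mem_seg _ _ (by positivity) (by rw [div_le_one (by positivity)]; exact hle)

/-- The rotation system of a straight-line drawing. -/
noncomputable def PlaneEmb.rot (hx : e.XInj) : Rot G where
  nxt u v := if h : v ∈ nbrs G u then
    (exists_cycNext (fun n => dirKey (e.pos u) (e.pos n)) h).choose else v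
  adj := by
    intro u v h
    have h' : v ∈ nbrs G u := mem_nbrs.2 h
    rw [dif_pos h']
    exact mem_nbrs.1 (exists_cycNext (fun n => dirKey (e.pos u) (e.pos n)) h').choose_spec.1
  trans := by
    intro u v S huv hv hS w hw
    refine cycNext_trans (key := fun n => dirKey (e.pos u) (e.pos n)) (hx.dirKey_injOn u)
      (nxt := fun v => if h : v ∈ nbrs G u then
        (exists_cycNext (fun n => dirKey (e.pos u) (e.pos n)) h).choose else v) ?_
      (mem_nbrs.2 huv) hv (fun a ha haS => hS a haS (mem_nbrs.1 ha)) w (mem_nbrs.2 hw)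
    intro a ha
    rw [dif_pos ha]
    exact (exists_cycNext (fun n => dirKey (e.pos u) (e.pos n)) ha).choose_spec

theorem PlaneEmb.rot_cycNext (hx : e.XInj) {u v : V} (h : G.Adj u v) :
    CycNext (fun n => dirKey (e.pos u) (e.pos n)) (nbrs G u) v ((e.rot hx).nxt u v) := by
  have h' : v ∈ nbrs G u := mem_nbrs.2 h
  simp only [PlaneEmb.rot, dif_pos h']
  exact (exists_cycNext (fun n => dirKey (e.pos u) (e.pos n)) h').choose_spec

theorem PlaneEmb.rot_eq (hx : e.XInj) {u v w : V} (h : G.Adj u v)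
    (hc : CycNext (fun n => dirKey (e.pos u) (e.pos n)) (nbrs G u) v w) :
    (e.rot hx).nxt u v = w :=
  CycNext.unique (hx.dirKey_injOn u) (e.rot_cycNext hx h) hc

/-- The corner at the head `b` of the dart `(a, b)` lies on one side of the vertical line
through `b`. -/
def PlaneEmb.GoodCorner (hx : e.XInj) (δ : V × V) : Prop :=
  G.Adj δ.1 δ.2 ∧
  ((e.pos δ.1).1 < (e.pos δ.2).1 ↔ (e.pos ((e.rot hx).nxt δ.2 δ.1)).1 < (e.pos δ.2).1) ∧
  dirKey (e.pos δ.2) (e.pos δ.1) < dirKey (e.pos δ.2) (e.pos ((e.rot hx).nxt δ.2 δ.1))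

theorem PlaneEmb.card_darts_le (hx : e.XInj) :
    (darts G).card ≤ 2 * Fintype.card V + ((darts G).filter (e.GoodCorner hx)).card := by
  rw [← Finset.card_filter_add_card_filter_not (s := darts G) (e.GoodCorner hx), add_comm]
  refine Nat.add_le_add_right ?_ _
  have hc : Fintype.card (V × Bool) = 2 * Fintype.card V := by
    rw [Fintype.card_prod, Fintype.card_bool, mul_comm]
  rw [← hc, ← Finset.card_univ]
  have hmaxi : ∀ u v, G.Adj v u → ¬ e.GoodCorner hx (v, u) → ∀ c, G.Adj u c →
      ((e.pos c).1 < (e.pos u).1 ↔ (e.pos v).1 < (e.pos u).1) →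
      dirKey (e.pos u) (e.pos c) ≤ dirKey (e.pos u) (e.pos v) := by
    intro u v hvu hng c huc hside
    obtain ⟨hadj, h | h⟩ := e.rot_cycNext hx hvu.symm
    · by_contra! hlt
      have h1 := h.1
      have h2 := h.2 c (mem_nbrs.2 huc) hlt
      dsimp only at h1 h2
      apply hng
      refine ⟨hvu, ?_, h.1⟩
      dsimp only
      have a1 := hx.ne hvu.symm
      have a2 := hx.ne huc
      have a3 := hx.ne (mem_nbrs.1 hadj)
      rw [← not_lt, dirKey_lt a2 a3] at h2
      rw [dirKey_lt a1 a3] at h1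
      grind
    · exact h.1 c (mem_nbrs.2 huc)
  refine Finset.card_le_card_of_injOn
    (fun δ => (δ.2, decide ((e.pos δ.1).1 < (e.pos δ.2).1))) (fun _ _ => Finset.mem_univ _) ?_
  rintro ⟨v, u⟩ h1 ⟨v', u'⟩ h2 heq
  simp only [Finset.coe_filter, mem_darts, Set.mem_ofPred_eq] at h1 h2
  simp only [Prod.mk.injEq, decide_eq_decide] at heq
  obtain ⟨rfl, hs⟩ := heq
  have k1 := hmaxi u v h1.1 h1.2 v' h2.1.symm hs.symm
  have k2 := hmaxi u v' h2.1 h2.2 v h1.1.symm hs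
  rw [hx.dirKey_injOn u (mem_nbrs.2 h1.1.symm) (mem_nbrs.2 h2.1.symm) (le_antisymm k2 k1)]

theorem PlaneEmb.Maximal.euler {e : PlaneEmb G} (hmax : e.Maximal) (hx : e.XInj) :
    (e.rot hx).Euler := by
  set R := e.rot hx with hR
  have htri : ∀ δ, e.GoodCorner hx δ → R.face (R.face (R.face δ)) = δ := by
    rintro ⟨v, u⟩ ⟨hvu, hside, hlt⟩
    dsimp only at hvu hside hlt
    set w := R.nxt u v with hw
    have huw : G.Adj u w := R.adj hvu.symm
    obtain ⟨hΔ, hempty⟩ := empty_of_cycNext (pos := e.pos) (s := nbrs G u)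
      (fun n hn => hx.ne (mem_nbrs.1 hn)) (mem_nbrs.2 hvu.symm) (mem_nbrs.2 huw) hside hlt
      (e.rot_cycNext hx hvu.symm)
    obtain ⟨hvw, hw1, hv1⟩ := hmax.corner hvu.symm huw hΔ
      (fun n hn => hempty n (mem_nbrs.2 hn))
    have e1 : R.nxt w u = v := e.rot_eq hx huw.symm (cycNext_of_empty
      (fun n hn => hx.ne (mem_nbrs.1 hn)) (mem_nbrs.2 huw.symm) (mem_nbrs.2 hvw.symm)
      (by rwa [cr_rotate, cr_rotate]) (fun n hn => hw1 n (mem_nbrs.1 hn)))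
    have e2 : R.nxt v w = u := e.rot_eq hx hvw (cycNext_of_empty
      (fun n hn => hx.ne (mem_nbrs.1 hn)) (mem_nbrs.2 hvw) (mem_nbrs.2 hvu)
      (by rwa [cr_rotate]) (fun n hn => hv1 n (mem_nbrs.1 hn)))
    rw [R.face_of_adj hvu, ← hw, R.face_of_adj huw, e1, R.face_of_adj hvw.symm, e2]
  set Tri := (darts G).filter (fun δ => R.face (R.face (R.face δ)) = δ) with hTri
  have hTinv : ∀ δ ∈ Tri, R.face δ ∈ Tri := by
    intro δ hδ
    rw [hTri, Finset.mem_filter, mem_darts] at hδ ⊢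
    exact ⟨R.face_adj hδ.1, by rw [hδ.2]⟩
  set g : V × V → ℚ := fun δ => if e.GoodCorner hx δ then 1 else 0 with hg
  have hZ : (((darts G).filter (e.GoodCorner hx)).card : ℚ) = ∑ δ ∈ Tri, g δ := by
    rw [hg, Finset.sum_boole]
    congr 2
    ext δ
    simp only [hTri, Finset.mem_filter]
    exact ⟨fun h => ⟨⟨h.1, htri δ h.2⟩, h.2⟩, fun h => ⟨h.1.1, h.2⟩⟩
  have h3 : 3 * ∑ δ ∈ Tri, g δ ≤ 2 * (Tri.card : ℚ) := by
    have s1 := sum_comp_of_invariant R.face_injective hTinv g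
    have s2 := sum_comp_of_invariant R.face_injective hTinv (fun δ => g (R.face δ))
    have : 3 * ∑ δ ∈ Tri, g δ = ∑ δ ∈ Tri, (g δ + g (R.face δ) + g (R.face (R.face δ))) := by
      rw [Finset.sum_add_distrib, Finset.sum_add_distrib]
      linarith
    rw [this]
    have : (2 : ℚ) * Tri.card = ∑ δ ∈ Tri, 2 := by simp [mul_comm]
    rw [this]
    refine Finset.sum_le_sum fun δ hδ => ?_
    have hle : ∀ δ, g δ ≤ 1 := fun δ => by simp only [hg]; split_ifs <;> norm_num
    by_cases c1 : e.GoodCorner hx δ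
    · by_cases c2 : e.GoodCorner hx (R.face δ)
      · have c3 : ¬ e.GoodCorner hx (R.face (R.face δ)) := by
          intro c3
          have ht := htri _ c1
          obtain ⟨a, b⟩ := δ
          have hab := c1.1
          rw [R.face_of_adj hab] at c2 c3 ht
          rw [R.face_of_adj c2.1] at c3 ht
          rw [R.face_of_adj c3.1] at ht
          obtain ⟨d1, f1, -⟩ := c1
          obtain ⟨d2, f2, -⟩ := c2
          obtain ⟨d3, f3, -⟩ := c3
          simp only [Prod.mk.injEq] at ht
          obtain ⟨g1, g2⟩ := ht
          dsimp only at *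
          rw [← hR] at f1 f2 f3
          rw [g2] at f3
          rw [g1] at f2 f3 d3
          have := hx.ne d1
          have := hx.ne d2
          have := hx.ne d3
          grind
        have : g (R.face (R.face δ)) = 0 := if_neg c3
        linarith [hle δ, hle (R.face δ)]
      · have : g (R.face δ) = 0 := if_neg c2
        linarith [hle δ, hle (R.face (R.face δ))]
    · have : g δ = 0 := if_neg c1
      linarith [hle (R.face δ), hle (R.face (R.face δ))]
  have hw : (Tri.card : ℚ) / 3 ≤ ∑ δ ∈ darts G, orbWt R.face δ := by
    calc (Tri.card : ℚ) / 3 = ∑ δ ∈ Tri, (1 / 3 : ℚ) := by simp; ring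
      _ ≤ ∑ δ ∈ Tri, orbWt R.face δ := by
        refine Finset.sum_le_sum fun δ hδ => ?_
        have hp : Function.IsPeriodicPt R.face 3 δ := (Finset.mem_filter.1 hδ).2
        have h1 := hp.minimalPeriod_le (by norm_num)
        have h2 := hp.minimalPeriod_pos (by norm_num)
        unfold orbWt
        apply one_div_le_one_div_of_le
        · exact_mod_cast h2
        · exact_mod_cast h1
      _ ≤ _ := Finset.sum_le_sum_of_subset_of_nonneg (Finset.filter_subset _ _)
        (fun _ _ _ => orbWt_nonneg _ _)
  have hcard : ((darts G).card : ℚ) ≤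
      2 * Fintype.card V + ((darts G).filter (e.GoodCorner hx)).card := by
    exact_mod_cast e.card_darts_le hx
  unfold Rot.Euler
  linarith

end plane
end

section
open scoped Classical

theorem PlaneEmb.rot_euler {V : Type} [Fintype V] {G : SimpleGraph V} (e : PlaneEmb G)
    (hx : e.XInj) : (e.rot hx).Euler := by
  induction hn : ((darts G)ᶜ).card using Nat.strong_induction_on generalizing G with
  | _ n ih =>
  by_cases hmax : e.Maximal
  · exact hmax.euler hx
  unfold PlaneEmb.Maximal at hmax
  push Not at hmax
  obtain ⟨u, p, hup, hadj, hv, he, -⟩ := hmax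
  have hx' : (e.add hup hv he).XInj := hx
  have hlt : ((darts (addEdge G u p))ᶜ).card < n := by
    rw [← hn]
    refine Finset.card_lt_card (Finset.ssubset_iff_of_subset ?_ |>.2 ⟨(u, p), ?_, ?_⟩)
    · intro δ hδ
      rw [Finset.mem_compl, mem_darts] at hδ ⊢
      exact fun h => hδ ((addEdge_adj hup).2 (Or.inl h))
    · rw [Finset.mem_compl, mem_darts]; exact hadj
    · rw [Finset.mem_compl, mem_darts, not_not]; exact (addEdge_adj hup).2 (Or.inr rfl)
  refine (ih _ hlt (e.add hup hv he) hx' rfl).delete (p := u) (q := p)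
    ((addEdge_adj hup).2 (Or.inr rfl)) ?_ ?_
  · intro a b
    rw [addEdge_adj hup]
    constructor
    · refine fun h => ⟨Or.inl h, fun hs => hadj ?_⟩
      rw [Sym2.eq_iff] at hs
      rcases hs with ⟨rfl, rfl⟩ | ⟨rfl, rfl⟩
      · exact h
      · exact h.symm
    · rintro ⟨h | h, h'⟩
      · exact h
      · exact absurd h h'
  · intro a b hab hab'
    refine e.rot_eq hx hab ?_
    refine ((e.add hup hv he).rot_cycNext hx' ((addEdge_adj hup).2 (Or.inl hab))).mono ?_
      (mem_nbrs.2 hab')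
    intro c hc
    exact mem_nbrs.2 ((addEdge_adj hup).2 (Or.inl (mem_nbrs.1 hc)))

/-- A horizontal shear of the plane. -/
def shear (ε : ℝ) (z : ℝ × ℝ) : ℝ × ℝ := (z.1 + ε * z.2, z.2)

theorem shear_injective (ε : ℝ) : Function.Injective (shear ε) := by
  rintro ⟨a, b⟩ ⟨c, d⟩ h
  simp only [shear, Prod.mk.injEq] at h
  obtain ⟨h1, rfl⟩ := h
  simpa using h1

theorem mem_seg_shear {ε : ℝ} {x y z : ℝ × ℝ} (h : z ∈ seg (shear ε x) (shear ε y)) :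
    ∃ w ∈ seg x y, shear ε w = z := by
  obtain ⟨t, h0, h1, rfl⟩ := mem_seg_iff.1 h
  refine ⟨pt x y t, pt_mem_seg _ _ h0 h1, ?_⟩
  ext <;> simp [shear, pt]
  ring

/-- The image of a drawing under a shear. -/
def PlaneEmb.shear {V : Type} {G : SimpleGraph V} (e : PlaneEmb G) (ε : ℝ) : PlaneEmb G where
  pos v := ChoosSep.shear ε (e.pos v)
  inj := (shear_injective ε).comp e.inj
  edges_meet := by
    rintro a b c d hab hcd hne z ⟨h1, h2⟩
    obtain ⟨w, hw, rfl⟩ := mem_seg_shear h1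
    obtain ⟨w', hw', h⟩ := mem_seg_shear h2
    rw [shear_injective ε h] at hw'
    obtain ⟨k1, k2⟩ := e.edges_meet hab hcd hne ⟨hw, hw'⟩
    refine ⟨?_, ?_⟩
    · rcases k1 with rfl | rfl
      · exact Or.inl rfl
      · exact Or.inr rfl
    · rcases k2 with rfl | rfl
      · exact Or.inl rfl
      · exact Or.inr rfl
  vertex_off := by
    intro a b v hab ha hb h
    obtain ⟨w, hw, h⟩ := mem_seg_shear h
    rw [shear_injective ε h] at hw
    exact e.vertex_off hab ha hb hw

theorem PlaneEmb.exists_xInj {V : Type} [Finite V] {G : SimpleGraph V} (e : PlaneEmb G) :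
    ∃ e' : PlaneEmb G, e'.XInj := by
  obtain ⟨ε, hε⟩ := (Set.finite_range fun z : V × V =>
    ((e.pos z.2).1 - (e.pos z.1).1) / ((e.pos z.1).2 - (e.pos z.2).2)).exists_notMem
  refine ⟨e.shear ε, fun a b h => ?_⟩
  simp only [PlaneEmb.shear, ChoosSep.shear] at h
  by_cases hy : (e.pos a).2 = (e.pos b).2
  · rw [hy] at h
    exact e.inj (Prod.ext (by simpa using h) hy)
  · refine absurd ⟨(a, b), ?_⟩ hε
    have := sub_ne_zero.2 hy
    simp only
    field_simp
    linarith

/-- Euler's inequality for finite plane graphs. -/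
theorem IsPlanar.exists_euler {V : Type} [Fintype V] {G : SimpleGraph V} (h : IsPlanar G) :
    ∃ R : Rot G, R.Euler := by
  obtain ⟨e⟩ := h
  obtain ⟨e', hx⟩ := e.exists_xInj
  exact ⟨_, e'.rot_euler hx⟩

/-- Planarity passes to subgraphs, possibly on fewer vertices. -/
theorem IsPlanar.of_hom {V W : Type} {G : SimpleGraph V} {H : SimpleGraph W} (h : IsPlanar G)
    {f : W → V} (hf : Function.Injective f) (hadj : ∀ a b, H.Adj a b → G.Adj (f a) (f b)) :
    IsPlanar H := by
  obtain ⟨e⟩ := h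
  refine ⟨⟨fun v => e.pos (f v), e.inj.comp hf, ?_, ?_⟩⟩
  · intro a b c d hab hcd hne
    refine e.edges_meet (hadj _ _ hab) (hadj _ _ hcd) fun h => hne ?_
    exact Sym2.map.injective hf h
  · intro a b v hab ha hb
    exact e.vertex_off (hadj _ _ hab) (fun h => ha (hf h)) (fun h => hb (hf h))

end

section
open scoped Classical

/-! ### Faces of sparse rotation systems -/

/-- There is no cycle of length five. -/
def NoC5 {V : Type*} (G : SimpleGraph V) : Prop :=
  ∀ a b c d e, G.Adj a b → G.Adj b c → G.Adj c d → G.Adj d e → G.Adj e a →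
    a ≠ c → a ≠ d → b ≠ d → b ≠ e → c ≠ e → False

/-- There is no cycle of length six. -/
def NoC6 {V : Type*} (G : SimpleGraph V) : Prop :=
  ∀ a b c d e f, G.Adj a b → G.Adj b c → G.Adj c d → G.Adj d e → G.Adj e f → G.Adj f a →
    a ≠ c → b ≠ d → c ≠ e → d ≠ f → e ≠ a → f ≠ b → a ≠ d → b ≠ e → c ≠ f → False

namespace Rot
variable {V : Type*} {H : SimpleGraph V} (R : Rot H)

/-- The face to the right of the dart `(a, b)` is a triangle. -/
def Tri (a b : V) : Prop :=
  H.Adj a b ∧ R.nxt (R.nxt b a) b = a ∧ R.nxt a (R.nxt b a) = b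

/-- The face to the right of the dart `(a, b)` is a quadrangle (or a triangle walked around
with a multiplicity). -/
def Quad (a b : V) : Prop :=
  H.Adj a b ∧ R.nxt (R.nxt (R.nxt b a) b) (R.nxt b a) = a ∧
    R.nxt a (R.nxt (R.nxt b a) b) = b

/-- The face to the right of the dart `(a, b)` is neither a triangle nor a quadrangle. -/
def Big (a b : V) : Prop := H.Adj a b ∧ ¬ R.Tri a b ∧ ¬ R.Quad a b

variable {R} {a b : V}

theorem adj_nxt (h : H.Adj a b) : H.Adj b (R.nxt b a) := R.adj h.symm

theorem tri_iff (h : H.Adj a b) : R.Tri a b ↔ R.face (R.face (R.face (a, b))) = (a, b) := by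
  rw [R.face_of_adj h, R.face_of_adj (adj_nxt h), R.face_of_adj (adj_nxt (adj_nxt h)),
    Prod.mk.injEq, Tri]
  constructor
  · rintro ⟨-, h1, h2⟩; rw [h1]; exact ⟨rfl, h2⟩
  · rintro ⟨h1, h2⟩; rw [h1] at h2; exact ⟨h, h1, h2⟩

theorem quad_iff (h : H.Adj a b) :
    R.Quad a b ↔ R.face (R.face (R.face (R.face (a, b)))) = (a, b) := by
  rw [R.face_of_adj h, R.face_of_adj (adj_nxt h), R.face_of_adj (adj_nxt (adj_nxt h)),
    R.face_of_adj (adj_nxt (adj_nxt (adj_nxt h))), Prod.mk.injEq, Quad]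
  constructor
  · rintro ⟨-, h1, h2⟩; rw [h1]; exact ⟨rfl, h2⟩
  · rintro ⟨h1, h2⟩; rw [h1] at h2; exact ⟨h, h1, h2⟩

theorem Tri.next (h : R.Tri a b) : R.Tri b (R.nxt b a) := by
  obtain ⟨h1, h2, h3⟩ := h
  refine ⟨adj_nxt h1, ?_, ?_⟩
  · rw [h2, h3]
  · rw [h2]

theorem Tri.prev (h : R.Tri a b) : R.Tri (R.nxt b a) a := by
  have := h.next.next
  rwa [h.2.1] at this

theorem Tri.adj_third (h : R.Tri a b) : H.Adj a (R.nxt b a) := by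
  have := h.prev.1
  exact this.symm

theorem tri_next_iff [Fintype V] (h : H.Adj a b) : R.Tri b (R.nxt b a) ↔ R.Tri a b := by
  rw [tri_iff h, tri_iff (adj_nxt h), ← R.face_of_adj h]
  exact R.face_injective.eq_iff

theorem quad_next_iff [Fintype V] (h : H.Adj a b) : R.Quad b (R.nxt b a) ↔ R.Quad a b := by
  rw [quad_iff h, quad_iff (adj_nxt h), ← R.face_of_adj h]
  exact R.face_injective.eq_iff

theorem Big.next [Fintype V] (h : R.Big a b) : R.Big b (R.nxt b a) :=
  ⟨adj_nxt h.1, by rw [tri_next_iff h.1]; exact h.2.1, by rw [quad_next_iff h.1]; exact h.2.2⟩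

/-- The hypotheses under which the discharging argument is carried out. -/
structure Sparse {V : Type*} [Fintype V] {H : SimpleGraph V} (_R : Rot H) : Prop where
  c5 : NoC5 H
  c6 : NoC6 H
  deg : ∀ v, 3 ≤ (nbrs H v).card
  no3 : ∀ u a b c, H.Adj u a → H.Adj u b → H.Adj u c → a ≠ b → a ≠ c → b ≠ c →
    H.Adj a b → H.Adj b c → (nbrs H u).card ≠ 3

namespace Sparse
variable [Fintype V] {c d x y : V}

theorem nbrs_subset_of_closed {S : Finset V} (hab : H.Adj b a) (ha : a ∈ S)
    (hS : ∀ x ∈ S, H.Adj b x → R.nxt b x ∈ S) : (nbrs H b) ⊆ S := by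
  intro w hw
  exact R.trans b a (S : Set V) hab ha hS w (mem_nbrs.1 hw)

theorem nxt_ne (hR : R.Sparse) (h : H.Adj b a) : R.nxt b a ≠ a := by
  intro h1
  have := Finset.card_le_card (nbrs_subset_of_closed (R := R) (S := {a}) h (by simp)
    (by simp only [Finset.mem_singleton]; rintro x rfl -; exact h1))
  have := hR.deg b
  simp at *
  omega

theorem nxt_nxt_ne (hR : R.Sparse) (h : H.Adj b a) : R.nxt b (R.nxt b a) ≠ a := by
  intro h1
  have := Finset.card_le_card (nbrs_subset_of_closed (R := R) (S := {a, R.nxt b a}) h (by simp)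
    (by simp only [Finset.mem_insert, Finset.mem_singleton]; rintro x (rfl | rfl) -
        · exact Or.inr rfl
        · exact Or.inl h1))
  have := hR.deg b
  have := Finset.card_le_two (a := a) (b := R.nxt b a)
  omega

theorem card_eq_three (hR : R.Sparse) (h : H.Adj b a)
    (h1 : R.nxt b (R.nxt b (R.nxt b a)) = a) : (nbrs H b).card = 3 := by
  have := Finset.card_le_card (nbrs_subset_of_closed (R := R)
    (S := {a, R.nxt b a, R.nxt b (R.nxt b a)}) h (by simp)
    (by simp only [Finset.mem_insert, Finset.mem_singleton]; rintro x (rfl | rfl | rfl) -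
        · exact Or.inr (Or.inl rfl)
        · exact Or.inr (Or.inr rfl)
        · exact Or.inl h1))
  have := hR.deg b
  have := Finset.card_le_three (a := a) (b := R.nxt b a) (c := R.nxt b (R.nxt b a))
  omega

theorem nxt3_of_card (hR : R.Sparse) (h : H.Adj b a) (hc : (nbrs H b).card = 3) :
    R.nxt b (R.nxt b (R.nxt b a)) = a := by
  have h1 := R.adj h
  have h2 := R.adj h1
  have h3 := R.adj h2
  have hsub : {a, R.nxt b a, R.nxt b (R.nxt b a)} ⊆ nbrs H b := by
    intro x; simp only [Finset.mem_insert, Finset.mem_singleton]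
    rintro (rfl | rfl | rfl) <;> simpa
  have hcard : ({a, R.nxt b a, R.nxt b (R.nxt b a)} : Finset V).card = 3 := by
    rw [Finset.card_eq_three]
    exact ⟨_, _, _, (hR.nxt_ne h).symm, (hR.nxt_nxt_ne h).symm, (hR.nxt_ne h1).symm, rfl⟩
  have heq := Finset.eq_of_subset_of_card_le hsub (by omega)
  have h3' : R.nxt b (R.nxt b (R.nxt b a)) ∈ nbrs H b := by simpa
  rw [← heq] at h3'
  simp only [Finset.mem_insert, Finset.mem_singleton] at h3'
  rcases h3' with h | h | h
  · exact h
  · exact absurd h (hR.nxt_nxt_ne h1)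
  · exact absurd h (hR.nxt_ne h2)

/-- Two sides of a triangular face, meeting in `b`, are not both shared with other triangular
faces. -/
theorem not_tri_tri (hR : R.Sparse) (h : R.Tri a b) (h1 : R.Tri b a)
    (h2 : R.Tri (R.nxt b a) b) : False := by
  obtain ⟨hab, hc1, hc2⟩ := h
  have hac := Tri.adj_third ⟨hab, hc1, hc2⟩
  set c := R.nxt b a with hc
  have hbc : H.Adj b c := adj_nxt hab
  obtain ⟨-, hp1, hp2⟩ := h1
  have hbp := Tri.adj_third ⟨hab.symm, hp1, hp2⟩
  set p := R.nxt a b with hp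
  have hap : H.Adj a p := adj_nxt hab.symm
  obtain ⟨-, hq1, hq2⟩ := h2
  have hcq := Tri.adj_third ⟨hbc.symm, hq1, hq2⟩
  set q := R.nxt b c with hq
  have hbq : H.Adj b q := adj_nxt hbc.symm
  have haq : a ≠ q := by
    intro h
    exact hR.nxt_nxt_ne hab.symm (by rw [← hc, ← hq, h])
  have hpc : p ≠ c := by
    intro h
    rw [h] at hp2
    exact haq hp2.symm
  by_cases hpq : p = q
  · refine hR.no3 b p a c hbp hab.symm hbc hap.ne.symm hpc hac.ne hap.symm hac
      (hR.card_eq_three hbp ?_)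
    rw [hp2, ← hc, ← hq, hpq]
  · exact hR.c5 a p b q c hap hbp.symm hbq hcq.symm hac.symm hab.ne haq hpq hpc hbc.ne

/-- A triangular face does not share an edge with a quadrangular face. -/
theorem not_tri_quad (hR : R.Sparse) (h : R.Tri a b) (h1 : R.Quad b a) : False := by
  obtain ⟨hab, hc1, hc2⟩ := h
  have hac := Tri.adj_third ⟨hab, hc1, hc2⟩
  set c := R.nxt b a with hc
  have hbc : H.Adj b c := adj_nxt hab
  obtain ⟨-, hq1, hq2⟩ := h1
  set p := R.nxt a b with hp
  have hap : H.Adj a p := adj_nxt hab.symm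
  set q := R.nxt p a with hq
  have hpq : H.Adj p q := adj_nxt hap
  have hqb : H.Adj q b := by rw [← hq1]; exact adj_nxt hpq
  refine hR.c5 a c b q p hac hbc.symm hqb.symm hpq.symm hap.symm hab.ne
    (hR.nxt_ne hap.symm).symm ?_ ?_ (hR.nxt_ne hab).symm
  · intro h
    apply hR.nxt_nxt_ne hab.symm
    rw [← hc, h, hq2]
  · intro h
    apply hR.nxt_nxt_ne hab
    rw [← hp, ← h, hc2]

/-- The reverse of a dart of a triangular face is in a triangular or a big face. -/
theorem big_of_tri (hR : R.Sparse) (h : R.Tri a b) (h1 : ¬ R.Tri b a) : R.Big b a :=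
  ⟨h.1.symm, h1, fun h2 => hR.not_tri_quad h h2⟩

/-- At a vertex of degree three, at most one corner is triangular. -/
theorem tri_unique (hR : R.Sparse) (hd : (nbrs H b).card = 3) (h1 : R.Tri x b)
    (h2 : R.Tri y b) : x = y := by
  by_contra hxy
  have h3 := hR.nxt3_of_card h1.1.symm hd
  have hx := h1.1.symm
  have hx1 := R.adj hx
  have hx2 := R.adj hx1
  have n1 := hR.nxt_ne hx
  have n2 := hR.nxt_ne hx1
  have n3 := hR.nxt_nxt_ne hx
  have hy : y = x ∨ y = R.nxt b x ∨ y = R.nxt b (R.nxt b x) := by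
    have := nbrs_subset_of_closed (R := R) (S := {x, R.nxt b x, R.nxt b (R.nxt b x)}) hx
      (by simp) (by
        simp only [Finset.mem_insert, Finset.mem_singleton]; rintro x (rfl | rfl | rfl) -
        · exact Or.inr (Or.inl rfl)
        · exact Or.inr (Or.inr rfl)
        · exact Or.inl h3) (mem_nbrs.2 h2.1.symm)
    simpa using this
  rcases hy with rfl | rfl | rfl
  · exact hxy rfl
  · exact hR.no3 b _ _ _ hx hx1 hx2 n1.symm n3.symm n2.symm h1.adj_third h2.adj_third hd
  · have := h2.adj_third
    rw [h3] at this
    exact hR.no3 b _ _ _ hx2 hx hx1 n3 n2 n1.symm this h1.adj_third hd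

/-- At a vertex of degree three, at most one corner is not big. -/
theorem small_unique (hR : R.Sparse) (hd : (nbrs H b).card = 3) (hx : H.Adj x b)
    (hy : H.Adj y b) (hxy : x ≠ y) (h1 : ¬ R.Big x b) (h2 : ¬ R.Big y b) : False := by
  have h3 := hR.nxt3_of_card hx.symm hd
  wlog hyx : y = R.nxt b x generalizing x y
  · have hy' : y = R.nxt b (R.nxt b x) := by
      have := nbrs_subset_of_closed (R := R) (S := {x, R.nxt b x, R.nxt b (R.nxt b x)}) hx.symm
        (by simp) (by
          simp only [Finset.mem_insert, Finset.mem_singleton]; rintro x (rfl | rfl | rfl) -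
          · exact Or.inr (Or.inl rfl)
          · exact Or.inr (Or.inr rfl)
          · exact Or.inl h3) (mem_nbrs.2 hy.symm)
      simp only [Finset.mem_insert, Finset.mem_singleton] at this
      grind
    have hxe : x = R.nxt b y := by rw [hy', h3]
    exact this hy hx hxy.symm h2 h1 (by rw [hy', h3]) hxe
  have hsmall : ∀ {z}, H.Adj z b → ¬ R.Big z b → R.Tri z b ∨ R.Quad z b := by
    intro z hz hb
    by_contra! h
    exact hb ⟨hz, h.1, h.2⟩
  rcases hsmall hx h1 with t1 | q1 <;> rcases hsmall hy h2 with t2 | q2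
  · exact hxy (hR.tri_unique hd t1 t2)
  · have := t1.next
    rw [← hyx] at this
    exact hR.not_tri_quad this q2
  · have := (quad_next_iff hx).2 q1
    rw [← hyx] at this
    exact hR.not_tri_quad t2 this
  · set z := R.nxt b y with hz
    have hbz : H.Adj b z := adj_nxt hy
    rw [← hyx, ← hz] at h3
    obtain ⟨-, p1, p2⟩ := q1
    rw [← hyx] at p1 p2
    set p := R.nxt y b with hp
    have hyp : H.Adj y p := adj_nxt hy.symm
    have hpx : H.Adj p x := by rw [← p1]; exact adj_nxt hyp
    obtain ⟨-, q1, q2⟩ := q2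
    rw [← hz] at q1 q2
    set q := R.nxt z b with hq
    have hzq : H.Adj z q := adj_nxt hbz
    have hqy : H.Adj q y := by rw [← q1]; exact adj_nxt hzq
    have hzx : z ≠ x := by
      have := hR.nxt_ne hbz
      rw [h3] at this
      exact this.symm
    have hzy : z ≠ y := hR.nxt_ne hy.symm
    have hpz : p ≠ z := by
      intro h
      rw [h] at hyp hpx
      exact hR.no3 b x z y hx.symm hbz hy.symm hzx.symm hxy hzy hpx.symm hyp.symm hd
    have hqx : q ≠ x := by
      intro h
      rw [h] at hqy hzq
      exact hR.no3 b z x y hbz hx.symm hy.symm hzx hzy hxy hzq hqy hd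
    have hpq : p ≠ q := by
      intro h
      apply hR.nxt_nxt_ne hy
      rw [← hp, h, q2]
    exact hR.c6 x p y q z b hpx.symm hyp.symm hqy.symm hzq.symm hbz.symm hx.symm
      hxy hpq hzy.symm (hR.nxt_ne hbz.symm) hzx (hR.nxt_ne hy).symm hqx.symm hpz hy.ne

end Sparse
end Rot
end

section
open scoped Classical

/-! ### Discharging: local inequalities -/

namespace Rot
variable {V : Type*} {H : SimpleGraph V} (R : Rot H)

/-- The charge sent by the face of `(a, b)` across the edge `a b`. -/
noncomputable def toTri (a b : V) : ℚ :=
  if R.Big a b ∧ R.Tri b a then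
    if R.Tri b (R.nxt a b) ∨ R.Tri (R.nxt a b) a then 21 else 14
  else 0

/-- The charge sent by the face of `(a, b)` to its corner `b`. -/
noncomputable def toVert [Fintype V] (a b : V) : ℚ :=
  if R.Big a b ∧ (nbrs H b).card = 3 then 6 else 0

/-- The vertex `b` sends charge to its corner in the face of `(a, b)`. -/
def Gives (a b : V) : Prop :=
  R.Big a b ∧ R.Tri b a ∧ R.Tri (R.nxt b a) b ∧
    (R.Tri b (R.nxt a b) ∨ R.Tri (R.nxt b (R.nxt b a)) b)

/-- The charge sent by the vertex `b` to its corner in the face of `(a, b)`. -/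
noncomputable def fromVert (a b : V) : ℚ := if R.Gives a b then 6 else 0

/-- The share of `(a, b)` in the charge passing at its head. -/
noncomputable def outShare (a b : V) : ℚ :=
  if R.Tri b a then if R.Tri b (R.nxt a b) then -3 else 0 else 6

/-- The share of `(a, b)` in the charge passing at its tail. -/
noncomputable def inShare (a b : V) : ℚ :=
  if R.Tri b a then if R.Tri (R.nxt a b) a then -3 else 0 else 6

variable {R} {a b c x y z : V}

theorem toTri_nonneg : 0 ≤ R.toTri a b := by
  unfold toTri; split_ifs <;> norm_num

theorem fromVert_nonneg : 0 ≤ R.fromVert a b := by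
  unfold fromVert; split_ifs <;> norm_num

namespace Sparse
variable [Fintype V]

theorem card_ne_three_of_tri (hR : R.Sparse) (h1 : R.Tri x b) (h2 : R.Tri y b) (hxy : x ≠ y) :
    (nbrs H b).card ≠ 3 := fun h => hxy (hR.tri_unique h h1 h2)

/-- No three consecutive corners at a vertex are triangular. -/
theorem not_three_corners (hR : R.Sparse) (h1 : R.Tri x b) (h2 : R.Tri (R.nxt b x) b)
    (h3 : R.Tri (R.nxt b (R.nxt b x)) b) : False :=
  hR.not_tri_tri h2 h1.next h3

theorem toTri_add_shares (hR : R.Sparse) (hb : R.Big a b) :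
    R.toTri a b + R.outShare a b + R.inShare a b ≤ 18 := by
  unfold toTri outShare inShare
  by_cases h : R.Tri b a
  · have h3 : ¬ (R.Tri b (R.nxt a b) ∧ R.Tri (R.nxt a b) a) := by
      rintro ⟨h1, h2⟩
      exact hR.not_tri_tri h.next h2 (by rwa [h.2.1])
    simp only [h, hb, true_and, if_true]
    by_cases h1 : R.Tri b (R.nxt a b) <;> by_cases h2 : R.Tri (R.nxt a b) a
    · exact absurd ⟨h1, h2⟩ h3
    all_goals simp [h1, h2]; try norm_num
  · simp [h]; norm_num

/-- Two triangular faces on the two sides of a corner of a big face. -/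
theorem card_ne_three_of_corner (hR : R.Sparse) (h1 : R.Tri b a) (h2 : R.Tri (R.nxt b a) b) :
    (nbrs H b).card ≠ 3 := by
  refine hR.card_ne_three_of_tri h1.prev h2 fun h => ?_
  have := h1.2.2
  rw [h] at this
  exact hR.nxt_nxt_ne h1.1 this

theorem corner_le (hR : R.Sparse) (hb : R.Big a b) :
    R.toVert a b - R.fromVert a b ≤ R.outShare a b + R.inShare b (R.nxt b a) := by
  have hab := hb.1
  unfold toVert fromVert Gives outShare inShare
  by_cases h1 : R.Tri b a <;> by_cases h2 : R.Tri (R.nxt b a) b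
  · have h3 := hR.card_ne_three_of_corner h1 h2
    by_cases h4 : R.Tri b (R.nxt a b) <;> by_cases h5 : R.Tri (R.nxt b (R.nxt b a)) b <;>
      simp [h1, h2, h3, h4, h5, hb] <;> norm_num
  · by_cases h4 : R.Tri b (R.nxt a b)
    · have h3 : (nbrs H b).card ≠ 3 := by
        refine hR.card_ne_three_of_tri h1.prev h4.prev fun h => ?_
        have := h4.2.2
        rw [← h] at this
        exact hR.nxt_ne h4.1 this
      simp [h1, h2, h3, h4]; norm_num
    · simp [h1, h2, h4]; split_ifs <;> norm_num
  · by_cases h5 : R.Tri (R.nxt b (R.nxt b a)) b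
    · have h3 : (nbrs H b).card ≠ 3 :=
        hR.card_ne_three_of_tri h2 h5 (hR.nxt_ne (adj_nxt hab)).symm
      simp [h1, h2, h3, h5]; norm_num
    · simp [h1, h2, h5]; split_ifs <;> norm_num
  · simp [h1, h2]; split_ifs <;> norm_num

/-- The three edges of a triangular face receive enough charge. -/
theorem tri_receives (hR : R.Sparse) (h : R.Tri a b) :
    42 ≤ R.toTri b a + R.toTri (R.nxt b a) b + R.toTri a (R.nxt b a) := by
  have h1 := hR.not_tri_tri h
  have h2 := hR.not_tri_tri h.next
  have h3 := hR.not_tri_tri h.prev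
  have b1 := hR.big_of_tri h
  have b2 := hR.big_of_tri h.next
  have b3 := hR.big_of_tri h.prev
  have t2 := h.next
  have t3 := h.prev
  have e1 := h.2.1
  have e2 := h.2.2
  set c := R.nxt b a with hc
  rw [e1] at h2
  rw [e2] at h3
  unfold toTri
  rw [e1, e2, ← hc]
  have n1 : R.Tri b a → ¬ R.Big b a := fun t b => b.2.1 t
  have n2 : R.Tri c b → ¬ R.Big c b := fun t b => b.2.1 t
  have n3 : R.Tri a c → ¬ R.Big a c := fun t b => b.2.1 t
  by_cases q1 : R.Tri b a <;> by_cases q2 : R.Tri c b <;> by_cases q3 : R.Tri a c <;>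
    simp_all <;> norm_num

theorem card_le_sum_toVert (hR : R.Sparse) (hd : (nbrs H b).card = 3) :
    12 ≤ ∑ a ∈ nbrs H b, (R.toVert a b - R.fromVert a b) := by
  have h0 : ∀ a ∈ nbrs H b, R.toVert a b - R.fromVert a b = if R.Big a b then 6 else 0 := by
    intro a ha
    have : R.fromVert a b = 0 := by
      unfold fromVert
      rw [if_neg]
      rintro ⟨-, h1, h2, -⟩
      exact hR.card_ne_three_of_corner h1 h2 hd
    rw [this, toVert]
    simp [hd]
  rw [Finset.sum_congr rfl h0, ← Finset.sum_filter, Finset.sum_const, nsmul_eq_mul]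
  have h1 : ((nbrs H b).filter fun a => ¬ R.Big a b).card ≤ 1 := by
    rw [Finset.card_le_one]
    intro x hx y hy
    rw [Finset.mem_filter, mem_nbrs] at hx hy
    by_contra hxy
    exact hR.small_unique hd hx.1.symm hy.1.symm hxy hx.2 hy.2
  have h2 := Finset.card_filter_add_card_filter_not (s := nbrs H b) (fun a => R.Big a b)
  have h3 : 2 ≤ ((nbrs H b).filter fun a => R.Big a b).card := by omega
  have : (2 : ℚ) ≤ ((nbrs H b).filter fun a => R.Big a b).card := by exact_mod_cast h3
  linarith

theorem five_le_of_gives (hR : R.Sparse) (hd : (nbrs H b).card ≠ 3) (h : R.Gives a b) :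
    3 ≤ ((nbrs H b).filter fun a => R.Tri a b).card ∧
      2 ≤ ((nbrs H b).filter fun a => ¬ R.Tri a b).card := by
  have key : ∀ u v w x y, R.Tri u b → R.Tri v b → R.Tri w b → H.Adj b x → H.Adj b y →
      ¬ R.Tri x b → ¬ R.Tri y b → u ≠ v → u ≠ w → v ≠ w → x ≠ y →
      3 ≤ ((nbrs H b).filter fun a => R.Tri a b).card ∧
      2 ≤ ((nbrs H b).filter fun a => ¬ R.Tri a b).card := by
    intro u v w x y tu tv tw ax ay tx ty huv huw hvw hxy
    constructor
    · rw [← Finset.card_eq_three.2 ⟨u, v, w, huv, huw, hvw, rfl⟩]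
      apply Finset.card_le_card
      intro z
      simp only [Finset.mem_insert, Finset.mem_singleton, Finset.mem_filter, mem_nbrs]
      rintro (rfl | rfl | rfl)
      exacts [⟨tu.1.symm, tu⟩, ⟨tv.1.symm, tv⟩, ⟨tw.1.symm, tw⟩]
    · rw [← Finset.card_pair hxy]
      apply Finset.card_le_card
      intro z
      simp only [Finset.mem_insert, Finset.mem_singleton, Finset.mem_filter, mem_nbrs]
      rintro (rfl | rfl)
      exacts [⟨ax, tx⟩, ⟨ay, ty⟩]
  obtain ⟨hb, h1, h2, h3⟩ := h
  have hba := h1.1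
  have t1 := h1.prev
  have e1 := h1.2.2
  set c := R.nxt a b with hc
  have hbc := t1.1.symm
  have ne1 : c ≠ R.nxt b a := by
    intro h; rw [h] at e1; exact hR.nxt_nxt_ne hba e1
  have hba1 := R.adj hba
  have hba2 := R.adj hba1
  rcases h3 with h3 | h3
  · have t2 := h3.prev
    have e2 := h3.2.2
    set c' := R.nxt c b with hc'
    have hbc' := t2.1.symm
    obtain ⟨c'', hbc'', e3⟩ := R.surj hbc'
    refine key c' c (R.nxt b a) a c'' t2 t1 h2 hba hbc'' hb.2.1 ?_ ?_ ?_ ne1 ?_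
    · intro t3
      exact hR.not_three_corners t3 (by rwa [e3]) (by rwa [e3, e2])
    · intro h; rw [← h] at e2; exact hR.nxt_ne hbc' (by rw [e2, h])
    · intro h
      rw [h] at e2
      exact hd (hR.card_eq_three hba (by rw [e2, e1]))
    · rintro rfl
      exact hd (hR.card_eq_three hba (by rw [e3, e2, e1]))
  · refine key c (R.nxt b a) (R.nxt b (R.nxt b a)) a (R.nxt b (R.nxt b (R.nxt b a))) t1 h2 h3
      hba (R.adj hba2) hb.2.1 ?_ ne1 ?_ (hR.nxt_ne hba1).symm ?_
    · exact hR.not_three_corners h2 h3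
    · intro h
      exact hd (hR.card_eq_three hba (by rw [← h, e1]))
    · intro h
      exact hd (hR.card_eq_three hba h.symm)

/-- Vertices end up with nonnegative charge. -/
theorem vertex_charge (hR : R.Sparse) :
    0 ≤ 12 * ((nbrs H b).card - 4 : ℚ) + ∑ a ∈ nbrs H b, (R.toVert a b - R.fromVert a b) := by
  by_cases hd : (nbrs H b).card = 3
  · have := hR.card_le_sum_toVert hd
    rw [hd]; push_cast; linarith
  · have h3 := hR.deg b
    have h0 : ∀ a ∈ nbrs H b, R.toVert a b - R.fromVert a b = - if R.Gives a b then 6 else 0 := by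
      intro a ha
      simp [toVert, hd, fromVert]
    rw [Finset.sum_congr rfl h0, Finset.sum_neg_distrib, ← Finset.sum_filter, Finset.sum_const,
      nsmul_eq_mul]
    have h4 : (4 : ℚ) ≤ (nbrs H b).card := by
      have : 4 ≤ (nbrs H b).card := by omega
      exact_mod_cast this
    rcases Finset.eq_empty_or_nonempty ((nbrs H b).filter fun a => R.Gives a b) with he | ⟨a, ha⟩
    · rw [he]; simp only [Finset.card_empty, Nat.cast_zero, zero_mul, neg_zero]; linarith
    · rw [Finset.mem_filter] at ha
      obtain ⟨h5, h6⟩ := hR.five_le_of_gives hd ha.2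
      have h7 : ((nbrs H b).filter fun a => R.Gives a b).card ≤
          ((nbrs H b).filter fun a => ¬ R.Tri a b).card := by
        apply Finset.card_le_card
        intro x hx
        rw [Finset.mem_filter] at hx ⊢
        exact ⟨hx.1, hx.2.1.2.1⟩
      have h8 := Finset.card_filter_add_card_filter_not (s := nbrs H b) (fun a => R.Tri a b)
      have h9 : ((nbrs H b).filter fun a => R.Gives a b).card * 6 + 48 ≤
        12 * (nbrs H b).card := by omega
      have : ((((nbrs H b).filter fun a => R.Gives a b).card * 6 + 48 : ℕ) : ℚ) ≤
        (12 * (nbrs H b).card : ℕ) := by exact_mod_cast h9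
      push_cast at this
      linarith

theorem lobe_aux (hR : R.Sparse) (hxz : H.Adj x z) (e : R.nxt y x = z) (h1 : R.Tri y x)
    (h2 : R.Tri z y) : False := by
  have hyx := h1.1
  have hzy := h2.1
  have hxa := h1.next.1
  have hay := h1.prev.1
  have hyb := h2.next.1
  have hbz := h2.prev.1
  have e1 := h1.2.2
  set a := R.nxt x y with ha
  set b := R.nxt y z with hb
  have haz : a ≠ z := by
    intro h
    rw [h, ← e] at e1
    exact hR.nxt_nxt_ne hyx e1
  have hxb : x ≠ b := by
    intro h
    rw [hb, ← e] at h
    exact hR.nxt_nxt_ne hyx h.symm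
  by_cases hab : a = b
  · refine hR.no3 y a x z hay.symm hyx hzy.symm hxa.ne.symm haz hxz.ne hxa.symm hxz ?_
    exact hR.card_eq_three hyx (by rw [e, ← hb, ← hab, e1])
  · exact hR.c5 x a y b z hxa hay hyb hbz hxz.symm hyx.ne.symm hxb hab haz hzy.ne.symm

theorem lobe (hR : R.Sparse) (hxy : H.Adj x y) (hxz : H.Adj x z) (e1 : R.nxt y x = z)
    (e2 : R.nxt z y = x) :
    R.toTri x y + R.toTri y z + R.toTri z x + R.toVert x y + R.toVert y z ≤ 42 := by
  have hyz : H.Adj y z := e1 ▸ adj_nxt hxy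
  have n1 : ¬ (R.Tri y x ∧ R.Tri z y) := fun h => hR.lobe_aux hxz e1 h.1 h.2
  have n2 : ¬ (R.Tri z y ∧ R.Tri x z) := fun h => hR.lobe_aux hxy.symm e2 h.1 h.2
  have n3 : R.Tri y x → R.Tri x z → (nbrs H y).card ≠ 3 ∧ (nbrs H z).card ≠ 3 := by
    intro h1 h3
    have hxa := h1.next.1
    have hay := h1.prev.1
    have hzc := h3.next.1
    have hcx := h3.prev.1
    have f1 := h1.2.2
    set a := R.nxt x y with ha
    set c := R.nxt z x with hc
    have haz : a ≠ z := by
      intro h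
      rw [h, ← e1] at f1
      exact hR.nxt_nxt_ne hxy.symm f1
    have hyc : y ≠ c := by
      intro h
      rw [hc, ← e2] at h
      exact hR.nxt_nxt_ne hyz.symm h.symm
    by_cases hac : a = c
    · rw [← hac] at hzc
      exact ⟨hR.no3 y z x a hyz hxy.symm hay.symm hxz.ne.symm haz.symm hxa.ne hxz.symm hxa,
        hR.no3 z y x a hyz.symm hxz.symm hzc hxy.ne.symm hay.ne.symm hxa.ne hxy.symm hxa⟩
    · exact (hR.c5 y a x c z hay.symm hxa.symm hcx.symm hzc.symm hyz.symm hxy.ne.symm hyc hac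
        haz hxz.ne).elim
  have b1 : R.toTri x y ≤ if R.Tri y x then 21 else 0 := by
    unfold toTri; split_ifs <;> simp_all; norm_num
  have b2 : R.toTri y z ≤ if R.Tri z y then 21 else 0 := by
    unfold toTri; split_ifs <;> simp_all; norm_num
  have b3 : R.toTri z x ≤ if R.Tri x z then 21 else 0 := by
    unfold toTri; split_ifs <;> simp_all; norm_num
  have b4 : R.toVert x y ≤ if (nbrs H y).card = 3 then 6 else 0 := by
    unfold toVert; split_ifs <;> simp_all
  have b5 : R.toVert y z ≤ if (nbrs H z).card = 3 then 6 else 0 := by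
    unfold toVert; split_ifs <;> simp_all
  by_cases q1 : R.Tri y x <;> by_cases q2 : R.Tri z y <;> by_cases q3 : R.Tri x z <;>
    simp only [q1, q2, q3, if_true, if_false, true_and, and_true, not_true, not_false_iff] at * <;>
    first
    | linarith
    | (have := n3 trivial trivial
       rw [if_neg this.1] at b4
       rw [if_neg this.2] at b5
       linarith)
    | (have b6 : R.toVert x y ≤ 6 := b4.trans (by split_ifs <;> norm_num)
       have b7 : R.toVert y z ≤ 6 := b5.trans (by split_ifs <;> norm_num)
       linarith)

end Sparse
end Rot
end

section
open scoped Classical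

/-! ### Discharging: summing up -/

theorem orbWt_le {α : Type*} [Fintype α] {f : α → α} (hf : Function.Injective f) {x : α} {k : ℕ}
    (hk : 0 < k) (h : ∀ j, 0 < j → j < k → f^[j] x ≠ x) : orbWt f x ≤ 1 / k := by
  have hpos := Function.minimalPeriod_pos_of_mem_periodicPts (mem_periodicPts_of_injective hf x)
  have hle : k ≤ Function.minimalPeriod f x := by
    by_contra! hlt
    exact h _ hpos hlt (Function.isPeriodicPt_minimalPeriod f x)
  unfold orbWt
  apply one_div_le_one_div_of_le
  · exact_mod_cast hk
  · exact_mod_cast hle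

theorem sum_iterate_of_invariant {α : Type*} [Fintype α] {f : α → α} (hf : Function.Injective f)
    {S : Finset α} (hS : ∀ x ∈ S, f x ∈ S) (g : α → ℚ) (k : ℕ) :
    ∑ x ∈ S, g (f^[k] x) = ∑ x ∈ S, g x := by
  induction k with
  | zero => rfl
  | succ k ih =>
    rw [← ih]
    simp only [Function.iterate_succ_apply]
    exact sum_comp_of_invariant hf hS (fun x => g (f^[k] x))

namespace Rot
variable {V : Type*} {H : SimpleGraph V} {R : Rot H} {a b c x y z : V}

theorem face_ne (h : H.Adj a b) : R.face (a, b) ≠ (a, b) := by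
  rw [R.face_of_adj h]
  intro h1
  exact h.ne (Prod.mk.inj h1).1.symm

namespace Sparse
variable [Fintype V]

theorem nxt_five (hR : R.Sparse) (h : H.Adj a b) : R.face^[5] (a, b) ≠ (a, b) := by
  intro h5
  simp only [Function.iterate_succ_apply, Function.iterate_zero, id] at h5
  have h1 := adj_nxt (R := R) h
  rw [R.face_of_adj h] at h5
  set c := R.nxt b a with hc
  have h2 := adj_nxt (R := R) h1
  rw [R.face_of_adj h1] at h5
  set d := R.nxt c b with hd
  have h3 := adj_nxt (R := R) h2
  rw [R.face_of_adj h2] at h5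
  set e := R.nxt d c with he
  rw [R.face_of_adj h3, R.face_of_adj (adj_nxt h3), Prod.mk.injEq] at h5
  obtain ⟨h5, h6⟩ := h5
  rw [h5] at h6
  have h4 : H.Adj e a := h5 ▸ adj_nxt h3
  exact hR.c5 a b c d e h h1 h2 h3 h4 (hR.nxt_ne h.symm).symm (h5 ▸ hR.nxt_ne h3.symm)
    (hR.nxt_ne h1.symm).symm (h6 ▸ hR.nxt_ne h4.symm) (hR.nxt_ne h2.symm).symm

theorem face_face_ne (hR : R.Sparse) (h : H.Adj a b) : R.face (R.face (a, b)) ≠ (a, b) := by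
  rw [R.face_of_adj h, R.face_of_adj (adj_nxt h)]
  intro h1
  exact hR.nxt_ne h.symm (Prod.mk.inj h1).1

/-- The initial charge of a dart. -/
theorem charge_tri (hR : R.Sparse) (h : R.Tri a b) : -14 ≤ 42 * (1 - 4 * orbWt R.face (a, b)) := by
  have := orbWt_le R.face_injective (x := (a, b)) (k := 3) (by norm_num) (by
    intro j hj hj'
    interval_cases j
    · exact face_ne h.1
    · exact hR.face_face_ne h.1)
  norm_num at this
  linarith

theorem charge_not_tri (hR : R.Sparse) (h : H.Adj a b) (ht : ¬ R.Tri a b) :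
    0 ≤ 42 * (1 - 4 * orbWt R.face (a, b)) := by
  have := orbWt_le R.face_injective (x := (a, b)) (k := 4) (by norm_num) (by
    intro j hj hj'
    interval_cases j
    · exact face_ne h
    · exact hR.face_face_ne h
    · rwa [tri_iff h] at ht)
  norm_num at this
  linarith

theorem charge_big (hR : R.Sparse) (h : R.Big a b) :
    14 ≤ 42 * (1 - 4 * orbWt R.face (a, b)) := by
  have := orbWt_le R.face_injective (x := (a, b)) (k := 6) (by norm_num) (by
    intro j hj hj'
    interval_cases j
    · exact face_ne h.1
    · exact hR.face_face_ne h.1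
    · have := h.2.1; rwa [tri_iff h.1] at this
    · have := h.2.2; rwa [quad_iff h.1] at this
    · exact hR.nxt_five h.1)
  norm_num at this
  linarith

theorem charge_big' (hR : R.Sparse) (h : R.Big a b) (h6 : R.face^[6] (a, b) ≠ (a, b)) :
    18 ≤ 42 * (1 - 4 * orbWt R.face (a, b)) := by
  have := orbWt_le R.face_injective (x := (a, b)) (k := 7) (by norm_num) (by
    intro j hj hj'
    interval_cases j
    · exact face_ne h.1
    · exact hR.face_face_ne h.1
    · have := h.2.1; rwa [tri_iff h.1] at this
    · have := h.2.2; rwa [quad_iff h.1] at this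
    · exact hR.nxt_five h.1
    · exact h6)
  norm_num at this
  linarith

theorem six_aux (hR : R.Sparse) {u v w x y : V} (hb : R.Big u v) (e1 : R.nxt v u = w)
    (e2 : R.nxt w v = u) (e3 : R.nxt u w = x) (e4 : R.nxt x u = y) (e5 : R.nxt y x = u)
    (e6 : R.nxt u y = v) :
    R.toTri u v + R.toTri v w + R.toTri w u + R.toTri u x + R.toTri x y + R.toTri y u +
      (R.toVert u v + R.toVert v w + R.toVert w u + R.toVert u x + R.toVert x y + R.toVert y u)
      ≤ 84 := by
  have a1 := hb.1
  have a2 : H.Adj v w := e1 ▸ adj_nxt a1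
  have a3 : H.Adj w u := e2 ▸ adj_nxt a2
  have a4 : H.Adj u x := e3 ▸ adj_nxt a3
  have a5 : H.Adj x y := e4 ▸ adj_nxt a4
  have a6 : H.Adj y u := e5 ▸ adj_nxt a5
  have hxw : x ≠ w := e3 ▸ hR.nxt_ne a3.symm
  have hvy : v ≠ y := e6 ▸ hR.nxt_ne a6.symm
  have hvx : v ≠ x := by
    rintro rfl
    exact hb.2.1 ⟨a1, by rw [e1, e2], by rw [e1, e3]⟩
  have hd : (nbrs H u).card ≠ 3 := by
    intro hd
    have hwy : w ≠ y := by
      rintro rfl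
      exact hb.2.1 ⟨a1, by rw [e1, e2], by rw [e1, e6]⟩
    have hs : ({v, w, x, y} : Finset V) ⊆ nbrs H u := by
      intro z
      simp only [Finset.mem_insert, Finset.mem_singleton, mem_nbrs]
      rintro (rfl | rfl | rfl | rfl)
      exacts [a1, a3.symm, a4, a6.symm]
    have := Finset.card_le_card hs
    rw [Finset.card_insert_of_notMem, Finset.card_eq_three.2 ⟨w, x, y, hxw.symm, hwy, a5.ne, rfl⟩,
      hd] at this
    · omega
    · simp [a2.ne, hvx, hvy]
  have l1 := hR.lobe a1 a3.symm e1 e2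
  have l2 := hR.lobe a4 a6.symm e4 e5
  have z1 : R.toVert w u = 0 := by simp [toVert, hd]
  have z2 : R.toVert y u = 0 := by simp [toVert, hd]
  linarith

theorem six_le (hR : R.Sparse) {v0 v1 v2 v3 v4 v5 : V} (hb : R.Big v0 v1) (e1 : R.nxt v1 v0 = v2)
    (e2 : R.nxt v2 v1 = v3) (e3 : R.nxt v3 v2 = v4) (e4 : R.nxt v4 v3 = v5)
    (e5 : R.nxt v5 v4 = v0) (e6 : R.nxt v0 v5 = v1) :
    R.toTri v0 v1 + R.toTri v1 v2 + R.toTri v2 v3 + R.toTri v3 v4 + R.toTri v4 v5 + R.toTri v5 v0 +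
      (R.toVert v0 v1 + R.toVert v1 v2 + R.toVert v2 v3 + R.toVert v3 v4 + R.toVert v4 v5 +
        R.toVert v5 v0) ≤ 84 := by
  have b1 := e1 ▸ hb.next
  have b2 := e2 ▸ b1.next
  have b3 := e3 ▸ b2.next
  have b4 := e4 ▸ b3.next
  have b5 := e5 ▸ b4.next
  by_cases h0 : v0 = v3
  · subst h0
    exact hR.six_aux hb e1 e2 e3 e4 e5 e6
  by_cases h1 : v1 = v4
  · subst h1
    have := hR.six_aux b1 e2 e3 e4 e5 e6 e1
    linarith
  by_cases h2 : v2 = v5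
  · subst h2
    have := hR.six_aux b2 e3 e4 e5 e6 e1 e2
    linarith
  exact (hR.c6 v0 v1 v2 v3 v4 v5 hb.1 b1.1 b2.1 b3.1 b4.1 b5.1
    (e1 ▸ hR.nxt_ne hb.1.symm).symm (e2 ▸ hR.nxt_ne b1.1.symm).symm
    (e3 ▸ hR.nxt_ne b2.1.symm).symm (e4 ▸ hR.nxt_ne b3.1.symm).symm
    (e5 ▸ (hR.nxt_ne b4.1.symm).symm) (e6 ▸ hR.nxt_ne b5.1.symm).symm.symm.symm h0 h1 h2).elim

theorem sum_six_le (hR : R.Sparse) (h : R.Big a b) (h6 : R.face^[6] (a, b) = (a, b)) :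
    ∑ k ∈ Finset.range 6, (R.toTri (R.face^[k] (a, b)).1 (R.face^[k] (a, b)).2 +
      R.toVert (R.face^[k] (a, b)).1 (R.face^[k] (a, b)).2) ≤ 84 := by
  simp only [Finset.sum_range_succ, Finset.sum_range_zero, Function.iterate_succ_apply,
    Function.iterate_zero, id] at h6 ⊢
  have h1 := adj_nxt (R := R) h.1
  have h2 := adj_nxt (R := R) h1
  have h3 := adj_nxt (R := R) h2
  have h4 := adj_nxt (R := R) h3
  have h5 := adj_nxt (R := R) h4
  rw [R.face_of_adj h.1, R.face_of_adj h1, R.face_of_adj h2, R.face_of_adj h3,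
    R.face_of_adj h4] at h6 ⊢
  rw [R.face_of_adj h5, Prod.mk.injEq] at h6
  obtain ⟨e5, e6⟩ := h6
  rw [e5] at e6
  have := hR.six_le h rfl rfl rfl rfl e5 e6
  simp only [e5] at this ⊢
  linarith

variable (R) in
theorem face_mem_filter {P : V → V → Prop} [DecidablePred fun δ : V × V => P δ.1 δ.2]
    (hP : ∀ a b, H.Adj a b → P a b → P b (R.nxt b a)) :
    ∀ δ ∈ (darts H).filter (fun δ => P δ.1 δ.2),
      R.face δ ∈ (darts H).filter (fun δ => P δ.1 δ.2) := by
  rintro ⟨a, b⟩ h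
  rw [Finset.mem_filter, mem_darts] at h
  rw [Finset.mem_filter, mem_darts, R.face_of_adj h.1]
  exact ⟨adj_nxt h.1, hP a b h.1 h.2⟩

theorem six_next (h : H.Adj a b) :
    R.face^[6] (b, R.nxt b a) = (b, R.nxt b a) ↔ R.face^[6] (a, b) = (a, b) := by
  rw [← R.face_of_adj h, ← Function.iterate_succ_apply, Function.iterate_succ_apply']
  exact R.face_injective.eq_iff

theorem sum_six (hR : R.Sparse) :
    ∑ δ ∈ (darts H).filter (fun δ => R.Big δ.1 δ.2 ∧ R.face^[6] (δ.1, δ.2) = (δ.1, δ.2)),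
      (R.toTri δ.1 δ.2 + R.toVert δ.1 δ.2) ≤
    ∑ _δ ∈ (darts H).filter (fun δ => R.Big δ.1 δ.2 ∧ R.face^[6] (δ.1, δ.2) = (δ.1, δ.2)), 14 := by
  have hinv := face_mem_filter R
    (P := fun a b => R.Big a b ∧ R.face^[6] (a, b) = (a, b))
    (fun a b h hP => ⟨hP.1.next, (six_next h).2 hP.2⟩)
  set S := (darts H).filter (fun δ => R.Big δ.1 δ.2 ∧ R.face^[6] (δ.1, δ.2) = (δ.1, δ.2)) with hS
  have h1 : ∑ δ ∈ S, ∑ k ∈ Finset.range 6, (R.toTri (R.face^[k] δ).1 (R.face^[k] δ).2 +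
      R.toVert (R.face^[k] δ).1 (R.face^[k] δ).2) ≤ ∑ _δ ∈ S, 84 := by
    apply Finset.sum_le_sum
    rintro ⟨a, b⟩ h
    rw [hS, Finset.mem_filter] at h
    exact hR.sum_six_le h.2.1 h.2.2
  rw [Finset.sum_comm, Finset.sum_congr rfl (fun k _ => sum_iterate_of_invariant R.face_injective
    hinv (fun δ => R.toTri δ.1 δ.2 + R.toVert δ.1 δ.2) k)] at h1
  simp only [Finset.sum_const, Finset.card_range, nsmul_eq_mul] at h1 ⊢
  push_cast at h1
  linarith

theorem sum_not_six (hR : R.Sparse) :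
    ∑ δ ∈ (darts H).filter (fun δ => R.Big δ.1 δ.2 ∧ R.face^[6] (δ.1, δ.2) ≠ (δ.1, δ.2)),
      (R.toTri δ.1 δ.2 + (R.toVert δ.1 δ.2 - R.fromVert δ.1 δ.2)) ≤
    ∑ _δ ∈ (darts H).filter (fun δ => R.Big δ.1 δ.2 ∧ R.face^[6] (δ.1, δ.2) ≠ (δ.1, δ.2)), 18 := by
  have hinv := face_mem_filter R
    (P := fun a b => R.Big a b ∧ R.face^[6] (a, b) ≠ (a, b))
    (fun a b h hP => ⟨hP.1.next, fun h6 => hP.2 ((six_next h).1 h6)⟩)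
  set S := (darts H).filter (fun δ => R.Big δ.1 δ.2 ∧ R.face^[6] (δ.1, δ.2) ≠ (δ.1, δ.2)) with hS
  have h1 : ∑ δ ∈ S, (R.toVert δ.1 δ.2 - R.fromVert δ.1 δ.2) ≤
      ∑ δ ∈ S, (R.outShare δ.1 δ.2 + R.inShare (R.face δ).1 (R.face δ).2) := by
    apply Finset.sum_le_sum
    rintro ⟨a, b⟩ h
    rw [hS, Finset.mem_filter] at h
    rw [R.face_of_adj h.2.1.1]
    exact hR.corner_le h.2.1
  rw [Finset.sum_add_distrib, sum_comp_of_invariant R.face_injective hinv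
    (fun δ => R.inShare δ.1 δ.2)] at h1
  have h2 : ∑ δ ∈ S, (R.toTri δ.1 δ.2 + R.outShare δ.1 δ.2 + R.inShare δ.1 δ.2) ≤ ∑ _δ ∈ S, 18 := by
    apply Finset.sum_le_sum
    rintro ⟨a, b⟩ h
    rw [hS, Finset.mem_filter] at h
    exact hR.toTri_add_shares h.2.1
  rw [Finset.sum_add_distrib, Finset.sum_add_distrib] at h2
  rw [Finset.sum_add_distrib]
  linarith

theorem sum_darts_swap (f : V → V → ℚ) :
    ∑ δ ∈ darts H, f δ.2 δ.1 = ∑ δ ∈ darts H, f δ.1 δ.2 := by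
  refine Finset.sum_bij' (fun δ _ => δ.swap) (fun δ _ => δ.swap) ?_ ?_ ?_ ?_ ?_ <;>
    simp [mem_darts, SimpleGraph.adj_comm]

theorem sum_darts (f : V → V → ℚ) :
    ∑ δ ∈ darts H, f δ.1 δ.2 = ∑ b, ∑ a ∈ nbrs H b, f a b := by
  rw [← sum_darts_swap, Finset.sum_sigma']
  refine Finset.sum_bij' (fun δ _ => (⟨δ.1, δ.2⟩ : Σ _ : V, V)) (fun δ _ => (δ.1, δ.2)) ?_ ?_ ?_ ?_ ?_ <;>
    simp [mem_darts]

theorem sum_tri (hR : R.Sparse) :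
    ∑ _δ ∈ (darts H).filter (fun δ => R.Tri δ.1 δ.2), 14 ≤ ∑ δ ∈ darts H, R.toTri δ.1 δ.2 := by
  have hinv := face_mem_filter R (P := fun a b => R.Tri a b) (fun a b h hP => hP.next)
  set S := (darts H).filter (fun δ => R.Tri δ.1 δ.2) with hS
  have h1 : ∑ _δ ∈ S, (42 : ℚ) ≤ ∑ δ ∈ S, ∑ k ∈ Finset.range 3,
      R.toTri (R.face^[k] δ).2 (R.face^[k] δ).1 := by
    apply Finset.sum_le_sum
    rintro ⟨a, b⟩ h
    rw [hS, Finset.mem_filter] at h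
    have h1 := h.2.1
    have := hR.tri_receives h.2
    simp only [Finset.sum_range_succ, Finset.sum_range_zero, Function.iterate_succ_apply,
      Function.iterate_zero, id]
    rw [R.face_of_adj h1, R.face_of_adj (adj_nxt h1), h.2.2.1]
    linarith
  rw [Finset.sum_comm, Finset.sum_congr rfl (fun k _ => sum_iterate_of_invariant R.face_injective
    hinv (fun δ => R.toTri δ.2 δ.1) k)] at h1
  have h2 : ∑ δ ∈ S, R.toTri δ.2 δ.1 ≤ ∑ δ ∈ darts H, R.toTri δ.2 δ.1 :=
    Finset.sum_le_sum_of_subset_of_nonneg (Finset.filter_subset _ _) (fun _ _ _ => toTri_nonneg)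
  rw [sum_darts_swap R.toTri] at h2
  simp only [Finset.sum_const, Finset.card_range, nsmul_eq_mul] at h1 ⊢
  push_cast at h1
  linarith

/-- A sparse plane graph has average degree at most four. -/
theorem card_darts_le (hR : R.Sparse) (hE : R.Euler) : (darts H).card ≤ 4 * Fintype.card V := by
  have h1 : ∑ δ ∈ darts H, (
      (if R.Tri δ.1 δ.2 then -14 else 0) +
      (if R.Big δ.1 δ.2 ∧ R.face^[6] (δ.1, δ.2) = (δ.1, δ.2) then
        14 - (R.toTri δ.1 δ.2 + R.toVert δ.1 δ.2) else 0) +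
      (if R.Big δ.1 δ.2 ∧ R.face^[6] (δ.1, δ.2) ≠ (δ.1, δ.2) then
        18 - (R.toTri δ.1 δ.2 + (R.toVert δ.1 δ.2 - R.fromVert δ.1 δ.2)) else 0)) ≤
      ∑ δ ∈ darts H, (42 * (1 - 4 * orbWt R.face δ) -
        (R.toTri δ.1 δ.2 + (R.toVert δ.1 δ.2 - R.fromVert δ.1 δ.2))) := by
    apply Finset.sum_le_sum
    rintro ⟨a, b⟩ h
    rw [mem_darts] at h
    simp only at h ⊢
    by_cases hT : R.Tri a b
    · have hb : ¬ R.Big a b := fun h => h.2.1 hT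
      have := hR.charge_tri hT
      simp [hT, hb, toTri, toVert, fromVert, Gives]
      linarith
    · by_cases hb : R.Big a b
      · have h0 := fromVert_nonneg (R := R) (a := a) (b := b)
        by_cases h6 : R.face^[6] (a, b) = (a, b)
        · have := hR.charge_big hb
          simp only [hT, hb, h6, true_and, if_true, if_false, ne_eq, not_true]
          linarith
        · have := hR.charge_big' hb h6
          simp only [hT, hb, h6, true_and, if_true, if_false, ne_eq, not_false_iff]
          linarith
      · have := hR.charge_not_tri h hT
        simp [hT, hb, toTri, toVert, fromVert, Gives]
        linarith
  rw [Finset.sum_add_distrib, Finset.sum_add_distrib, ← Finset.sum_filter, ← Finset.sum_filter,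
    ← Finset.sum_filter, Finset.sum_sub_distrib, Finset.sum_sub_distrib, Finset.sum_sub_distrib,
    Finset.sum_add_distrib (s := darts H), sum_darts (fun a b => R.toVert a b - R.fromVert a b),
    ← Finset.mul_sum, Finset.sum_sub_distrib, ← Finset.mul_sum] at h1
  have h2 := hR.sum_tri
  have h3 := hR.sum_six
  have h4 := hR.sum_not_six
  have h5 : 0 ≤ ∑ b, (12 * ((nbrs H b).card - 4 : ℚ) +
      ∑ a ∈ nbrs H b, (R.toVert a b - R.fromVert a b)) :=
    Finset.sum_nonneg (fun b _ => hR.vertex_charge)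
  have h6 : ∑ b, ((nbrs H b).card : ℚ) = (darts H).card := by
    have := sum_darts (H := H) (fun _ _ => 1)
    simp only [Finset.sum_const, nsmul_eq_mul, mul_one] at this
    exact this.symm
  rw [Finset.sum_add_distrib, ← Finset.mul_sum, Finset.sum_sub_distrib, h6] at h5
  unfold Rot.Euler at hE
  simp only [Finset.sum_const, nsmul_eq_mul, Finset.card_univ] at h1 h2 h3 h4 h5
  have : ((darts H).card : ℚ) ≤ 4 * Fintype.card V := by linarith
  exact_mod_cast this

end Sparse
end Rot
end

section
open scoped Classical

/-! ### Bipartite plane graphs without short cycles -/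

/-- There is no cycle of length four. -/
def NoC4 {V : Type*} (G : SimpleGraph V) : Prop :=
  ∀ a b c d, G.Adj a b → G.Adj b c → G.Adj c d → G.Adj d a → a ≠ c → b ≠ d → False

theorem Rot.card_darts_le_of_bipartite {V : Type*} [Fintype V] {H : SimpleGraph V} {R : Rot H}
    (hE : R.Euler) (side : V → Prop) (hside : ∀ a b, H.Adj a b → (side a ↔ ¬ side b))
    (hdeg : ∀ u v, H.Adj u v → ∃ w, H.Adj u w ∧ w ≠ v) (h4 : NoC4 H) (h6 : NoC6 H) :
    3 * (darts H).card ≤ 8 * Fintype.card V := by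
  have hne : ∀ {a b}, H.Adj b a → R.nxt b a ≠ a := by
    intro a b hba h
    obtain ⟨w, hw, hwa⟩ := hdeg b a hba
    exact hwa (R.trans b a {a} hba rfl (by rintro x rfl -; exact h) w hw)
  have hω : ∀ δ ∈ darts H, orbWt R.face δ ≤ 1 / 8 := by
    rintro ⟨a, b⟩ hδ
    have h1 : H.Adj a b := mem_darts.1 hδ
    have := orbWt_le R.face_injective (x := (a, b)) (k := 8) (by norm_num) (by
      have h2 := Rot.adj_nxt (R := R) h1
      have h3 := Rot.adj_nxt (R := R) h2
      have h4' := Rot.adj_nxt (R := R) h3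
      have h5 := Rot.adj_nxt (R := R) h4'
      have h6' := Rot.adj_nxt (R := R) h5
      have n1 := hne h1.symm
      have n2 := hne h2.symm
      have n3 := hne h3.symm
      have n4 := hne h4'.symm
      have f1 := R.face_of_adj h1
      have f2 := R.face_of_adj h2
      have f3 := R.face_of_adj h3
      have f4 := R.face_of_adj h4'
      have f5 := R.face_of_adj h5
      have f6 := R.face_of_adj h6'
      have f7 := R.face_of_adj (Rot.adj_nxt (R := R) h6')
      have n5 := hne h5.symm
      generalize R.nxt b a = c at *
      generalize R.nxt c b = d at *
      generalize R.nxt d c = e at *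
      generalize R.nxt e d = f at *
      generalize R.nxt f e = g at *
      have h7 := Rot.adj_nxt (R := R) h6'
      have s1 := hside _ _ h1
      have e2 : side a ↔ side c := by rw [s1, hside _ _ h2, not_not]
      have s3 := hside _ _ h3
      rw [← e2] at s3
      have e4 : side a ↔ side e := by rw [s3, hside _ _ h4', not_not]
      have s5 := hside _ _ h5
      rw [← e4] at s5
      have e6 : side a ↔ side g := by rw [s5, hside _ _ h6', not_not]
      have s7 := hside _ _ h7
      rw [← e6] at s7
      have hss : ∀ {x y}, (side x ↔ ¬ side y) → x ≠ y := by
        rintro x _ h rfl; exact iff_not_self h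
      have o14 : b ≠ e := hss (by rw [← e4, s1, not_not])
      have o25 : c ≠ f := hss (by rw [← e2, s5])
      intro j hj hj'
      interval_cases j <;>
        simp only [Function.iterate_succ_apply, Function.iterate_zero, id, f1, f2, f3, f4, f5, f6,
          f7, ne_eq, Prod.mk.injEq, not_and]
      · intro h; exact absurd h.symm (hss s1)
      · intro h; exact absurd h n1
      · intro h; exact absurd h.symm (hss s3)
      · intro h h'
        rw [h] at h4'
        exact h4 _ _ _ _ h1 h2 h3 h4' n1.symm n2.symm
      · intro h; exact absurd h.symm (hss s5)
      · intro h h'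
        have n6 := hne h6'.symm
        rw [h'] at n6
        rw [h] at h6' n5
        exact h6 _ _ _ _ _ _ h1 h2 h3 h4' h5 h6' n1.symm n2.symm n3.symm n4.symm n5.symm
          n6.symm (hss s3) o14 o25
      · intro h; exact absurd h.symm (hss s7))
    simpa using this
  have hsum := Finset.sum_le_sum hω
  unfold Rot.Euler at hE
  simp only [Finset.sum_const, nsmul_eq_mul] at hsum
  have : (3 * (darts H).card : ℚ) ≤ 8 * Fintype.card V := by linarith
  exact_mod_cast this

/-- A strong form of Hall's condition for independent vertices of degree three in a plane graph. -/
theorem IsPlanar.card_lt_card_biUnion_nbrs {V : Type} [Fintype V] {G : SimpleGraph V}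
    (hpl : IsPlanar G) (h6 : NoC6 G) {X : Finset V} (hind : ∀ x ∈ X, ∀ x' ∈ X, ¬ G.Adj x x')
    (hdeg : ∀ x ∈ X, (nbrs G x).card = 3)
    (h4 : ∀ x ∈ X, ∀ x' ∈ X, x ≠ x' → ∀ u v, u ≠ v → G.Adj x u → G.Adj x v → G.Adj x' u →
      G.Adj x' v → False) {S : Finset V} (hSX : S ⊆ X) (hS : S.Nonempty) :
    S.card < (S.biUnion (nbrs G)).card := by
  induction hn : S.card using Nat.strong_induction_on generalizing S with
  | _ n ih =>
    subst hn
    by_contra! hcard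
    have hmem : ∀ u, u ∈ S.biUnion (nbrs G) ↔ ∃ x ∈ S, G.Adj x u := by simp
    have htwo : ∀ x ∈ S, ∀ u, G.Adj x u → ∃ x' ∈ S, x' ≠ x ∧ G.Adj x' u := by
      intro x hx u hxu
      by_contra! hcon
      have hsub : (S.erase x).biUnion (nbrs G) ⊆ (S.biUnion (nbrs G)).erase u := by
        intro v hv
        simp only [Finset.mem_biUnion, Finset.mem_erase, mem_nbrs] at hv ⊢
        obtain ⟨x', ⟨hx'x, hx'⟩, hv⟩ := hv
        refine ⟨?_, x', hx', hv⟩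
        rintro rfl
        exact hcon x' hx' hx'x hv
      have hc1 := Finset.card_le_card hsub
      rw [Finset.card_erase_of_mem ((hmem u).2 ⟨x, hx, hxu⟩)] at hc1
      have hc2 := Finset.card_erase_add_one hx
      have hne : (S.erase x).Nonempty := by
        rw [← Finset.card_pos]
        have h3 : (nbrs G x).card ≤ (S.biUnion (nbrs G)).card :=
          Finset.card_le_card (Finset.subset_biUnion_of_mem (nbrs G) hx)
        have := hdeg x (hSX hx)
        omega
      have := ih _ (by omega) ((Finset.erase_subset _ _).trans hSX) hne rfl
      omega
    set N := S.biUnion (nbrs G) with hN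
    let B : SimpleGraph {v // v ∈ S ∪ N} :=
      { Adj := fun a b => G.Adj a b ∧ (a.1 ∈ S ∨ b.1 ∈ S)
        symm := ⟨fun a b h => ⟨h.1.symm, h.2.symm⟩⟩
        loopless := ⟨fun a h => G.loopless.irrefl _ h.1⟩ }
    have hBpl : IsPlanar B := hpl.of_hom Subtype.val_injective (fun a b h => h.1)
    obtain ⟨R, hR⟩ := hBpl.exists_euler
    have hindS : ∀ x ∈ S, ∀ x' ∈ S, ¬ G.Adj x x' := fun x hx x' hx' => hind x (hSX hx) x' (hSX hx')
    have hside : ∀ a b, B.Adj a b → ((a.1 ∈ S) ↔ ¬ b.1 ∈ S) := by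
      rintro a b ⟨hab, h⟩
      have := hindS a.1
      constructor
      · intro ha hb; exact this ha _ hb hab
      · exact fun hb => h.resolve_right hb
    have hmain := Rot.card_darts_le_of_bipartite hR (fun v => v.1 ∈ S) hside ?_ ?_ ?_
    · have hd : 2 * (3 * S.card) ≤ (darts B).card := by
        have hs : (S.sigma fun x => nbrs G x).card = 3 * S.card := by
          rw [Finset.card_sigma, Finset.sum_congr rfl (fun x hx => hdeg x (hSX hx)),
            Finset.sum_const, smul_eq_mul, mul_comm]
        have c1 := Finset.card_le_card_of_surjOn
          (s := (darts B).filter fun δ => δ.1.1 ∈ S) (t := S.sigma fun x => nbrs G x)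
          (fun δ => (⟨δ.1.1, δ.2.1⟩ : Σ _ : V, V)) (by
            rintro ⟨x, u⟩ h
            simp only [Finset.coe_sigma, Set.mem_sigma_iff, Finset.mem_coe, mem_nbrs] at h
            exact ⟨(⟨x, Finset.mem_union_left _ h.1⟩,
              ⟨u, Finset.mem_union_right _ ((hmem u).2 ⟨x, h⟩)⟩),
              by simpa [mem_darts, h.1, B] using h.2, rfl⟩)
        have c2 := Finset.card_le_card_of_surjOn
          (s := (darts B).filter fun δ => ¬ δ.1.1 ∈ S) (t := S.sigma fun x => nbrs G x)
          (fun δ => (⟨δ.2.1, δ.1.1⟩ : Σ _ : V, V)) (by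
            rintro ⟨x, u⟩ h
            simp only [Finset.coe_sigma, Set.mem_sigma_iff, Finset.mem_coe, mem_nbrs] at h
            have hu : u ∉ S := fun hu => hindS x h.1 u hu h.2
            exact ⟨(⟨u, Finset.mem_union_right _ ((hmem u).2 ⟨x, h⟩)⟩,
              ⟨x, Finset.mem_union_left _ h.1⟩),
              by simpa [mem_darts, h.1, hu, B] using h.2.symm, rfl⟩)
        have := Finset.card_filter_add_card_filter_not (s := darts B) (fun δ => δ.1.1 ∈ S)
        omega
      have hc : Fintype.card {v // v ∈ S ∪ N} ≤ S.card + N.card := by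
        rw [Fintype.card_coe]
        exact Finset.card_union_le _ _
      have := hS.card_pos
      omega
    · rintro ⟨u, hu⟩ ⟨v, hv⟩ ⟨huv, h | h⟩
      · have h3 := hdeg u (hSX h)
        have : ∃ w ∈ nbrs G u, w ≠ v := by
          apply Finset.exists_mem_ne
          omega
        obtain ⟨w, hw, hwv⟩ := this
        rw [mem_nbrs] at hw
        refine ⟨⟨w, Finset.mem_union_right _ ((hmem w).2 ⟨u, h, hw⟩)⟩, ⟨hw, Or.inl h⟩, ?_⟩
        simpa using hwv
      · obtain ⟨x', hx', hne, hadj⟩ := htwo v h u huv.symm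
        refine ⟨⟨x', Finset.mem_union_left _ hx'⟩, ⟨hadj.symm, Or.inr hx'⟩, ?_⟩
        simpa using hne
    · rintro a b c d hab hbc hcd hda hac hbd
      have hac' : a.1 ≠ c.1 := fun h => hac (Subtype.ext h)
      have hbd' : b.1 ≠ d.1 := fun h => hbd (Subtype.ext h)
      have s1 := hside _ _ hab
      have s2 := hside _ _ hbc
      have s3 := hside _ _ hcd
      by_cases ha : a.1 ∈ S
      · exact h4 _ (hSX ha) _ (hSX (by_contra fun h => s1.1 ha (s2.2 h))) hac' _ _ hbd' hab.1 hda.1.symm hbc.1.symm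
          hcd.1
      · have hb : b.1 ∈ S := by_contra fun h => ha (s1.2 h)
        exact h4 _ (hSX hb) _ (hSX (by_contra fun h => s2.1 hb (s3.2 h))) hbd' _ _ hac'
          hab.1.symm hbc.1 hda.1 hcd.1.symm
    · rintro a b c d e f h1 h2 h3 h4 h5 h6' n1 n2 n3 n4 n5 n6 n7 n8 n9
      exact h6 _ _ _ _ _ _ h1.1 h2.1 h3.1 h4.1 h5.1 h6'.1 (Subtype.coe_ne_coe.2 n1)
        (Subtype.coe_ne_coe.2 n2) (Subtype.coe_ne_coe.2 n3) (Subtype.coe_ne_coe.2 n4)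
        (Subtype.coe_ne_coe.2 n5) (Subtype.coe_ne_coe.2 n6) (Subtype.coe_ne_coe.2 n7)
        (Subtype.coe_ne_coe.2 n8) (Subtype.coe_ne_coe.2 n9)

end

section
open scoped Classical

/-! ### Trimming hyperedges -/

/-- Every nonempty subfamily of `A` indexed in `X` covers more points than it has members. -/
def StrongHall {ι V : Type*} (X : Finset ι) (A : ι → Finset V) : Prop :=
  ∀ S ⊆ X, S.Nonempty → S.card < (S.biUnion A).card

theorem StrongHall.trim_one {ι V : Type*} {X : Finset ι} {A : ι → Finset V} (h : StrongHall X A)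
    {x : ι} {y z w : V} (hA : A x = {y, z, w}) :
    StrongHall X (Function.update A x {y, z}) ∨ StrongHall X (Function.update A x {y, w}) := by
  by_contra! hcon
  obtain ⟨h1, h2⟩ := hcon
  unfold StrongHall at h1 h2
  push Not at h1 h2
  obtain ⟨S1, hS1, hne1, hc1⟩ := h1
  obtain ⟨S2, hS2, hne2, hc2⟩ := h2
  have hx : ∀ (S : Finset ι) (B : Finset V), S ⊆ X → S.Nonempty →
      (S.biUnion (Function.update A x B)).card ≤ S.card → x ∈ S := by
    intro S B hS hne hc
    by_contra hxS
    have : S.biUnion (Function.update A x B) = S.biUnion A := by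
      apply Finset.biUnion_congr rfl
      intro a ha
      rw [Function.update_of_ne]
      rintro rfl
      exact hxS ha
    rw [this] at hc
    exact absurd (h S hS hne) (by omega)
  have hx1 := hx S1 _ hS1 hne1 hc1
  have hx2 := hx S2 _ hS2 hne2 hc2
  set U1 := S1.biUnion (Function.update A x {y, z}) with hU1
  set U2 := S2.biUnion (Function.update A x {y, w}) with hU2
  have mem1 : ∀ {a v}, a ∈ S1 → a ≠ x → v ∈ A a → v ∈ U1 := by
    intro a v ha hax hv
    rw [hU1, Finset.mem_biUnion]
    exact ⟨a, ha, by rwa [Function.update_of_ne hax]⟩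
  have mem2 : ∀ {a v}, a ∈ S2 → a ≠ x → v ∈ A a → v ∈ U2 := by
    intro a v ha hax hv
    rw [hU2, Finset.mem_biUnion]
    exact ⟨a, ha, by rwa [Function.update_of_ne hax]⟩
  have memx1 : ∀ {v}, v = y ∨ v = z → v ∈ U1 := by
    intro v hv
    rw [hU1, Finset.mem_biUnion]
    exact ⟨x, hx1, by simpa using hv⟩
  have memx2 : ∀ {v}, v = y ∨ v = w → v ∈ U2 := by
    intro v hv
    rw [hU2, Finset.mem_biUnion]
    exact ⟨x, hx2, by simpa using hv⟩
  have hun : (S1 ∪ S2).biUnion A ⊆ U1 ∪ U2 := by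
    intro v hv
    obtain ⟨a, ha, hva⟩ := Finset.mem_biUnion.1 hv
    rw [Finset.mem_union] at ha ⊢
    by_cases hax : a = x
    · rw [hax, hA] at hva
      simp only [Finset.mem_insert, Finset.mem_singleton] at hva
      rcases hva with h | h | h
      · exact Or.inl (memx1 (Or.inl h))
      · exact Or.inl (memx1 (Or.inr h))
      · exact Or.inr (memx2 (Or.inr h))
    · exact ha.imp (fun h => mem1 h hax hva) (fun h => mem2 h hax hva)
  have hint : (S1 ∩ S2).card ≤ (U1 ∩ U2).card := by
    have hxi : x ∈ S1 ∩ S2 := Finset.mem_inter.2 ⟨hx1, hx2⟩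
    have hc := Finset.card_erase_add_one hxi
    rcases Finset.eq_empty_or_nonempty ((S1 ∩ S2).erase x) with he | hne
    · have : y ∈ U1 ∩ U2 := Finset.mem_inter.2 ⟨memx1 (Or.inl rfl), memx2 (Or.inl rfl)⟩
      have := Finset.card_pos.2 ⟨y, this⟩
      rw [he, Finset.card_empty] at hc
      omega
    · have hs : ((S1 ∩ S2).erase x).biUnion A ⊆ U1 ∩ U2 := by
        intro v hv
        obtain ⟨a, ha, hva⟩ := Finset.mem_biUnion.1 hv
        rw [Finset.mem_erase, Finset.mem_inter] at ha
        exact Finset.mem_inter.2 ⟨mem1 ha.2.1 ha.1 hva, mem2 ha.2.2 ha.1 hva⟩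
      have h3 := Finset.card_le_card hs
      have h4 := h _ (((Finset.erase_subset _ _).trans Finset.inter_subset_left).trans hS1) hne
      omega
  have h3 := Finset.card_le_card hun
  have h4 := h (S1 ∪ S2) (Finset.union_subset hS1 hS2) (hne1.mono Finset.subset_union_left)
  have h5 := Finset.card_union_add_card_inter S1 S2
  have h6 := Finset.card_union_add_card_inter U1 U2
  omega

/-- The triples `{y x, z x, w x}` can be trimmed to pairs containing `y x`. -/
theorem StrongHall.trim {ι V : Type*} {X : Finset ι} {y z w : ι → V}
    (h : StrongHall X (fun x => {y x, z x, w x})) :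
    ∃ m : ι → V, (∀ x, m x = z x ∨ m x = w x) ∧ StrongHall X (fun x => {y x, m x}) := by
  have key : ∀ P ⊆ X, ∃ m : ι → V, (∀ x, m x = z x ∨ m x = w x) ∧
      StrongHall X (fun x => if x ∈ P then {y x, m x} else {y x, z x, w x}) := by
    intro P
    induction P using Finset.induction_on with
    | empty => intro _; exact ⟨z, fun x => Or.inl rfl, by simpa using h⟩
    | insert x P hxP ih =>
      intro hP
      obtain ⟨m, hm, hH⟩ := ih ((Finset.subset_insert _ _).trans hP)
      have hup : ∀ v, Function.update (fun x => if x ∈ P then ({y x, m x} : Finset V)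
          else {y x, z x, w x}) x {y x, v} = fun a => if a ∈ insert x P then
            {y a, Function.update m x v a} else {y a, z a, w a} := by
        intro v
        funext a
        by_cases hax : a = x
        · subst hax; simp
        · simp [hax]
      rcases hH.trim_one (x := x) (y := y x) (z := z x) (w := w x) (by simp [hxP]) with h1 | h1
      · refine ⟨Function.update m x (z x), fun a => ?_, by rwa [hup] at h1⟩
        by_cases hax : a = x
        · subst hax; simp
        · simpa [hax] using hm a
      · refine ⟨Function.update m x (w x), fun a => ?_, by rwa [hup] at h1⟩
        by_cases hax : a = x
        · subst hax; simp
        · simpa [hax] using hm a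
  obtain ⟨m, hm, hH⟩ := key X subset_rfl
  refine ⟨m, hm, fun S hS hne => ?_⟩
  have := hH S hS hne
  rwa [Finset.biUnion_congr (t₂ := fun x => {y x, m x}) rfl (fun a ha => by simp [hS ha])] at this

end

section
open scoped Classical

/-! ### Critical list assignments -/

/-- The common color of two lists that share exactly one color. -/
def common {V : Type*} (L : V → Finset ℕ) (u v : V) : ℕ := (L u ∩ L v).sup id

theorem common_comm {V : Type*} (L : V → Finset ℕ) (u v : V) : common L u v = common L v u := by
  rw [common, Finset.inter_comm, common]

/-- `G` is not colorable from the lists `L`, but it becomes so on the removal of any nonempty set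
of vertices; lists have size three and adjacent lists have exactly one common color. -/
structure Critical {V : Type} (G : SimpleGraph V) (L : V → Finset ℕ) : Prop where
  card : ∀ v, (L v).card = 3
  edge : ∀ u v, G.Adj u v → (L u ∩ L v).card = 1
  not_col : ¬ ColorableWith G L
  crit : ∀ T : Finset V, T.Nonempty → ∃ φ : V → ℕ, (∀ v, φ v ∈ L v) ∧
    ∀ u v, u ∉ T → v ∉ T → G.Adj u v → φ u ≠ φ v

namespace Critical
variable {V : Type} {G : SimpleGraph V} {L : V → Finset ℕ} {u v x y z : V}

theorem eq_common (hC : Critical G L) (h : G.Adj u v) {c : ℕ} (hu : c ∈ L u) (hv : c ∈ L v) :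
    c = common L u v := by
  obtain ⟨d, hd⟩ := Finset.card_eq_one.1 (hC.edge u v h)
  have : c ∈ L u ∩ L v := Finset.mem_inter.2 ⟨hu, hv⟩
  rw [hd, Finset.mem_singleton] at this
  simp [common, hd, this]

theorem common_mem (hC : Critical G L) (h : G.Adj u v) :
    common L u v ∈ L u ∧ common L u v ∈ L v := by
  obtain ⟨d, hd⟩ := Finset.card_eq_one.1 (hC.edge u v h)
  have hd' : d ∈ L u ∩ L v := by simp [hd]
  have : common L u v = d := by simp [common, hd]
  rw [this]
  exact Finset.mem_inter.1 hd'

variable [Fintype V]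

/-- Every color of `u` is common with some neighbor. -/
theorem exists_common_eq (hC : Critical G L) {a : ℕ} (ha : a ∈ L u) :
    ∃ v, G.Adj u v ∧ common L u v = a := by
  by_contra! hcon
  obtain ⟨φ, hφ, hp⟩ := hC.crit {u} ⟨u, by simp⟩
  apply hC.not_col
  have hno : ∀ v, G.Adj u v → a ≠ φ v := fun v huv h =>
    hcon v huv (hC.eq_common huv ha (h ▸ hφ v)).symm
  refine ⟨Function.update φ u a, fun v => ?_, fun v w hvw => ?_⟩
  · by_cases hv : v = u
    · subst hv; simpa using ha
    · simpa [hv] using hφ v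
  · by_cases hv : v = u
    · subst hv
      rw [Function.update_self, Function.update_of_ne hvw.ne.symm]
      exact hno w hvw
    · by_cases hw : w = u
      · subst hw
        rw [Function.update_self, Function.update_of_ne hvw.ne]
        exact (hno v hvw.symm).symm
      · rw [Function.update_of_ne hv, Function.update_of_ne hw]
        exact hp v w (by simpa using hv) (by simpa using hw) hvw

theorem subset_image (hC : Critical G L) (u : V) : L u ⊆ (nbrs G u).image (common L u) := by
  intro a ha
  obtain ⟨v, hv, rfl⟩ := hC.exists_common_eq ha
  exact Finset.mem_image_of_mem _ (mem_nbrs.2 hv)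

theorem common_injOn (hC : Critical G L) (hd : (nbrs G x).card = 3) (hu : G.Adj x u)
    (hv : G.Adj x v) (h : common L x u = common L x v) : u = v := by
  have h1 := Finset.card_le_card (hC.subset_image x)
  rw [hC.card] at h1
  have h2 : ((nbrs G x).image (common L x)).card = (nbrs G x).card :=
    le_antisymm Finset.card_image_le (by omega)
  exact Finset.card_image_iff.1 h2 (mem_nbrs.2 hu) (mem_nbrs.2 hv) h

/-- A vertex of degree three can be given the common color with `u` unless `u` has it. -/
theorem ne_of_common (hC : Critical G L) (hd : (nbrs G x).card = 3) (hu : G.Adj x u)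
    (hv : G.Adj x v) {c : ℕ} (hc : c ∈ L v) (hne : v = u → c ≠ common L x u) :
    common L x u ≠ c := by
  rintro rfl
  exact hne (hC.common_injOn hd hv hu (hC.eq_common hv (hC.common_mem hu).1 hc).symm) rfl

theorem common_ne (hC : Critical G L) (hd : (nbrs G x).card = 3) (hu : G.Adj x u)
    (hv : G.Adj x v) (huv : G.Adj u v) : common L u v ≠ common L x u := by
  intro h
  have h1 := (hC.common_mem huv).2
  rw [h] at h1
  exact hC.ne_of_common hd hu hv h1 (fun h => absurd h huv.ne.symm) rfl

/-- Two adjacent vertices of degree three have no common neighbor. -/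
theorem no_triangle (hC : Critical G L) (hx : (nbrs G x).card = 3) (hz : (nbrs G z).card = 3)
    (hxz : G.Adj x z) (hxy : G.Adj x y) (hzy : G.Adj z y) : False := by
  obtain ⟨φ, hφ, hp⟩ := hC.crit {x, z} ⟨x, by simp⟩
  have key : ∀ a c, a ∈ L x → c ∈ L z → a ≠ c → (∀ v, v ≠ z → G.Adj x v → a ≠ φ v) →
      (∀ v, v ≠ x → G.Adj z v → c ≠ φ v) → False := by
    intro a c ha hc hac hxv hzv
    apply hC.not_col
    set ψ := Function.update (Function.update φ x a) z c with hψ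
    have ψx : ψ x = a := by simp [hψ, hxz.ne]
    have ψz : ψ z = c := by simp [hψ]
    have ψo : ∀ v, v ≠ x → v ≠ z → ψ v = φ v := fun v h1 h2 => by simp [hψ, h1, h2]
    refine ⟨ψ, fun v => ?_, ?_⟩
    · by_cases h1 : v = x
      · rw [h1, ψx]; exact ha
      · by_cases h2 : v = z
        · rw [h2, ψz]; exact hc
        · rw [ψo v h1 h2]; exact hφ v
    · have sx : ∀ v, G.Adj x v → ψ x ≠ ψ v := by
        intro v hv
        by_cases h2 : v = z
        · rw [h2, ψx, ψz]; exact hac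
        · rw [ψx, ψo v hv.ne.symm h2]; exact hxv v h2 hv
      have sz : ∀ v, G.Adj z v → ψ z ≠ ψ v := by
        intro v hv
        by_cases h2 : v = x
        · rw [h2, ψx, ψz]; exact hac.symm
        · rw [ψz, ψo v h2 hv.ne.symm]; exact hzv v h2 hv
      intro v w hvw
      by_cases h1 : v = x
      · subst h1; exact sx w hvw
      by_cases h2 : v = z
      · subst h2; exact sz w hvw
      by_cases h3 : w = x
      · subst h3; exact (sx v hvw.symm).symm
      by_cases h4 : w = z
      · subst h4; exact (sz v hvw.symm).symm
      rw [ψo v h1 h2, ψo w h3 h4]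
      exact hp v w (by simp [h1, h2]) (by simp [h3, h4]) hvw
  have hde : common L x y ≠ common L x z := fun h => hzy.ne.symm (hC.common_injOn hx hxy hxz h)
  have hfe : common L z y ≠ common L z x := fun h => hxy.ne.symm (hC.common_injOn hz hzy hxz.symm h)
  have hxe := hC.common_mem hxz
  rw [common_comm L z x] at hfe
  by_cases hy : φ y = common L x y
  · refine key _ (common L z y) hxe.1 (hC.common_mem hzy).1 hfe.symm ?_ ?_
    · intro v hvz hv
      exact hC.ne_of_common hx hxz hv (hφ v) (fun h => absurd h hvz)
    · intro v hvx hv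
      refine hC.ne_of_common hz hzy hv (hφ v) ?_
      rintro rfl h
      rw [hy] at h
      refine hC.common_ne hx hxy hxz hzy.symm ?_
      rw [common_comm, h]
  · refine key (common L x y) _ (hC.common_mem hxy).1 hxe.2 hde ?_ ?_
    · intro v hvz hv
      refine hC.ne_of_common hx hxy hv (hφ v) ?_
      rintro rfl; exact hy
    · intro v hvx hv
      rw [common_comm]
      exact hC.ne_of_common hz hxz.symm hv (hφ v) (fun h => absurd h hvx)

end Critical

/-- The vertices of degree three whose neighborhood contains a path. -/
noncomputable def fans {V : Type*} [Fintype V] (G : SimpleGraph V) : Finset V :=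
  Finset.univ.filter fun x => (nbrs G x).card = 3 ∧ ∃ y z w, y ≠ z ∧ y ≠ w ∧ z ≠ w ∧
    G.Adj x y ∧ G.Adj x z ∧ G.Adj x w ∧ G.Adj y z ∧ G.Adj y w

section
variable {V : Type} [Fintype V] {G : SimpleGraph V} {L : V → Finset ℕ} {x x' : V}

theorem mem_fans : x ∈ fans G ↔ (nbrs G x).card = 3 ∧ ∃ y z w, y ≠ z ∧ y ≠ w ∧ z ≠ w ∧
    G.Adj x y ∧ G.Adj x z ∧ G.Adj x w ∧ G.Adj y z ∧ G.Adj y w := by simp [fans]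

theorem nbrs_eq_of_card {y z w : V} (hd : (nbrs G x).card = 3) (hy : G.Adj x y) (hz : G.Adj x z)
    (hw : G.Adj x w) (hyz : y ≠ z) (hyw : y ≠ w) (hzw : z ≠ w) : nbrs G x = {y, z, w} := by
  symm
  apply Finset.eq_of_subset_of_card_le
  · intro v
    simp only [Finset.mem_insert, Finset.mem_singleton, mem_nbrs]
    rintro (rfl | rfl | rfl) <;> assumption
  · rw [hd, Finset.card_eq_three.2 ⟨y, z, w, hyz, hyw, hzw, rfl⟩]

/-- In the neighborhood of a fan vertex, every vertex has a neighbor. -/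
theorem exists_adj_of_mem_fans (hx : x ∈ fans G) {v : V} (hv : G.Adj x v) :
    ∃ v', G.Adj x v' ∧ G.Adj v v' := by
  obtain ⟨hd, y, z, w, hyz, hyw, hzw, hy, hz, hw, ayz, ayw⟩ := mem_fans.1 hx
  have := nbrs_eq_of_card hd hy hz hw hyz hyw hzw
  have hv' := mem_nbrs.2 hv
  rw [this] at hv'
  simp only [Finset.mem_insert, Finset.mem_singleton] at hv'
  rcases hv' with rfl | rfl | rfl
  · exact ⟨z, hz, ayz⟩
  · exact ⟨y, hy, ayz.symm⟩
  · exact ⟨y, hy, ayw.symm⟩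

theorem Critical.fans_indep (hC : Critical G L) (hx : x ∈ fans G) (hx' : x' ∈ fans G) :
    ¬ G.Adj x x' := by
  intro h
  obtain ⟨y, hy, hy'⟩ := exists_adj_of_mem_fans hx h
  exact hC.no_triangle (mem_fans.1 hx).1 (mem_fans.1 hx').1 h hy hy'

theorem Critical.fans_share (hC : Critical G L) (h5 : NoC5 G) (hx : x ∈ fans G)
    (hx' : x' ∈ fans G) (hne : x ≠ x') {p q : V} (hpq : p ≠ q) (hp : G.Adj x p) (hq : G.Adj x q)
    (hp' : G.Adj x' p) (hq' : G.Adj x' q) : False := by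
  have hd := (mem_fans.1 hx).1
  obtain ⟨r, hr, hrp, hrq⟩ : ∃ r, G.Adj x r ∧ r ≠ p ∧ r ≠ q := by
    by_contra! hcon
    have : nbrs G x ⊆ {p, q} := by
      intro r hr
      rw [mem_nbrs] at hr
      simp only [Finset.mem_insert, Finset.mem_singleton]
      by_cases h : r = p
      · exact Or.inl h
      · exact Or.inr (hcon r hr h)
    have := (Finset.card_le_card this).trans Finset.card_le_two
    omega
  have hrx : r ≠ x' := by
    rintro rfl
    exact hC.fans_indep hx hx' hr
  obtain ⟨v, hv, hrv⟩ := exists_adj_of_mem_fans hx hr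
  have hv' := mem_nbrs.2 hv
  rw [nbrs_eq_of_card hd hr hp hq hrp hrq hpq] at hv'
  simp only [Finset.mem_insert, Finset.mem_singleton] at hv'
  rcases hv' with rfl | rfl | rfl
  · exact hrv.ne rfl
  · exact h5 r x q x' v hr.symm hq hq'.symm hp' hrv.symm hrq hrx hne hp.ne hpq.symm
  · exact h5 r x p x' v hr.symm hp hp'.symm hq' hrv.symm hrp hrx hne hq.ne hpq

end
end

section
open scoped Classical

/-! ### Orientations with bounded outdegree -/

/-- The edges of `G` with an end in `T`. -/
noncomputable def touch {V : Type*} [Fintype V] (G : SimpleGraph V) (T : Finset V) :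
    Finset (Sym2 V) :=
  G.edgeFinset.filter fun e => ∃ v ∈ T, v ∈ e

theorem mem_touch {V : Type*} [Fintype V] {G : SimpleGraph V} {T : Finset V} {p q : V} :
    s(p, q) ∈ touch G T ↔ G.Adj p q ∧ (p ∈ T ∨ q ∈ T) := by
  simp only [touch, Finset.mem_filter, SimpleGraph.mem_edgeFinset, SimpleGraph.mem_edgeSet,
    Sym2.mem_iff]
  refine and_congr_right fun _ => ⟨?_, ?_⟩
  · rintro ⟨v, hv, rfl | rfl⟩
    · exact Or.inl hv
    · exact Or.inr hv
  · rintro (h | h)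
    · exact ⟨p, h, Or.inl rfl⟩
    · exact ⟨q, h, Or.inr rfl⟩

/-- If `T` is touched by at most `2 |T|` edges and is minimal with this property, then these edges
can be oriented with all tails in `T` and outdegrees at most two. -/
theorem exists_orientation {V : Type*} [Fintype V] {G : SimpleGraph V} {T : Finset V}
    (hT : (touch G T).card ≤ 2 * T.card)
    (hmin : ∀ T' ⊂ T, T'.Nonempty → 2 * T'.card < (touch G T').card) :
    ∃ O : V → V → Prop, (∀ p q, O p q → p ∈ T ∧ G.Adj p q) ∧
      (∀ p q, G.Adj p q → p ∈ T → O p q ∨ O q p) ∧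
      ∀ p, (Finset.univ.filter (O p)).card ≤ 2 := by
  have hall : ∀ F : Finset {e // e ∈ touch G T}, F.card ≤
      (F.biUnion fun e => (T.filter (· ∈ e.1)) ×ˢ (Finset.univ : Finset Bool)).card := by
    intro F
    by_contra! hF
    set W := T.filter fun v => ∃ e ∈ F, v ∈ e.1 with hW
    have h1 : (F.biUnion fun e => (T.filter (· ∈ e.1)) ×ˢ (Finset.univ : Finset Bool)) =
        W ×ˢ (Finset.univ : Finset Bool) := by
      ext ⟨v, b⟩
      simp only [Finset.mem_biUnion, Finset.mem_product, Finset.mem_filter, hW, Finset.mem_univ,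
        and_true]
      tauto
    rw [h1, Finset.card_product, Finset.card_univ, Fintype.card_bool] at hF
    have hWT : W ⊆ T := Finset.filter_subset _ _
    have h2 : touch G (T \ W) ⊆ touch G T \ F.map ⟨Subtype.val, Subtype.val_injective⟩ := by
      intro e he
      obtain ⟨he, v, hv, hve⟩ := Finset.mem_filter.1 he
      rw [Finset.mem_sdiff] at hv
      refine Finset.mem_sdiff.2 ⟨Finset.mem_filter.2 ⟨he, v, hv.1, hve⟩, fun hmem => hv.2 ?_⟩
      obtain ⟨e', he', rfl⟩ := Finset.mem_map.1 hmem
      exact Finset.mem_filter.2 ⟨hv.1, e', he', hve⟩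
    have h3 : F.map ⟨Subtype.val, Subtype.val_injective⟩ ⊆ touch G T := by
      intro e he
      obtain ⟨e', -, rfl⟩ := Finset.mem_map.1 he
      exact e'.2
    have h4 := Finset.card_le_card h2
    have h5 := Finset.card_le_card h3
    rw [Finset.card_sdiff_of_subset h3] at h4
    rw [Finset.card_map] at h4 h5
    have h6 := Finset.card_sdiff_of_subset hWT
    have h7 := Finset.card_le_card hWT
    obtain ⟨e, he⟩ : F.Nonempty := Finset.card_pos.1 (by omega)
    obtain ⟨-, v, hv, hve⟩ := Finset.mem_filter.1 e.2
    have hvW : v ∈ W := Finset.mem_filter.2 ⟨hv, e, he, hve⟩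
    have h8 := hmin (T \ W) (Finset.ssubset_iff_subset_ne.2 ⟨Finset.sdiff_subset, fun h => by
      rw [← h] at hv; exact (Finset.mem_sdiff.1 hv).2 hvW⟩) (Finset.card_pos.1 (by omega))
    omega
  obtain ⟨g, hg, hgt⟩ := (Finset.all_card_le_biUnion_card_iff_exists_injective _).1 hall
  simp only [Finset.mem_product, Finset.mem_filter, Finset.mem_univ, and_true] at hgt
  obtain ⟨O, hO⟩ : ∃ O : V → V → Prop, ∀ p q, O p q ↔ ∃ e, e.1 = s(p, q) ∧ (g e).1 = p :=
    ⟨_, fun _ _ => Iff.rfl⟩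
  refine ⟨O, fun p q hpq => ?_, fun p q hpq hp => ?_, fun p => ?_⟩
  · obtain ⟨e, he, rfl⟩ := (hO p q).1 hpq
    have h := e.2
    rw [he, mem_touch] at h
    exact ⟨(hgt e).1, h.1⟩
  · rw [hO, hO]
    have h := hgt ⟨s(p, q), mem_touch.2 ⟨hpq, Or.inl hp⟩⟩
    rcases Sym2.mem_iff.1 h.2 with h | h
    · exact Or.inl ⟨_, rfl, h⟩
    · exact Or.inr ⟨_, Sym2.eq_swap, h⟩
  · have : ∀ q ∈ Finset.univ.filter (O p), ∃ e, e.1 = s(p, q) ∧ (g e).1 = p :=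
      fun q hq => (hO p q).1 (Finset.mem_filter.1 hq).2
    choose e he using this
    have := Finset.card_le_card_of_injOn (s := (Finset.univ.filter (O p)).attach)
      (t := (Finset.univ : Finset Bool)) (fun q => (g (e q.1 q.2)).2) (fun _ _ => by simp) ?_
    · simpa using this
    · intro q _ q' _ h
      have h1 : e q.1 q.2 = e q'.1 q'.2 :=
        hg (Prod.ext ((he q.1 q.2).2.trans (he q'.1 q'.2).2.symm) h)
      have h2 := (he q.1 q.2).1
      rw [h1, (he q'.1 q'.2).1] at h2
      exact Subtype.ext (Sym2.congr_right.1 h2).symm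

/-- Choose colors one at a time, along a dependency relation `D` that is acyclic on `T`, avoiding
at most two colors each time. -/
theorem exists_choice {V : Type*} [Fintype V] {L : V → Finset ℕ} (hL : ∀ v, (L v).card = 3)
    {T : Finset V} {O D : V → V → Prop} {F : V → V → ℕ → ℕ} (hirr : ∀ p, ¬ O p p)
    (hO : ∀ p, (Finset.univ.filter (O p)).card ≤ 2)
    (hF : ∀ p q, ¬ D p q → ∀ a b, F p q a = F p q b)
    (hac : ∀ W ⊆ T, W.Nonempty → ∃ p ∈ W, ∀ p' ∈ W, ¬ D p' p)
    {φ : V → ℕ} (hφ : ∀ v, φ v ∈ L v) :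
    ∃ ψ : V → ℕ, (∀ v, ψ v ∈ L v) ∧ (∀ v, v ∉ T → ψ v = φ v) ∧
      ∀ p ∈ T, ∀ q, O p q → ψ p ≠ F p q (ψ q) := by
  have key : ∀ n, ∀ W ⊆ T, W.card = n → ∃ ψ : V → ℕ, (∀ v, ψ v ∈ L v) ∧
      (∀ v, v ∉ W → ψ v = φ v) ∧ ∀ p ∈ W, ∀ q, O p q → ψ p ≠ F p q (ψ q) := by
    intro n
    induction n with
    | zero =>
      intro W _ hW
      rw [Finset.card_eq_zero] at hW
      subst hW
      exact ⟨φ, hφ, fun _ _ => rfl, by simp⟩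
    | succ n ih =>
      intro W hWT hW
      obtain ⟨p, hp, hpD⟩ := hac W hWT (Finset.card_pos.1 (by omega))
      obtain ⟨ψ, h1, h2, h3⟩ := ih (W.erase p) ((Finset.erase_subset _ _).trans hWT)
        (by rw [Finset.card_erase_of_mem hp, hW]; rfl)
      obtain ⟨c, hc, hcF⟩ : ∃ c ∈ L p, c ∉ (Finset.univ.filter (O p)).image
          (fun q => F p q (ψ q)) := by
        apply Finset.exists_mem_notMem_of_card_lt_card
        rw [hL]
        exact (Finset.card_image_le.trans (hO p)).trans_lt (by norm_num)
      refine ⟨Function.update ψ p c, fun v => ?_, fun v hv => ?_, fun p' hp' q hpq => ?_⟩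
      · by_cases hv : v = p
        · subst hv; simpa using hc
        · simpa [hv] using h1 v
      · have hvp : v ≠ p := fun h => hv (h ▸ hp)
        rw [Function.update_of_ne hvp]
        exact h2 v (fun h => hv (Finset.mem_of_mem_erase h))
      · by_cases hpp : p' = p
        · subst hpp
          have hq : q ≠ p' := fun h => hirr _ (h ▸ hpq)
          rw [Function.update_self, Function.update_of_ne hq]
          rintro rfl
          exact hcF (Finset.mem_image.2 ⟨q, by simpa using hpq, rfl⟩)
        · have h4 := h3 p' (Finset.mem_erase.2 ⟨hpp, hp'⟩) q hpq
          rw [Function.update_of_ne hpp]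
          by_cases hq : q = p
          · subst hq
            rwa [hF p' q (hpD p' hp') _ (ψ q)]
          · rwa [Function.update_of_ne hq]
  exact key _ T subset_rfl rfl

end

section
open scoped Classical

/-! ### The graph without fan vertices is dense -/

/-- The graph obtained from `G` by isolating its fan vertices. -/
def core {V : Type*} [Fintype V] (G : SimpleGraph V) : SimpleGraph V where
  Adj u v := G.Adj u v ∧ u ∉ fans G ∧ v ∉ fans G
  symm := ⟨fun _ _ h => ⟨h.1.symm, h.2.2, h.2.1⟩⟩
  loopless := ⟨fun _ h => h.1.ne rfl⟩

section
variable {V : Type} [Fintype V] {G : SimpleGraph V} {L : V → Finset ℕ}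

/-- Each fan vertex `x` has a center `y x` and another neighbor `m x`, chosen so that the pairs
`{y x, m x}` satisfy the strong Hall condition. -/
theorem Critical.exists_pairs (hC : Critical G L) (hpl : IsPlanar G) (h5 : NoC5 G) (h6 : NoC6 G)
    [Nonempty V] : ∃ y m : V → V,
      (∀ x ∈ fans G, G.Adj x (y x) ∧ G.Adj x (m x) ∧ G.Adj (y x) (m x) ∧
        ∀ v, G.Adj x v → v ≠ y x → v ≠ m x → G.Adj v (y x)) ∧
      StrongHall (fans G) fun x => {y x, m x} := by
  have : ∀ x, ∃ y z w, x ∈ fans G → nbrs G x = {y, z, w} ∧ G.Adj y z ∧ G.Adj y w := by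
    intro x
    by_cases hx : x ∈ fans G
    · obtain ⟨hd, y, z, w, hyz, hyw, hzw, hy, hz, hw, ayz, ayw⟩ := mem_fans.1 hx
      exact ⟨y, z, w, fun _ => ⟨nbrs_eq_of_card hd hy hz hw hyz hyw hzw, ayz, ayw⟩⟩
    · exact ⟨x, x, x, fun h => absurd h hx⟩
  choose y z w hyzw using this
  have hH : StrongHall (fans G) fun x => {y x, z x, w x} := by
    intro S hS hne
    have := hpl.card_lt_card_biUnion_nbrs h6 (X := fans G)
      (fun x hx x' hx' => hC.fans_indep hx hx') (fun x hx => (mem_fans.1 hx).1)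
      (fun x hx x' hx' hxx u v huv hu hv hu' hv' =>
        hC.fans_share h5 hx hx' hxx huv hu hv hu' hv') hS hne
    rwa [Finset.biUnion_congr rfl fun x hx => (hyzw x (hS hx)).1] at this
  obtain ⟨m, hm, hHm⟩ := hH.trim
  refine ⟨y, m, fun x hx => ?_, hHm⟩
  obtain ⟨hN, ayz, ayw⟩ := hyzw x hx
  have hN' : ∀ v, G.Adj x v ↔ v = y x ∨ v = z x ∨ v = w x := by
    intro v
    rw [← mem_nbrs, hN]
    simp
  have hadj : G.Adj (y x) (m x) := by rcases hm x with h | h <;> rw [h] <;> assumption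
  refine ⟨(hN' _).2 (Or.inl rfl), (hN' _).2 (Or.inr (hm x)), hadj, fun v hv hvy _ => ?_⟩
  rcases (hN' v).1 hv with h | h | h
  · exact absurd h hvy
  · rw [h]; exact ayz.symm
  · rw [h]; exact ayw.symm

/-- A coloring outside a set `T` of non-fan vertices and the fan vertices adjacent to it, together
with an orientation of the core edges at `T`, extends to a coloring of the whole graph. -/
theorem Critical.not_orientable (hC : Critical G L) (hpl : IsPlanar G) (h5 : NoC5 G)
    (h6 : NoC6 G) {T : Finset V} (hT : T.Nonempty) (hTX : ∀ v ∈ T, v ∉ fans G)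
    {O : V → V → Prop} (hOadj : ∀ p q, O p q → p ∈ T ∧ (core G).Adj p q)
    (hOor : ∀ p q, (core G).Adj p q → p ∈ T → O p q ∨ O q p)
    (hO2 : ∀ p, (Finset.univ.filter (O p)).card ≤ 2) : False := by
  obtain ⟨v₀, hv₀⟩ := hT
  have : Nonempty V := ⟨v₀⟩
  obtain ⟨y, m, hym, hH⟩ := hC.exists_pairs hpl h5 h6
  have hnot : ∀ x ∈ fans G, ∀ v, G.Adj x v → v ∉ fans G := fun x hx v hv hvX =>
    hC.fans_indep hx hvX hv
  set XT := (fans G).filter fun x => ∃ v ∈ T, G.Adj x v with hXT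
  have hXTX : ∀ x ∈ XT, x ∈ fans G := fun x hx => (Finset.mem_filter.1 hx).1
  have : ∀ x, ∃ t h, x ∈ XT → G.Adj x t ∧ G.Adj x h ∧ O t h ∧
      ((t = y x ∧ h = m x ∨ t = m x ∧ h = y x) ∨ h ∉ T) := by
    intro x
    by_cases hx : x ∈ XT
    swap
    · exact ⟨x, x, fun h => absurd h hx⟩
    obtain ⟨hxX, v, hvT, hv⟩ := Finset.mem_filter.1 hx
    obtain ⟨hy, hm, hadj, ho⟩ := hym x hxX
    have hout : ∀ p q, G.Adj x p → G.Adj x q → G.Adj p q → p ∈ T → O p q ∨ O q p :=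
      fun p q hp hq hpq => hOor p q ⟨hpq, hnot x hxX p hp, hnot x hxX q hq⟩
    by_cases hyT : y x ∈ T
    · rcases hout _ _ hy hm hadj hyT with h | h
      · exact ⟨_, _, fun _ => ⟨hy, hm, h, Or.inl (Or.inl ⟨rfl, rfl⟩)⟩⟩
      · exact ⟨_, _, fun _ => ⟨hm, hy, h, Or.inl (Or.inr ⟨rfl, rfl⟩)⟩⟩
    by_cases hmT : m x ∈ T
    · rcases hout _ _ hm hy hadj.symm hmT with h | h
      · exact ⟨_, _, fun _ => ⟨hm, hy, h, Or.inl (Or.inr ⟨rfl, rfl⟩)⟩⟩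
      · exact ⟨_, _, fun _ => ⟨hy, hm, h, Or.inl (Or.inl ⟨rfl, rfl⟩)⟩⟩
    have hvy : G.Adj v (y x) := ho v hv (fun h => hyT (h ▸ hvT)) (fun h => hmT (h ▸ hvT))
    rcases hout _ _ hv hy hvy hvT with h | h
    · exact ⟨_, _, fun _ => ⟨hv, hy, h, Or.inr hyT⟩⟩
    · exact absurd (hOadj _ _ h).1 hyT
  choose t h hth using this
  set D : V → V → Prop := fun p q => ∃ x ∈ XT, t x = p ∧ h x = q with hD
  have huniq : ∀ x ∈ XT, ∀ x' ∈ XT, t x = t x' → h x = h x' → x = x' := by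
    intro x hx x' hx' ht hh
    by_contra hne
    obtain ⟨a1, a2, a3, -⟩ := hth x hx
    obtain ⟨b1, b2, -⟩ := hth x' hx'
    exact hC.fans_share h5 (hXTX x hx) (hXTX x' hx') hne (hOadj _ _ a3).2.ne a1 a2 (ht ▸ b1)
      (hh ▸ b2)
  set F : V → V → ℕ → ℕ := fun p q c =>
    if hpq : D p q then
      if c = common L hpq.choose q then common L hpq.choose p else common L p q
    else common L p q with hF
  have hFD : ∀ x ∈ XT, ∀ c, F (t x) (h x) c =
      if c = common L x (h x) then common L x (t x) else common L (t x) (h x) := by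
    intro x hx c
    have hpq : D (t x) (h x) := ⟨x, hx, rfl, rfl⟩
    have hch := hpq.choose_spec
    have := huniq _ hch.1 x hx hch.2.1 hch.2.2
    simp only [hF, dif_pos hpq, this]
  have hFn : ∀ p q, ¬ D p q → ∀ c, F p q c = common L p q := fun p q hpq c => by
    simp only [hF, dif_neg hpq]
  obtain ⟨φ, hφ, hφp⟩ := hC.crit (T ∪ XT) ⟨v₀, Finset.mem_union_left _ hv₀⟩
  have hac : ∀ W ⊆ T, W.Nonempty → ∃ p ∈ W, ∀ p' ∈ W, ¬ D p' p := by
    intro W hWT hW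
    by_contra! hcon
    have : ∀ p, ∃ x, p ∈ W → x ∈ XT ∧ t x ∈ W ∧ h x = p := by
      intro p
      by_cases hp : p ∈ W
      · obtain ⟨p', hp', x, hx, rfl, hxp⟩ := hcon p hp
        exact ⟨x, fun _ => ⟨hx, hp', hxp⟩⟩
      · exact ⟨p, fun h => absurd h hp⟩
    choose g hg using this
    have hinj : Set.InjOn g W := by
      intro p hp p' hp' hpp
      rw [← (hg p hp).2.2, hpp, (hg p' hp').2.2]
    have h1 := hH (W.image g) (by
      intro x hx
      obtain ⟨p, hp, rfl⟩ := Finset.mem_image.1 hx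
      exact hXTX _ (hg p hp).1) (hW.image g)
    have h2 : (W.image g).biUnion (fun x => {y x, m x}) ⊆ W := by
      intro v hv
      simp only [Finset.mem_biUnion, Finset.mem_image, Finset.mem_insert,
        Finset.mem_singleton] at hv
      obtain ⟨x, ⟨p, hp, rfl⟩, hv⟩ := hv
      obtain ⟨hx, htW, hhp⟩ := hg p hp
      have hhW : h (g p) ∈ W := by rw [hhp]; exact hp
      rcases (hth _ hx).2.2.2 with (⟨e1, e2⟩ | ⟨e1, e2⟩) | hhT
      · rw [e1] at htW; rw [e2] at hhW
        rcases hv with rfl | rfl <;> assumption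
      · rw [e1] at htW; rw [e2] at hhW
        rcases hv with rfl | rfl <;> assumption
      · exact absurd (hWT hhW) hhT
    have h3 := Finset.card_le_card h2
    rw [Finset.card_image_of_injOn hinj] at h1
    omega
  obtain ⟨ψ, hψ, hψφ, hψF⟩ := exists_choice hC.card (F := F)
    (fun p hp => (hOadj _ _ hp).2.ne rfl) hO2
    (fun p q hpq a b => by rw [hFn p q hpq, hFn p q hpq]) hac hφ
  have hproper : ∀ p q, O p q → ψ p ≠ ψ q := by
    intro p q hpq heq
    obtain ⟨hp, hadj, -, -⟩ := hOadj _ _ hpq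
    have hc := hC.eq_common hadj (hψ p) (heq ▸ hψ q)
    have hne := hψF p hp q hpq
    by_cases hDpq : D p q
    · obtain ⟨x, hx, rfl, rfl⟩ := hDpq
      rw [hFD x hx] at hne
      split_ifs at hne with hq
      · refine hC.common_ne (mem_fans.1 (hXTX x hx)).1 (hth x hx).2.1 (hth x hx).1 hadj.symm ?_
        rw [← hq, common_comm, ← hc, heq]
      · exact hne hc
    · rw [hFn _ _ hDpq] at hne
      exact hne hc
  apply hC.not_col
  set χ : V → ℕ := fun v => if v ∈ XT then
    if ψ (h v) = common L v (h v) then common L v (t v) else common L v (h v) else ψ v with hχ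
  have hχψ : ∀ v, v ∉ XT → χ v = ψ v := fun v hv => by simp only [hχ, if_neg hv]
  have hχX : ∀ x ∈ XT, ∀ v, G.Adj x v → χ x ≠ χ v := by
    intro x hx v hv
    have hd := (mem_fans.1 (hXTX x hx)).1
    obtain ⟨ht, hh, hO, -⟩ := hth x hx
    rw [hχψ v fun hvX => hnot x (hXTX x hx) v hv (hXTX v hvX)]
    simp only [hχ, if_pos hx]
    split_ifs with hc
    · refine hC.ne_of_common hd ht hv (hψ v) ?_
      rintro rfl
      have := hψF _ (hOadj _ _ hO).1 _ hO
      rwa [hFD x hx, if_pos hc] at this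
    · refine hC.ne_of_common hd hh hv (hψ v) ?_
      rintro rfl
      exact hc
  refine ⟨χ, fun v => ?_, fun u v huv => ?_⟩
  · by_cases hv : v ∈ XT
    · obtain ⟨ht, hh, -⟩ := hth v hv
      simp only [hχ, if_pos hv]
      split_ifs
      · exact (hC.common_mem ht).1
      · exact (hC.common_mem hh).1
    · rw [hχψ v hv]; exact hψ v
  · by_cases hu : u ∈ XT
    · exact hχX u hu v huv
    by_cases hv : v ∈ XT
    · exact (hχX v hv u huv.symm).symm
    rw [hχψ u hu, hχψ v hv]
    have hXT' : ∀ a b, G.Adj a b → a ∈ T → b ∉ XT → b ∉ fans G := fun a b hab ha hb hbX =>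
      hb (Finset.mem_filter.2 ⟨hbX, a, ha, hab.symm⟩)
    by_cases huT : u ∈ T
    · rcases hOor u v ⟨huv, hTX u huT, hXT' u v huv huT hv⟩ huT with h | h
      · exact hproper _ _ h
      · exact (hproper _ _ h).symm
    by_cases hvT : v ∈ T
    · rcases hOor v u ⟨huv.symm, hTX v hvT, hXT' v u huv.symm hvT hu⟩ hvT with h | h
      · exact (hproper _ _ h).symm
      · exact hproper _ _ h
    rw [hψφ u huT, hψφ v hvT]
    exact hφp u v (by simp [huT, hu]) (by simp [hvT, hv]) huv

theorem Critical.two_mul_card_lt_card_touch (hC : Critical G L) (hpl : IsPlanar G) (h5 : NoC5 G)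
    (h6 : NoC6 G) {T : Finset V} (hT : T.Nonempty) (hTX : ∀ v ∈ T, v ∉ fans G) :
    2 * T.card < (touch (core G) T).card := by
  induction T using Finset.strongInduction with
  | H T ih =>
    by_contra! hcard
    obtain ⟨O, h1, h2, h3⟩ := exists_orientation hcard
      (fun T' hT' hne => ih T' hT' hne fun v hv => hTX v (hT'.1 hv))
    exact hC.not_orientable hpl h5 h6 hT hTX h1 h2 h3

end
end

section
open scoped Classical

/-! ### Conclusion -/

section
variable {V : Type} [Fintype V] {G : SimpleGraph V} {L : V → Finset ℕ}

theorem Critical.two_lt_card_nbrs_core (hC : Critical G L) (hpl : IsPlanar G) (h5 : NoC5 G)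
    (h6 : NoC6 G) {u : V} (hu : u ∉ fans G) : 2 < (nbrs (core G) u).card := by
  have h1 := hC.two_mul_card_lt_card_touch hpl h5 h6 (T := {u}) ⟨u, by simp⟩ (by simpa using hu)
  have h2 : touch (core G) {u} ⊆ (nbrs (core G) u).image (fun v => s(u, v)) := by
    intro e
    induction e with
    | h p q =>
      rw [mem_touch]
      simp only [Finset.mem_singleton, Finset.mem_image, mem_nbrs]
      rintro ⟨hpq, rfl | rfl⟩
      · exact ⟨q, hpq, rfl⟩
      · exact ⟨p, hpq.symm, Sym2.eq_swap⟩
  have h3 := (Finset.card_le_card h2).trans Finset.card_image_le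
  rw [Finset.card_singleton] at h1
  omega

theorem Critical.card_nbrs_core_ne (hC : Critical G L) (h5 : NoC5 G) {u a b c : V}
    (ha : (core G).Adj u a) (hb : (core G).Adj u b) (hc : (core G).Adj u c) (hab : a ≠ b)
    (hac : a ≠ c) (hbc : b ≠ c) (aab : G.Adj a b) (abc : G.Adj b c) :
    (nbrs (core G) u).card ≠ 3 := by
  intro hcard
  have hN := nbrs_eq_of_card hcard ha hb hc hab hac hbc
  have habc : ∀ v, v ∉ fans G → G.Adj u v → v = a ∨ v = b ∨ v = c := by
    intro v hv huv
    have := mem_nbrs.2 (show (core G).Adj u v from ⟨huv, ha.2.1, hv⟩)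
    rw [hN] at this
    simpa using this
  by_cases hX : ∃ x ∈ fans G, G.Adj x u
  · obtain ⟨x, hx, hxu⟩ := hX
    have hxn : ∀ v, v ∉ fans G → x ≠ v := fun v hv h => hv (h ▸ hx)
    have hxa : ¬ G.Adj x a := fun h =>
      h5 x a b c u h aab abc hc.1.symm hxu.symm (hxn _ hb.2.2) (hxn _ hc.2.2) hac ha.1.ne.symm
        hb.1.ne.symm
    have hxc : ¬ G.Adj x c := fun h =>
      h5 x c b a u h abc.symm aab.symm ha.1.symm hxu.symm (hxn _ hb.2.2) (hxn _ ha.2.2) hac.symm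
        hc.1.ne.symm hb.1.ne.symm
    have hnot : ∀ v, G.Adj x v → v ∉ fans G := fun v hv hvX => hC.fans_indep hx hvX hv
    have hxb : ∀ v, G.Adj x v → G.Adj u v → v = b := by
      intro v hv huv
      rcases habc v (hnot v hv) huv with rfl | rfl | rfl
      · exact absurd hv hxa
      · rfl
      · exact absurd hv hxc
    obtain ⟨q, hq, huq⟩ := exists_adj_of_mem_fans hx hxu
    obtain rfl := hxb q hq huq
    obtain ⟨r, hr, hru, hrq⟩ : ∃ r, G.Adj x r ∧ r ≠ u ∧ r ≠ q := by
      by_contra! hcon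
      have : nbrs G x ⊆ {u, q} := by
        intro r hr
        rw [mem_nbrs] at hr
        simp only [Finset.mem_insert, Finset.mem_singleton]
        by_cases h : r = u
        · exact Or.inl h
        · exact Or.inr (hcon r hr h)
      have := (Finset.card_le_card this).trans Finset.card_le_two
      have := (mem_fans.1 hx).1
      omega
    obtain ⟨r', hr', hrr⟩ := exists_adj_of_mem_fans hx hr
    have hv := mem_nbrs.2 hr'
    rw [nbrs_eq_of_card (mem_fans.1 hx).1 hr hxu hq hru hrq huq.ne] at hv
    simp only [Finset.mem_insert, Finset.mem_singleton] at hv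
    rcases hv with rfl | rfl | rfl
    · exact hrr.ne rfl
    · exact hrq (hxb r hr hrr.symm)
    · exact h5 u x r r' a hxu.symm hr hrr aab.symm ha.1.symm hru.symm huq.ne hq.ne
        (hxn _ ha.2.2) (fun h => hxa (h ▸ hr))
  · push Not at hX
    refine ha.2.1 (mem_fans.2 ⟨?_, b, a, c, hab.symm, hbc, hac, hb.1, ha.1, hc.1, aab.symm, abc⟩)
    rw [← hcard]
    congr 1
    ext v
    rw [mem_nbrs, mem_nbrs]
    exact ⟨fun h => ⟨h, ha.2.1, fun hv => hX v hv h.symm⟩, fun h => h.1⟩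

/-- There is no critical list assignment of a planar graph without cycles of length 5 and 6. -/
theorem Critical.not_isPlanar (hC : Critical G L) (h5 : NoC5 G) (h6 : NoC6 G) :
    ¬ IsPlanar G := by
  intro hpl
  set H : SimpleGraph {v // v ∉ fans G} := G.comap Subtype.val with hH
  have hadj : ∀ u v, H.Adj u v ↔ (core G).Adj u v := fun u v =>
    ⟨fun h => ⟨h, u.2, v.2⟩, fun h => h.1⟩
  have hnbrs : ∀ u, (nbrs H u).card = (nbrs (core G) u).card := by
    intro u
    rw [← Finset.card_map ⟨Subtype.val, Subtype.val_injective⟩]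
    congr 1
    ext v
    simp only [Finset.mem_map, mem_nbrs, Function.Embedding.coeFn_mk]
    constructor
    · rintro ⟨v, hv, rfl⟩
      exact (hadj u v).1 hv
    · intro h
      exact ⟨⟨v, h.2.2⟩, h.1, rfl⟩
  have hplH : IsPlanar H := hpl.of_hom Subtype.val_injective fun a b h => h
  obtain ⟨R, hE⟩ := hplH.exists_euler
  have hne : ∀ {a b : {v // v ∉ fans G}}, a ≠ b → a.1 ≠ b.1 := fun h h' => h (Subtype.ext h')
  have hR : R.Sparse :=
    { c5 := fun a b c d e h1 h2 h3 h4 h5' n1 n2 n3 n4 n5 =>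
        h5 a b c d e h1 h2 h3 h4 h5' (hne n1) (hne n2) (hne n3) (hne n4) (hne n5)
      c6 := fun a b c d e f h1 h2 h3 h4 h5' h6' n1 n2 n3 n4 n5 n6 n7 n8 n9 =>
        h6 a b c d e f h1 h2 h3 h4 h5' h6' (hne n1) (hne n2) (hne n3) (hne n4) (hne n5) (hne n6)
          (hne n7) (hne n8) (hne n9)
      deg := fun v => by
        rw [hnbrs]
        exact hC.two_lt_card_nbrs_core hpl h5 h6 v.2
      no3 := fun u a b c ha hb hc nab nac nbc aab abc => by
        rw [hnbrs]
        exact hC.card_nbrs_core_ne h5 ((hadj _ _).1 ha) ((hadj _ _).1 hb) ((hadj _ _).1 hc)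
          (hne nab) (hne nac) (hne nbc) aab abc }
  have h1 := hR.card_darts_le hE
  have hT : (Finset.univ.filter (· ∉ fans G)).Nonempty := by
    obtain ⟨v⟩ : Nonempty V := by
      by_contra hem
      rw [not_nonempty_iff] at hem
      exact hC.not_col ⟨fun _ => 0, fun v => hem.elim v, fun v => hem.elim v⟩
    by_cases hv : v ∈ fans G
    · obtain ⟨-, y, -, -, -, -, -, hy, -⟩ := mem_fans.1 hv
      exact ⟨y, by simpa using fun h => hC.fans_indep hv h hy⟩
    · exact ⟨v, by simpa using hv⟩
  have h2 := hC.two_mul_card_lt_card_touch hpl h5 h6 hT (by simp)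
  have h3 : (touch (core G) (Finset.univ.filter (· ∉ fans G))).card ≤ (core G).edgeFinset.card :=
    Finset.card_le_card (Finset.filter_subset _ _)
  have h4 := (core G).dart_card_eq_twice_card_edges
  have h5' : Fintype.card (core G).Dart ≤ (darts H).card := by
    rw [← Fintype.card_coe]
    refine Fintype.card_le_of_injective (fun d => ⟨(⟨d.fst, d.adj.2.1⟩, ⟨d.snd, d.adj.2.2⟩),
      mem_darts.2 d.adj.1⟩) fun d d' h => ?_
    simp only [Subtype.mk.injEq, Prod.mk.injEq] at h
    exact SimpleGraph.Dart.ext _ _ (Prod.ext h.1 h.2)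
  rw [Fintype.card_subtype] at h1
  omega

end

/-- List coloring from lists of size at least three sharing at most one color along edges. -/
theorem IsPlanar.colorableWith {V : Type} [Fintype V] {G : SimpleGraph V} {L : V → Finset ℕ}
    (hpl : IsPlanar G) (h5 : NoC5 G) (h6 : NoC6 G) (hL : ∀ v, 3 ≤ (L v).card)
    (hint : ∀ u v, G.Adj u v → (L u ∩ L v).card ≤ 1) : ColorableWith G L := by
  induction hn : Fintype.card V using Nat.strong_induction_on generalizing V with
  | _ n ih =>
  subst hn
  by_contra hcol
  choose L' hL' hL3 using fun v => Finset.exists_subset_card_eq (hL v)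
  have hint' : ∀ u v, G.Adj u v → (L' u ∩ L' v).card ≤ 1 := fun u v huv =>
    (Finset.card_le_card (Finset.inter_subset_inter (hL' u) (hL' v))).trans (hint u v huv)
  set G' : SimpleGraph V :=
    { Adj := fun u v => G.Adj u v ∧ (L' u ∩ L' v).card = 1
      symm := ⟨fun u v h => ⟨h.1.symm, by rw [Finset.inter_comm]; exact h.2⟩⟩
      loopless := ⟨fun _ h => h.1.ne rfl⟩ } with hG'
  have h5' : NoC5 G' := fun a b c d e k1 k2 k3 k4 k5 =>
    h5 a b c d e k1.1 k2.1 k3.1 k4.1 k5.1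
  have h6' : NoC6 G' := fun a b c d e f k1 k2 k3 k4 k5 k6 =>
    h6 a b c d e f k1.1 k2.1 k3.1 k4.1 k5.1 k6.1
  have hpl' : IsPlanar G' := hpl.of_hom Function.injective_id fun _ _ h => h.1
  refine Critical.not_isPlanar (G := G') (L := L') ⟨hL3, fun u v h => h.2, ?_, ?_⟩ h5' h6' hpl'
  · rintro ⟨φ, hφ, hp⟩
    refine hcol ⟨φ, fun v => hL' v (hφ v), fun u v huv heq => ?_⟩
    have : (L' u ∩ L' v).Nonempty := ⟨φ u, Finset.mem_inter.2 ⟨hφ u, heq ▸ hφ v⟩⟩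
    exact hp (u := u) (v := v) ⟨huv, le_antisymm (hint' u v huv) (Finset.card_pos.2 this)⟩ heq
  · intro T ⟨w, hw⟩
    have hne : ∀ {a b : {v // v ∉ T}}, a ≠ b → a.1 ≠ b.1 := fun h h' => h (Subtype.ext h')
    obtain ⟨φ, hφ, hp⟩ := ih (Fintype.card {v // v ∉ T})
      (Fintype.card_subtype_lt (x := w) (by simpa using hw))
      (G := G'.comap Subtype.val) (L := fun v => L' v)
      (hpl'.of_hom Subtype.val_injective fun a b h => h)
      (fun a b c d e k1 k2 k3 k4 k5 n1 n2 n3 n4 n5 =>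
        h5' a.1 b.1 c.1 d.1 e.1 k1 k2 k3 k4 k5 (hne n1) (hne n2) (hne n3) (hne n4) (hne n5))
      (fun a b c d e f k1 k2 k3 k4 k5 k6 n1 n2 n3 n4 n5 n6 n7 n8 n9 =>
        h6' a.1 b.1 c.1 d.1 e.1 f.1 k1 k2 k3 k4 k5 k6 (hne n1) (hne n2) (hne n3) (hne n4) (hne n5) (hne n6)
          (hne n7) (hne n8) (hne n9))
      (fun v => (hL3 v).ge) (fun u v h => h.2.le) rfl
    have : ∀ v, ∃ c, c ∈ L' v := fun v => Finset.card_pos.1 (by rw [hL3]; norm_num)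
    choose d hd using this
    refine ⟨fun v => if hv : v ∉ T then φ ⟨v, hv⟩ else d v, fun v => ?_, fun u v hu hv huv => ?_⟩
    · dsimp only
      split_ifs with hv
      · exact hd v
      · exact hφ ⟨v, hv⟩
    · simp only [dif_pos hu, dif_pos hv]
      exact hp (u := ⟨u, hu⟩) (v := ⟨v, hv⟩) huv

theorem noC5_of_not_hasCycleLen {V : Type} {G : SimpleGraph V} (h : ¬ HasCycleLen G 5) :
    NoC5 G := by
  intro a b c d e h1 h2 h3 h4 h5 n1 n2 n3 n4 n5
  refine h ⟨a, .cons h1 (.cons h2 (.cons h3 (.cons h4 (.cons h5 .nil)))), ?_, rfl⟩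
  have := h1.ne; have := h2.ne; have := h3.ne; have := h4.ne; have := h5.ne
  simp [SimpleGraph.Walk.cons_isCycle_iff, SimpleGraph.Walk.cons_isPath_iff]
  grind

theorem noC6_of_not_hasCycleLen {V : Type} {G : SimpleGraph V} (h : ¬ HasCycleLen G 6) :
    NoC6 G := by
  intro a b c d e f h1 h2 h3 h4 h5 h6 n1 n2 n3 n4 n5 n6 n7 n8 n9
  refine h ⟨a, .cons h1 (.cons h2 (.cons h3 (.cons h4 (.cons h5 (.cons h6 .nil))))), ?_, rfl⟩
  have := h1.ne; have := h2.ne; have := h3.ne; have := h4.ne; have := h5.ne; have := h6.ne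
  simp [SimpleGraph.Walk.cons_isCycle_iff, SimpleGraph.Walk.cons_isPath_iff]
  grind

end

/-- **Theorem.** Every planar graph with no cycle of length 5 and no cycle of
length 6 is `(3,1)`-choosable. -/
theorem C5C6free_planar_choosable_3_1 {V : Type} [Fintype V]
    (G : SimpleGraph V) (hplanar : IsPlanar G)
    (hC5 : ¬ HasCycleLen G 5) (hC6 : ¬ HasCycleLen G 6) :
    Choosable G 3 1 := by
  exact fun _ hL hint => hplanar.colorableWith (noC5_of_not_hasCycleLen hC5)
    (noC6_of_not_hasCycleLen hC6) hL fun _ _ h => hint h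

end ChoosSep
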